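/- Suppose a : I × I → ℤ is a symmetrizable generalized Cartan matrix, i.e. a(i,i) = 2 for all i, a(i,j) ≤ 0 for all i ≠ j, and there exist positive integers d_i (i ∈ I) with d_i · a(i,j) = d_j · a(j,i) for all i,j. Suppose L(i) ≥ 0 for all i ∈ I. Then for every n ∈ ℕ and all ν, ν' ∈ I^n, Σ_{w ∈ S(ν,ν')} ∏_{t=1}^{n} N(w,ν,t) ≥ 0. (This non-negativity is established in the paper as a consequence of Corollary 3.2, since the sum equals dim e(ν)R^Λ(β)e(ν') for the cyclotomic quiver Hecke algebra R^Λ(β).) -/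

import Mathlib

/-- `N(w,ν,t) = L(ν_t) − Σ_{j ∈ J_w^{<t}} a(ν_t, ν_j)`, where
`J_w^{<t} = {j < t : w(j) < w(t)}`. -/
def Nfun {I : Type*} (a : I → I → ℤ) (L : I → ℤ) {n : ℕ}
    (w : Equiv.Perm (Fin n)) (ν : Fin n → I) (t : Fin n) : ℤ :=
  L (ν t) - ∑ j ∈ Finset.univ.filter (fun j => j < t ∧ w j < w t), a (ν t) (ν j)

section
open Polynomial Module

theorem coker_aux {k : Type} [Field k] {J : Type} [Fintype J] [DecidableEq J] (A : Matrix J J k[X]) (hA : A.det ≠ 0) :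
    Module.Finite k ((J → k[X]) ⧸ LinearMap.range A.mulVecLin) ∧
    Module.finrank k ((J → k[X]) ⧸ LinearMap.range A.mulVecLin) = A.det.natDegree := by
  have hinj : Function.Injective A.mulVecLin := by
    intro u v h
    exact Matrix.mulVec_injective_of_det_ne_zero hA h
  let e := LinearEquiv.ofInjective A.mulVecLin hinj
  have h : Module.finrank k[X] (LinearMap.range A.mulVecLin) = Module.finrank k[X] (J → k[X]) :=
    e.symm.finrank_eq
  let b := Pi.basisFun k[X] J
  let a := Submodule.smithNormalFormCoeffs b h
  let b' := Submodule.smithNormalFormTopBasis b h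
  let ab := Submodule.smithNormalFormBotBasis b h
  have ab_eq := Submodule.smithNormalFormBotBasis_def b h
  have ha0 : ∀ i, a i ≠ 0 := Submodule.smithNormalFormCoeffs_ne_zero b h
  have fin : ∀ i, Module.Finite k (k[X] ⧸ Ideal.span ({Submodule.smithNormalFormCoeffs b h i} : Set k[X])) :=
    fun i => PowerBasis.finite <| AdjoinRoot.powerBasis (ha0 i)
  refine ⟨Module.Finite.equiv ((Submodule.quotientEquivPiSpan _ b h).restrictScalars k).symm, ?_⟩
  rw [Submodule.finrank_quotient_eq_sum k b h]
  have hdet : Associated (A.det) (∏ i, a i) := by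
    let e' : (J → k[X]) ≃ₗ[k[X]] (LinearMap.range A.mulVecLin) := b'.equiv ab (Equiv.refl _)
    let f : (J → k[X]) →ₗ[k[X]] (J → k[X]) := (Submodule.subtype (LinearMap.range A.mulVecLin)).comp e'.toLinearMap
    have hf : LinearMap.det f = ∏ i, a i := by
      rw [← LinearMap.det_toMatrix b', ← Matrix.det_diagonal]
      congr 1
      ext i j
      rw [LinearMap.toMatrix_apply]
      have : f (b' j) = a j • b' j := by
        simp only [f, e', LinearMap.comp_apply, LinearEquiv.coe_coe, Basis.equiv_apply,
          Equiv.refl_apply, Submodule.subtype_apply]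
        exact ab_eq j
      rw [this, map_smul, Basis.repr_self, Finsupp.smul_single, smul_eq_mul, mul_one]
      by_cases h : i = j
      · rw [h, Matrix.diagonal_apply_eq, Finsupp.single_eq_same]
      · rw [Matrix.diagonal_apply_ne _ h, Finsupp.single_eq_of_ne h]
    rw [← hf, ← LinearMap.det_toLin']
    refine LinearMap.associated_det_of_eq_comp (e.trans e'.symm) _ _ ?_
    intro x
    simp [f]
    rfl
  rw [natDegree_eq_of_degree_eq (degree_eq_degree_of_associated hdet),
    natDegree_prod _ _ fun i _ => ha0 i]
  congr with i
  exact (AdjoinRoot.powerBasis (ha0 i)).finrank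

theorem deg_aux {k : Type} [Field k] [CharZero k] {S : Type} [Fintype S] [DecidableEq S] (E y : Matrix S S k)
    (hE : E * E = E) (hy : E * y = y * E) :
    ∃ q : k[X], q.Monic ∧ q.natDegree = E.rank ∧
      (E.map C * ((X : k[X]) • (1 : Matrix S S k[X]) + y.map C) + (1 - E.map C)).det = q := by
  let f := Matrix.toLin' E
  let R := LinearMap.range f
  have hff : ∀ v, f (f v) = f v := by
    intro v
    simp only [f, Matrix.toLin'_apply, Matrix.mulVec_mulVec, hE]
  have hproj : LinearMap.IsProj R f :=
    ⟨fun v => ⟨v, rfl⟩, by rintro _ ⟨v, rfl⟩; exact hff v⟩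
  let Y := Matrix.toLin' y
  have hY : ∀ v, f (Y v) = Y (f v) := by
    intro v
    simp only [f, Y, Matrix.toLin'_apply, Matrix.mulVec_mulVec, hy]
  have hYR : ∀ v ∈ R, Y v ∈ R := by
    rintro _ ⟨v, rfl⟩
    exact ⟨Y v, hY v⟩
  let y' : R →ₗ[k] R := Y.restrict hYR
  refine ⟨(-y').charpoly, LinearMap.charpoly_monic _, ?_, ?_⟩
  · rw [LinearMap.charpoly_natDegree]
    rfl
  refine Polynomial.funext fun s => ?_
  rw [LinearMap.eval_charpoly, ← Polynomial.coe_evalRingHom, RingHom.map_det]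
  have h1 : (evalRingHom s).mapMatrix (E.map C * ((X : k[X]) • (1 : Matrix S S k[X]) + y.map C) + (1 - E.map C))
      = E * (s • 1 + y) + (1 - E) := by
    simp only [map_add, map_mul, map_sub, map_one]
    have h2 : ∀ Z : Matrix S S k, (evalRingHom s).mapMatrix (Z.map C) = Z := by
      intro Z; ext i j; simp
    rw [h2, h2]
    congr 3
    ext i j; by_cases h : i = j <;> simp [h]
  rw [h1, ← LinearMap.det_toLin']
  let e := R.prodEquivOfIsCompl (LinearMap.ker f) hproj.isCompl
  rw [← LinearMap.det_conj _ e.symm]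
  have : e.symm.toLinearMap ∘ₗ Matrix.toLin' (E * (s • 1 + y) + (1 - E)) ∘ₗ e.symm.symm.toLinearMap
     = LinearMap.prodMap ((algebraMap k (Module.End k R)) s - -y') (1 : Module.End k _) := by
    apply LinearMap.ext
    rintro ⟨u, v⟩
    simp only [LinearMap.comp_apply, LinearEquiv.coe_coe, LinearEquiv.symm_symm]
    rw [LinearEquiv.symm_apply_eq]
    have e1 : ∀ u v, e (u, v) = u.1 + v.1 := by
      intro u v; simp [e]
    rw [LinearMap.prodMap_apply, e1, e1]
    have hu : f u.1 = u.1 := hproj.map_id _ u.2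
    have hv : f v.1 = 0 := v.2
    have key : ∀ w, Matrix.toLin' (E * (s • 1 + y) + (1 - E)) w = s • f w + f (Y w) + w - f w := by
      intro w
      simp [f, Y, Matrix.mul_add, Matrix.add_mulVec, Matrix.sub_mulVec, Matrix.mulVec_mulVec, Matrix.smul_mulVec]
      abel
    rw [key, map_add, map_add, map_add, hY v, hu, hv, hY u, hu]
    simp [y', Module.algebraMap_end_apply]
    abel
  rw [this, LinearMap.det_prodMap]
  simp
end

section
open Polynomial Module
set_option linter.unusedSectionVars false
set_option linter.unusedSimpArgs false
set_option linter.unusedVariables false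

/-- complete homogeneous polynomial of degree `m-1` in two variables -/
def hh {A : Type*} [Ring A] (m : ℕ) (u v : A) : A :=
  ∑ r ∈ Finset.range m, u ^ r * v ^ (m - 1 - r)

/-- The relations of the quiver Hecke algebra. -/
structure KRel {I : Type*} [Fintype I] [DecidableEq I] (p : I → I → ℕ) {A : Type*} [Ring A]
    (x : ℕ → A) (e : ℕ → I → A) (τ : ℕ → A) : Prop where
  xx : ∀ k l, x k * x l = x l * x k
  xe : ∀ k l j, x k * e l j = e l j * x k
  ee : ∀ k l j j', e k j * e l j' = e l j' * e k j
  eid : ∀ k j, e k j * e k j = e k j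
  eorth : ∀ k j j', j ≠ j' → e k j * e k j' = 0
  tx : ∀ k l, l ≠ k → l ≠ k + 1 → τ k * x l = x l * τ k
  te : ∀ k l j, l ≠ k → l ≠ k + 1 → τ k * e l j = e l j * τ k
  te1 : ∀ k j, τ k * e (k + 1) j = e k j * τ k
  te0 : ∀ k j, τ k * e k j = e (k + 1) j * τ k
  tx1 : ∀ k, τ k * x (k + 1) = x k * τ k + ∑ j, e k j * e (k + 1) j
  tx0 : ∀ k, x (k + 1) * τ k = τ k * x k + ∑ j, e k j * e (k + 1) j
  teps0 : ∀ k, (∑ j, e k j) * τ k = τ k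
  teps1 : ∀ k, (∑ j, e (k + 1) j) * τ k = τ k
  tt : ∀ k, τ k * τ k = ∑ j, ∑ l, if j = l then 0 else
    e k j * e (k + 1) l * (x k ^ p j l + x (k + 1) ^ p l j)
  far : ∀ k l, k + 1 < l → τ k * τ l = τ l * τ k
  br : ∀ k, τ k * τ (k + 1) * τ k + (∑ j, ∑ l, if j = l then 0 else
    e k j * e (k + 1) l * e (k + 2) j * hh (p j l) (x k) (x (k + 2))) =
      τ (k + 1) * τ k * τ (k + 1)

theorem map_hh {A B : Type*} [Ring A] [Ring B] (f : A →+* B) (m : ℕ) (u v : A) :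
    f (hh m u v) = hh m (f u) (f v) := by
  simp [hh]

theorem KRel.map {I : Type*} [Fintype I] [DecidableEq I] {p : I → I → ℕ} {A : Type*} [Ring A]
    {x : ℕ → A} {e : ℕ → I → A} {τ : ℕ → A} (H : KRel p x e τ) {B : Type*} [Ring B] (f : A →+* B) :
    KRel p (fun k => f (x k)) (fun k j => f (e k j)) (fun k => f (τ k)) where
  xx k l := by simp only [← map_mul, H.xx k l]
  xe k l j := by simp only [← map_mul, H.xe k l]
  ee k l j j' := by simp only [← map_mul, H.ee k l j j']
  eid k j := by simp only [← map_mul, H.eid]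
  eorth k j j' h := by simp only [← map_mul, H.eorth k j j' h, map_zero]
  tx k l h h' := by simp only [← map_mul, H.tx k l h h']
  te k l j h h' := by simp only [← map_mul, H.te k l j h h']
  te1 k j := by simp only [← map_mul, H.te1]
  te0 k j := by simp only [← map_mul, H.te0]
  tx1 k := by simp only [← map_mul, H.tx1, ← map_add, ← map_sum]
  tx0 k := by simp only [← map_mul, H.tx0, ← map_add, ← map_sum]
  teps0 k := by simp only [← map_mul, H.teps0, ← map_add, ← map_sum]
  teps1 k := by simp only [← map_mul, H.teps1, ← map_add, ← map_sum]
  tt k := by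
    rw [← map_mul, H.tt, map_sum]
    refine Finset.sum_congr rfl fun j _ => ?_
    rw [map_sum]
    refine Finset.sum_congr rfl fun l _ => ?_
    split_ifs <;> simp
  far k l h := by simp only [← map_mul, H.far k l h]
  br k := by
    simp only [← map_mul]
    rw [← H.br, map_add, map_sum]
    congr 1
    refine Finset.sum_congr rfl fun j _ => ?_
    rw [map_sum]
    refine Finset.sum_congr rfl fun l _ => ?_
    split_ifs <;> simp [map_hh]

theorem hh_mul {A : Type*} [Ring A] (m : ℕ) (u v : A) (h : Commute u v) :
    (u - v) * hh m u v = u ^ m - v ^ m := by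
  unfold hh
  exact h.mul_geom_sum₂ m

theorem hh_comm {A : Type*} [Ring A] (m : ℕ) (u v : A) (h : Commute u v) :
    hh m u v = hh m v u := by
  unfold hh
  exact h.geom_sum₂_comm m

theorem hh_succ {A : Type*} [Ring A] (m : ℕ) (u v : A) (h : Commute u v) :
    hh (m + 1) u v = u ^ m + v * hh m u v := by
  simp only [hh, Nat.add_sub_cancel]
  rw [Commute.geom_sum₂_succ_eq h]

theorem hh_succ' {A : Type*} [Ring A] (m : ℕ) (u v : A) (h : Commute u v) :
    hh (m + 1) u v = v ^ m + u * hh m u v := by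
  rw [hh_comm _ _ _ h, hh_succ _ _ _ h.symm, hh_comm _ _ _ h]

section Plevel
variable {I : Type*} [Fintype I] [DecidableEq I] {p : I → I → ℕ} {B : Type*} [Ring B]
    {x : ℕ → B} {e : ℕ → I → B} {τ : ℕ → B}

/-- Bundle of the extra data needed to induce. -/
structure KExt (x : ℕ → B) (t : B) (Z : ℕ → B) : Prop where
  ct : ∀ b, Commute t b
  z1 : ∀ k, (t - x k) * Z k = 1
  z2 : ∀ k, Z k * (t - x k) = 1

def gg (e : ℕ → I → B) (Z : ℕ → B) (i : I) (k : ℕ) : B := e k i * Z k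
def qt (p : I → I → ℕ) (x : ℕ → B) (e : ℕ → I → B) (t : B) (i : I) (k : ℕ) : B :=
  ∑ j, if j = i then 0 else e k j * (t ^ p i j + x k ^ p j i)
def ep (e : ℕ → I → B) (k : ℕ) : B := ∑ j, e k j
def DD (p : I → I → ℕ) (x : ℕ → B) (e : ℕ → I → B) (i : I) (k : ℕ) : B :=
  ∑ j, if j = i then 0 else e k j * e (k + 1) j * hh (p j i) (x k) (x (k + 1))

theorem KExt.zc {t : B} {Z : ℕ → B} (X : KExt x t Z) {b : B} {k : ℕ} (h : Commute (x k) b) :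
    Commute (Z k) b := by
  have h1 : Commute (t - x k) b := (X.ct b).sub_left h
  have h1 := h1.eq
  show Z k * b = b * Z k
  calc Z k * b = Z k * (b * ((t - x k) * Z k)) := by rw [X.z1, mul_one]
    _ = Z k * ((t - x k) * b) * Z k := by rw [h1]; noncomm_ring
    _ = (Z k * (t - x k)) * b * Z k := by noncomm_ring
    _ = b * Z k := by rw [X.z2, one_mul]

variable (H : KRel p x e τ) {t : B} {Z : ℕ → B} (X : KExt x t Z) (i : I)
include H X

theorem cgx (k l) : Commute (gg e Z i k) (x l) :=
  Commute.mul_left (H.xe _ _ _).symm (X.zc (H.xx _ _))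
theorem cge (k l j) : Commute (gg e Z i k) (e l j) :=
  Commute.mul_left (H.ee _ _ _ _) (X.zc (H.xe _ _ _))
theorem cgg (k l) : Commute (gg e Z i k) (gg e Z i l) :=
  Commute.mul_right (cge H X i k l i) (X.zc (cgx H X i k l).symm).symm
theorem cgt (k l) (h : k ≠ l) (h' : k ≠ l + 1) : Commute (τ l) (gg e Z i k) :=
  Commute.mul_right (H.te l k i h h') (X.zc (H.tx l k h h').symm).symm

theorem g_x (k) : (t - x k) * gg e Z i k = e k i := by
  have : Commute (t - x k) (e k i) := (X.ct _).sub_left (H.xe k k i)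
  rw [gg, ← mul_assoc, this.eq, mul_assoc, X.z1, mul_one]
theorem e_g (k) : e k i * gg e Z i k = gg e Z i k := by
  rw [gg, ← mul_assoc, H.eid]
theorem e_g_ne (k j) (h : j ≠ i) : e k j * gg e Z i k = 0 := by
  rw [gg, ← mul_assoc, H.eorth k j i h, zero_mul]
theorem g_S (k) : gg e Z i k * (∑ j, e k j * e (k + 1) j) = gg e Z i k * e (k + 1) i := by
  rw [Finset.mul_sum, Finset.sum_eq_single i]
  · rw [← mul_assoc, (cge H X i k k i).eq, e_g H X]
  · intro j _ hj
    rw [← mul_assoc, (cge H X i k k j).eq, e_g_ne H X i k j hj, zero_mul]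
  · simp

theorem r1 (k) : τ k * gg e Z i (k + 1) = gg e Z i k * τ k + gg e Z i k * gg e Z i (k + 1) := by
  have h1 : τ k * gg e Z i (k + 1) = gg e Z i k * ((t - x k) * τ k) * gg e Z i (k + 1) := by
    have : Commute (t - x k) (gg e Z i k) := (X.ct _).sub_left (cgx H X i k k).symm
    rw [← mul_assoc, ← this.eq, g_x H X i k, ← H.te1, mul_assoc, e_g H X]
  have h2 : (t - x k) * τ k = τ k * (t - x (k + 1)) + ∑ j, e k j * e (k + 1) j := by
    rw [sub_mul, mul_sub, H.tx1, (X.ct (τ k)).eq]; abel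
  rw [h1, h2, mul_add, add_mul, g_S H X]
  rw [mul_assoc (gg e Z i k), mul_assoc (τ k), g_x H X, H.te1, ← mul_assoc,
    (cge H X i k k i).eq, e_g H X, mul_assoc, e_g H X]

theorem r2 (k) : gg e Z i (k + 1) * τ k = τ k * gg e Z i k + gg e Z i k * gg e Z i (k + 1) := by
  have h1 : gg e Z i (k + 1) * τ k = gg e Z i (k + 1) * (τ k * (t - x k)) * gg e Z i k := by
    rw [← e_g H X i (k + 1), (cge H X i (k+1) (k+1) i).symm.eq, mul_assoc, ← H.te0, ← g_x H X i k]
    rw [g_x H X, (cge H X i (k+1) (k+1) i).eq, e_g H X, ← g_x H X i k]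
    noncomm_ring
  have h2 : τ k * (t - x k) = (t - x (k + 1)) * τ k + ∑ j, e k j * e (k + 1) j := by
    rw [sub_mul, mul_sub, H.tx0, (X.ct (τ k)).eq]; abel
  have h3 : Commute (gg e Z i (k+1)) (t - x (k+1)) :=
    ((X.ct _).symm).sub_right (cgx H X i (k+1) (k+1))
  have h4 : gg e Z i (k + 1) * (∑ j, e k j * e (k + 1) j) = gg e Z i (k + 1) * e k i := by
    rw [Finset.mul_sum, Finset.sum_eq_single i]
    · rw [H.ee, ← mul_assoc, (cge H X i (k+1) (k+1) i).eq, e_g H X]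
    · intro j _ hj
      rw [H.ee, ← mul_assoc, (cge H X i (k+1) (k+1) j).eq, e_g_ne H X i (k+1) j hj, zero_mul]
    · simp
  rw [h1, h2, mul_add, add_mul, h4, ← mul_assoc, h3.eq, g_x H X, ← H.te0,
    mul_assoc, e_g H X, mul_assoc, e_g H X, (cgg H X i (k+1) k).eq]

theorem cep_x (k l) : Commute (ep e k) (x l) :=
  Commute.sum_left _ _ _ fun j _ => (H.xe l k j).symm
theorem cep_e (k l j) : Commute (ep e k) (e l j) :=
  Commute.sum_left _ _ _ fun j' _ => (H.ee _ _ _ _)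
theorem cep_g (k l) : Commute (ep e k) (gg e Z i l) :=
  Commute.sum_left _ _ _ fun j _ => (cge H X i l k j).symm
theorem ep_e (k j) : ep e k * e k j = e k j := by
  rw [ep, Finset.sum_mul, Finset.sum_eq_single j, H.eid]
  · intro b _ hb; exact H.eorth k b j hb
  · simp
theorem ep_g (k) : ep e k * gg e Z i k = gg e Z i k := by
  rw [gg, ← mul_assoc, ep_e H X]
theorem cq_x (k l) : Commute (qt p x e t i k) (x l) := by
  refine Commute.sum_left _ _ _ fun j _ => ?_
  split_ifs
  · exact Commute.zero_left _
  · exact Commute.mul_left (H.xe l k j).symm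
      (((X.ct (x l)).pow_left _).add_left ((show Commute (x k) (x l) from H.xx _ _).pow_left _))
theorem cq_e (k l j') : Commute (qt p x e t i k) (e l j') := by
  refine Commute.sum_left _ _ _ fun j _ => ?_
  split_ifs
  · exact Commute.zero_left _
  · exact Commute.mul_left (H.ee _ _ _ _)
      (((X.ct _).pow_left _).add_left ((show Commute (x k) (e l j') from H.xe _ _ _).pow_left _))
theorem cq_g (k l) : Commute (qt p x e t i k) (gg e Z i l) :=
  Commute.mul_right (cq_e H X i k l i) (X.zc (cq_x H X i k l).symm).symm
theorem cq_q (k l) : Commute (qt p x e t i k) (qt p x e t i l) := by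
  refine Commute.sum_right _ _ _ fun j _ => ?_
  split_ifs
  · exact Commute.zero_right _
  · exact Commute.mul_right (cq_e H X i k l j)
      (((X.ct _).symm.pow_right _).add_right ((cq_x H X i k l).pow_right _))
theorem ep_q (k) : ep e k * qt p x e t i k = qt p x e t i k := by
  rw [qt, Finset.mul_sum]
  refine Finset.sum_congr rfl fun j _ => ?_
  split_ifs
  · simp
  · rw [← mul_assoc, ep_e H X]
theorem cq_t (k l) (h : k ≠ l) (h' : k ≠ l + 1) : Commute (τ l) (qt p x e t i k) := by
  refine Commute.sum_right _ _ _ fun j _ => ?_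
  split_ifs
  · exact Commute.zero_right _
  · exact Commute.mul_right (H.te _ _ _ h h')
      (((X.ct _).symm.pow_right _).add_right
        ((show Commute (τ l) (x k) from H.tx _ _ h h').pow_right _))
theorem cep_t (k l) (h : k ≠ l) (h' : k ≠ l + 1) : Commute (τ l) (ep e k) :=
  Commute.sum_right _ _ _ fun j _ => H.te _ _ _ h h'
theorem q_g (k) : qt p x e t i k * gg e Z i k = 0 := by
  rw [qt, Finset.sum_mul]
  refine Finset.sum_eq_zero fun j _ => ?_
  split_ifs with h
  · simp
  · rw [mul_assoc, ((X.ct _).pow_left _ |>.add_left ((cgx H X i k k).symm.pow_left _) :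
      Commute (t ^ p i j + x k ^ p j i) (gg e Z i k)).eq, ← mul_assoc, e_g_ne H X i k j h, zero_mul]
theorem D_g (k) : DD p x e i k * gg e Z i k = 0 := by
  rw [DD, Finset.sum_mul]
  refine Finset.sum_eq_zero fun j _ => ?_
  split_ifs with h
  · simp
  · have : Commute (hh (p j i) (x k) (x (k + 1))) (gg e Z i k) :=
      Commute.sum_left _ _ _ fun r _ => Commute.mul_left ((cgx H X i _ _).symm.pow_left _)
        ((cgx H X i _ _).symm.pow_left _)
    rw [mul_assoc, this.eq, H.ee, ← mul_assoc, mul_assoc (e (k+1) j), e_g_ne H X i k j h]; simp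
theorem D_g1 (k) : DD p x e i k * gg e Z i (k + 1) = 0 := by
  rw [DD, Finset.sum_mul]
  refine Finset.sum_eq_zero fun j _ => ?_
  split_ifs with h
  · simp
  · have : Commute (hh (p j i) (x k) (x (k + 1))) (gg e Z i (k+1)) :=
      Commute.sum_left _ _ _ fun r _ => Commute.mul_left ((cgx H X i _ _).symm.pow_left _)
        ((cgx H X i _ _).symm.pow_left _)
    rw [mul_assoc, this.eq, ← mul_assoc, mul_assoc (e k j), e_g_ne H X i (k+1) j h]; simp

omit X in
theorem tpow1 (k m) : τ k * x (k + 1) ^ m = x k ^ m * τ k +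
    (∑ j, e k j * e (k + 1) j) * hh m (x k) (x (k + 1)) := by
  have c1 : Commute (∑ j, e k j * e (k + 1) j) (x k) :=
    Commute.sum_left _ _ _ fun j _ => Commute.mul_left (H.xe _ _ _).symm (H.xe _ _ _).symm
  induction m with
  | zero => simp [hh]
  | succ m ih =>
    rw [pow_succ, ← mul_assoc, ih, add_mul, mul_assoc, H.tx1, hh_succ _ _ _ (H.xx _ _), pow_succ]
    have c2 : Commute (hh m (x k) (x (k + 1))) (x (k+1)) :=
      Commute.sum_left _ _ _ fun r _ => Commute.mul_left (Commute.pow_left (H.xx _ _) _)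
        (Commute.pow_left (H.xx _ _) _)
    rw [mul_assoc _ (hh m (x k) (x (k + 1))), c2.eq, mul_add, mul_add, (c1.pow_right m).eq]
    noncomm_ring
omit X in
theorem tpow0 (k m) : x (k + 1) ^ m * τ k = τ k * x k ^ m +
    (∑ j, e k j * e (k + 1) j) * hh m (x k) (x (k + 1)) := by
  have c1 : Commute (∑ j, e k j * e (k + 1) j) (x (k+1)) :=
    Commute.sum_left _ _ _ fun j _ => Commute.mul_left (H.xe _ _ _).symm (H.xe _ _ _).symm
  induction m with
  | zero => simp [hh]
  | succ m ih =>
    rw [pow_succ', mul_assoc, ih, mul_add, ← mul_assoc, H.tx0, hh_succ _ _ _ (H.xx _ _), pow_succ',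
      ← mul_assoc, c1.symm.eq]
    have c2 : Commute (∑ j, e k j * e (k + 1) j) (x k ^ m) :=
      Commute.sum_left _ _ _ fun j _ => (Commute.mul_left (H.xe _ _ _).symm (H.xe _ _ _).symm).pow_right _
    rw [add_mul, c2.eq, mul_add,c2.eq]
    noncomm_ring
omit X in
theorem eS (k j) : e k j * (∑ j, e k j * e (k + 1) j) = e k j * e (k + 1) j := by
  rw [Finset.mul_sum, Finset.sum_eq_single j]
  · rw [← mul_assoc, H.eid]
  · intro b _ hb; rw [← mul_assoc, H.eorth _ _ _ hb.symm, zero_mul]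
  · simp
omit X in
theorem eS1 (k j) : e (k + 1) j * (∑ j, e k j * e (k + 1) j) = e k j * e (k + 1) j := by
  rw [Finset.mul_sum, Finset.sum_eq_single j]
  · rw [H.ee k, ← mul_assoc, H.eid]
  · intro b _ hb; rw [H.ee k, ← mul_assoc, H.eorth _ _ _ hb.symm, zero_mul]
  · simp

theorem r4 (k) : τ k * qt p x e t i (k + 1) = qt p x e t i k * τ k + DD p x e i k := by
  rw [qt, qt, DD, Finset.mul_sum, Finset.sum_mul, ← Finset.sum_add_distrib]
  refine Finset.sum_congr rfl fun j _ => ?_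
  split_ifs
  · simp
  · rw [← mul_assoc, H.te1, mul_assoc, mul_add, tpow1 H, mul_add, mul_add, mul_assoc,
      ← ((X.ct (τ k)).pow_left _).eq, add_mul, mul_add, ← mul_assoc _ (∑ j, _) _, eS H]
    noncomm_ring
theorem r5 (k) : qt p x e t i (k + 1) * τ k = τ k * qt p x e t i k + DD p x e i k := by
  rw [qt, qt, DD, Finset.mul_sum, Finset.sum_mul, ← Finset.sum_add_distrib]
  refine Finset.sum_congr rfl fun j _ => ?_
  split_ifs
  · simp
  · rw [← mul_assoc, H.te0, mul_assoc, add_mul, tpow0 H, ((X.ct (τ k)).pow_left _).eq, mul_add, mul_add,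
      ← mul_assoc _ (∑ j, _) _, eS1 H]
    noncomm_ring
end Plevel
end

section
open Polynomial Module
set_option linter.unusedSectionVars false
set_option linter.unusedSimpArgs false
set_option linter.unusedVariables false

section AbsRing
variable {B : Type*} [Ring B] {τ g1 g2 q1 q2 D : B}

theorem ab_k (r2 : g2 * τ = τ * g1 + g1 * g2) (c : g1 * g2 = g2 * g1) :
    g2 * (q1 - g1 ^ 2) - g1 * τ * g1 - τ * g1 * τ = g2 * (q1 - τ * τ) := by
  have h1 : τ * g1 = g2 * τ - g1 * g2 := by rw [r2]; abel
  rw [mul_assoc g1, h1, sub_mul, mul_sub, mul_sub, pow_two]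
  have : g1 * (g1 * g2) = g2 * (g1 * g1) := by rw [c, ← mul_assoc, c, mul_assoc]
  rw [this]
  noncomm_ring

theorem ab_k2 (r1 : τ * g2 = g1 * τ + g1 * g2) (c : g1 * g2 = g2 * g1) (c' : q2 * g1 = g1 * q2) :
    (q2 - g2 ^ 2) * g1 + g2 * τ * g2 - τ * g2 * τ = g1 * (q2 - τ * τ) := by
  rw [mul_assoc g2, r1, sub_mul, c', pow_two, add_mul, mul_add]
  have : g2 * (g1 * g2) = g2 * g2 * g1 := by rw [c, mul_assoc]
  rw [this, c]
  noncomm_ring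

theorem ab_U (r1 : τ * g2 = g1 * τ + g1 * g2) (c : g1 * g2 = g2 * g1)
    (r4 : τ * q2 = q1 * τ + D) :
    τ * (q2 - g2 ^ 2) = (q1 - g1 ^ 2) * τ + (D - g1 * g1 * g2 - g1 * g2 * g2) := by
  rw [mul_sub, pow_two, ← mul_assoc, r1, add_mul, mul_assoc g1 τ, r1, r4]
  noncomm_ring

theorem ab_U' (r2 : g2 * τ = τ * g1 + g1 * g2) (c : g1 * g2 = g2 * g1)
    (r5 : q2 * τ = τ * q1 + D) :
    (q2 - g2 ^ 2) * τ = τ * (q1 - g1 ^ 2) + (D - g1 * g1 * g2 - g1 * g2 * g2) := by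
  rw [sub_mul, pow_two, mul_assoc g2, r2, mul_add, ← mul_assoc, r2, r5]
  have : g2 * (g1 * g2) = g1 * g2 * g2 := by rw [← mul_assoc, c]
  have h2 : (τ * g1 + g1 * g2) * g1 = τ * g1 * g1 + g1 * g1 * g2 := by
    rw [add_mul, mul_assoc g1 g2, ← c]; noncomm_ring
  rw [this, h2]
  noncomm_ring

theorem ab_q2 {U1 U2 : B} (r2 : g2 * τ = τ * g1 + g1 * g2) (c : g1 * g2 = g2 * g1)
    (hU : τ * U2 = U1 * τ + (D - g1 * g1 * g2 - g1 * g2 * g2))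
    (h1 : U1 = q1 - g1 ^ 2) (h2 : U2 = q2 - g2 ^ 2) (q1g : q1 * g1 = 0) (q2g : q2 * g2 = 0)
    (g1q : q1 * g2 = g2 * q1)
    (Dg : D * g1 = 0) (gD : g2 * D = 0) :
    τ * U2 * g1 = U2 * -(g1 * g2) + g2 * τ * U2 := by
  have h3 : τ * g1 = g2 * τ - g1 * g2 := by rw [r2]; abel
  have k1 : U2 * (g1 * g2) = - (g1 * g2 * g2 * g2) := by
    rw [h2, sub_mul, pow_two]
    have : q2 * (g1 * g2) = 0 := by rw [c, ← mul_assoc, q2g, zero_mul]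
    rw [this]
    have : g2 * g2 * (g1 * g2) = g1 * g2 * g2 * g2 := by
      have c := (show Commute g1 g2 from c)
      rw [← mul_assoc, ((c.mul_right c).eq).symm]
      noncomm_ring
    rw [this]; simp
  have k2 : U1 * (g1 * g2) = - (g1 * g1 * g1 * g2) := by
    rw [h1, sub_mul, ← mul_assoc, q1g]
    noncomm_ring
  have k3 : U1 * g2 = g2 * U1 := by
    rw [h1, sub_mul, mul_sub, g1q]
    have c := (show Commute g1 g2 from c)
    rw [(c.pow_left 2).eq]
  rw [mul_assoc g2, hU, add_mul, mul_assoc U1, h3, mul_sub, mul_neg, k1, k2, ← mul_assoc, k3,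
    mul_add, sub_mul, sub_mul, mul_sub, mul_sub, Dg, gD]
  have j1 : g1 * g1 * g2 * g1 = g1 * g1 * g1 * g2 := by rw [mul_assoc, ← c]; noncomm_ring
  have j2 : g1 * g2 * g2 * g1 = g1 * g1 * g2 * g2 := by
    have c := (show Commute g1 g2 from c)
    rw [mul_assoc g1, mul_assoc, ← (c.mul_right c).eq]; noncomm_ring
  have j3 : g2 * (g1 * g1 * g2) = g1 * g1 * g2 * g2 := by
    have c := (show Commute g1 g2 from c)
    rw [← mul_assoc, ← (c.mul_left c).eq]
  have j4 : g2 * (g1 * g2 * g2) = g1 * g2 * g2 * g2 := by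
    rw [mul_assoc g1, ← mul_assoc, ← c]; noncomm_ring
  rw [j1, j2, j3, j4]
  noncomm_ring

theorem ab_p2 {U1 U2 EE : B} 
    (hU : τ * U2 = U1 * τ + EE) (hU' : U2 * τ = τ * U1 + EE) (cE : EE * U1 = U1 * EE)
    (cU : U1 * U2 = U2 * U1) :
    τ * U2 * U1 = U2 * U1 * τ := by
  have h : τ * U1 = U2 * τ - EE := by rw [hU']; abel
  rw [hU, add_mul, mul_assoc, h, mul_sub, cE, ← mul_assoc, cU]; abel
end AbsRing

section Plevel2
variable {I : Type*} [Fintype I] [DecidableEq I] {p : I → I → ℕ} {B : Type*} [Ring B]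
    {x : ℕ → B} {e : ℕ → I → B} {τ : ℕ → B}
variable (H : KRel p x e τ) {t : B} {Z : ℕ → B} (X : KExt x t Z) (i : I)
include H X

theorem chh_x (m k l r) : Commute (hh m (x k) (x l)) (x r) :=
  Commute.sum_left _ _ _ fun r _ => Commute.mul_left (Commute.pow_left (H.xx _ _) _)
    (Commute.pow_left (H.xx _ _) _)
theorem chh_e (m k l r j) : Commute (hh m (x k) (x l)) (e r j) :=
  Commute.sum_left _ _ _ fun _ _ => Commute.mul_left (Commute.pow_left (H.xe _ _ _) _)
    (Commute.pow_left (H.xe _ _ _) _)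
theorem cD_x (k l) : Commute (DD p x e i k) (x l) := by
  refine Commute.sum_left _ _ _ fun j _ => ?_
  split_ifs
  · exact Commute.zero_left _
  · exact Commute.mul_left (Commute.mul_left (H.xe _ _ _).symm (H.xe _ _ _).symm) (chh_x H X _ _ _ _)
theorem cD_e (k l j') : Commute (DD p x e i k) (e l j') := by
  refine Commute.sum_left _ _ _ fun j _ => ?_
  split_ifs
  · exact Commute.zero_left _
  · exact Commute.mul_left (Commute.mul_left (H.ee _ _ _ _) (H.ee _ _ _ _)) (chh_e H X _ _ _ _ _)
theorem cD_g (k l) : Commute (DD p x e i k) (gg e Z i l) :=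
  Commute.mul_right (cD_e H X i k l i) (X.zc (cD_x H X i k l).symm).symm
theorem cD_q (k l) : Commute (DD p x e i k) (qt p x e t i l) := by
  refine Commute.sum_right _ _ _ fun j _ => ?_
  split_ifs
  · exact Commute.zero_right _
  · exact Commute.mul_right (cD_e H X i k l j)
      (((X.ct _).symm.pow_right _).add_right ((cD_x H X i k l).pow_right _))
theorem t_ep0 (k) : τ k * ep e k = τ k := by
  rw [ep, Finset.mul_sum]; simp only [H.te0]; rw [← Finset.sum_mul, H.teps1]
theorem t_ep1 (k) : τ k * ep e (k + 1) = τ k := by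
  rw [ep, Finset.mul_sum]; simp only [H.te1]; rw [← Finset.sum_mul, H.teps0]
theorem ep_t0 (k) : ep e k * τ k = τ k := H.teps0 k
theorem ep_t1 (k) : ep e (k + 1) * τ k = τ k := H.teps1 k

theorem gq_tt (k) : gg e Z i (k + 1) * (qt p x e t i k - τ k * τ k) =
    ∑ l, if i = l then 0 else e k l * e (k + 1) i * hh (p i l) t (x (k + 1)) := by
  have h1 : gg e Z i (k + 1) * (τ k * τ k) = ∑ j, if i = j then 0 else
      e k j * gg e Z i (k + 1) * (x k ^ p j i + x (k + 1) ^ p i j) := by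
    rw [H.tt, Finset.mul_sum]
    refine Finset.sum_congr rfl fun j _ => ?_
    rw [Finset.mul_sum, Finset.sum_eq_single i]
    · by_cases h : i = j
      · simp [h]
      · rw [if_neg h, if_neg (Ne.symm h), ← mul_assoc, ← mul_assoc, (cge H X i (k+1) k j).eq,
          mul_assoc (e k j), (cge H X i (k+1) (k+1) i).eq, e_g H X]
    · intro l _ hl
      split_ifs
      · simp
      · rw [← mul_assoc, ← mul_assoc, (cge H X i (k+1) k j).eq,
          mul_assoc (e k j), (cge H X i (k+1) (k+1) l).eq, e_g_ne H X _ _ _ hl]; simp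
    · simp
  rw [mul_sub, h1, qt, Finset.mul_sum, ← Finset.sum_sub_distrib]
  refine Finset.sum_congr rfl fun j _ => ?_
  by_cases h : i = j
  · simp [h]
  · rw [if_neg h, if_neg h, if_neg (Ne.symm h), ← mul_assoc, (cge H X i (k+1) k j).eq, ← mul_sub,
      add_sub_add_comm]
    have : t ^ p i j + x k ^ p j i - (x k ^ p j i + x (k+1) ^ p i j) = (t - x (k+1)) * hh (p i j) t (x (k+1)) := by
      rw [hh_mul _ _ _ (X.ct _)]; abel
    rw [← add_sub_add_comm, this, mul_assoc, ← mul_assoc _ (t - _)]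
    have : Commute (gg e Z i (k+1)) (t - x (k+1)) :=
      Commute.sub_right (X.ct _).symm (cgx H X i _ _)
    rw [this.eq, g_x H X, mul_assoc]

theorem gq_tt2 (k) : gg e Z i k * (qt p x e t i (k + 1) - τ k * τ k) =
    ∑ l, if i = l then 0 else e k i * e (k + 1) l * hh (p i l) (x k) t := by
  have h1 : gg e Z i k * (τ k * τ k) = ∑ l, if i = l then 0 else
      e (k + 1) l * gg e Z i k * (x k ^ p i l + x (k + 1) ^ p l i) := by
    rw [H.tt, Finset.sum_comm, Finset.mul_sum]
    refine Finset.sum_congr rfl fun j _ => ?_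
    rw [Finset.mul_sum, Finset.sum_eq_single i]
    · by_cases h : i = j
      · simp [h]
      · rw [if_neg h, if_neg h, ← mul_assoc, H.ee, ← mul_assoc, (cge H X i k (k+1) j).eq,
          mul_assoc (e (k+1) j), (cge H X i k k i).eq, e_g H X]
    · intro l _ hl
      split_ifs
      · simp
      · rw [← mul_assoc, ← mul_assoc, (cge H X i k k l).eq, e_g_ne H X _ _ _ hl]; simp
    · simp
  rw [mul_sub, h1, qt, Finset.mul_sum, ← Finset.sum_sub_distrib]
  refine Finset.sum_congr rfl fun j _ => ?_
  by_cases h : i = j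
  · simp [h]
  · rw [if_neg h, if_neg h, if_neg (Ne.symm h), ← mul_assoc, (cge H X i k (k+1) j).eq, ← mul_sub]
    have : t ^ p i j + x (k+1) ^ p j i - (x k ^ p i j + x (k+1) ^ p j i) = (t - x k) * hh (p i j) (x k) t := by
      rw [hh_comm _ _ _ (X.ct _).symm, hh_mul _ _ _ (X.ct _)]; abel
    rw [this, mul_assoc, ← mul_assoc _ (t - _)]
    have : Commute (gg e Z i k) (t - x k) :=
      Commute.sub_right (X.ct _).symm (cgx H X i _ _)
    rw [this.eq, g_x H X, ← mul_assoc, H.ee]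

end Plevel2
end

section
open Polynomial Module
set_option linter.unusedSectionVars false
set_option linter.unusedSimpArgs false
set_option linter.unusedVariables false

section Wlevel
variable {F P : Type*} [CommRing F] [AddCommGroup P] [Module F P]

/-- diagonal operators -/
def dg : (ℕ → Module.End F P) →+* Module.End F (ℕ → P) where
  toFun f := LinearMap.pi fun a => f a ∘ₗ LinearMap.proj a
  map_one' := by ext; simp
  map_mul' f g := by ext; simp
  map_zero' := by ext; simp
  map_add' f g := by ext; simp

theorem dg_apply (f : ℕ → Module.End F P) (w : ℕ → P) (a : ℕ) : dg f w a = f a (w a) := rfl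

variable {I : Type*} [Fintype I] [DecidableEq I] (p : I → I → ℕ)
    (x : ℕ → Module.End F P) (e : ℕ → I → Module.End F P) (τ : ℕ → Module.End F P)
    (t : Module.End F P) (Z : ℕ → Module.End F P) (i : I)

def UU (k : ℕ) : Module.End F P := qt p x e t i k - gg e Z i k ^ 2

def xf (k : ℕ) : ℕ → Module.End F P := fun a => if k < a then x k else if k = a then t else x (k - 1)
def ef (k : ℕ) (j : I) : ℕ → Module.End F P := fun a =>
  if k < a then e k j else if k = a then (if j = i then 1 else 0) else e (k - 1) j

def TT (k : ℕ) : Module.End F (ℕ → P) := LinearMap.pi fun a =>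
  if a < k then τ (k - 1) ∘ₗ LinearMap.proj a
  else if a = k then ep e k ∘ₗ LinearMap.proj (k + 1) - gg e Z i k ∘ₗ LinearMap.proj k
  else if a = k + 1 then UU p x e t Z i k ∘ₗ LinearMap.proj k + gg e Z i k ∘ₗ LinearMap.proj (k + 1)
  else τ k ∘ₗ LinearMap.proj a

theorem xf_gt {k a : ℕ} (h : k < a) : xf x t k a = x k := by simp [xf, h]
theorem xf_eq {k : ℕ} : xf x t k k = t := by simp [xf]
theorem xf_lt {k a : ℕ} (h : a < k) : xf x t k a = x (k - 1) := by
  simp [xf, Nat.lt_asymm h, (Nat.ne_of_gt h)]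
theorem xf_lt' {k a : ℕ} (h : a ≤ k) : xf x t (k + 1) a = x k := by
  rw [xf_lt]; rfl; omega
theorem ef_gt {k a : ℕ} {j} (h : k < a) : ef e i k j a = e k j := by simp [ef, h]
theorem ef_eq {k : ℕ} {j} : ef e i k j k = if j = i then 1 else 0 := by simp [ef]
theorem ef_lt {k a : ℕ} {j} (h : a < k) : ef e i k j a = e (k - 1) j := by
  simp [ef, Nat.lt_asymm h, (Nat.ne_of_gt h)]
theorem ef_lt' {k a : ℕ} {j} (h : a ≤ k) : ef e i (k + 1) j a = e k j := by
  rw [ef_lt]; rfl; omega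

theorem TT_lt {k a : ℕ} (h : a < k) (w : ℕ → P) : TT p x e τ t Z i k w a = τ (k - 1) (w a) := by
  simp [TT, h]
theorem TT_lt' {k a : ℕ} (h : a ≤ k) (w : ℕ → P) : TT p x e τ t Z i (k + 1) w a = τ k (w a) := by
  rw [TT_lt]; rfl; omega
theorem TT_eq {k : ℕ} (w : ℕ → P) : TT p x e τ t Z i k w k = ep e k (w (k + 1)) - gg e Z i k (w k) := by
  simp [TT]
theorem TT_eq1 {k : ℕ} (w : ℕ → P) : TT p x e τ t Z i k w (k + 1) =
    UU p x e t Z i k (w k) + gg e Z i k (w (k + 1)) := by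
  simp [TT]
theorem TT_gt {k a : ℕ} (h : k + 1 < a) (w : ℕ → P) : TT p x e τ t Z i k w a = τ k (w a) := by
  have h1 : ¬ a < k := by omega
  have h2 : a ≠ k := by omega
  have h3 : a ≠ k + 1 := by omega
  simp [TT, h1, h2, h3]

variable {p x e τ t Z}
variable (H : KRel p x e τ) (X : KExt x t Z)

theorem TT_dg {k : ℕ} {f f' h : ℕ → Module.End F P}
    (h1 : ∀ a < k, τ (k-1) * f a = f' a * τ (k-1) + h a)
    (h2 : ep e k * f (k+1) = f' k * ep e k)
    (h3 : gg e Z i k * f k = f' k * gg e Z i k - h k)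
    (h4 : UU p x e t Z i k * f k = f' (k+1) * UU p x e t Z i k)
    (h5 : gg e Z i k * f (k+1) = f' (k+1) * gg e Z i k + h (k+1))
    (h6 : ∀ a > k + 1, τ k * f a = f' a * τ k + h a) :
    TT p x e τ t Z i k * dg f = dg f' * TT p x e τ t Z i k + dg h := by
  apply LinearMap.ext; intro w; funext a
  rw [LinearMap.add_apply, Module.End.mul_apply, Module.End.mul_apply, Pi.add_apply, dg_apply, dg_apply]
  rcases lt_or_ge a k with ha | ha
  · rw [TT_lt _ _ _ _ _ _ _ ha, TT_lt _ _ _ _ _ _ _ ha]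
    exact LinearMap.congr_fun (h1 a ha) (w a)
  rcases eq_or_lt_of_le ha with rfl | ha
  · rw [TT_eq, TT_eq, dg_apply, dg_apply, map_sub]
    have h2 := LinearMap.congr_fun h2 (w (k+1))
    have h3 := LinearMap.congr_fun h3 (w k)
    simp only [Module.End.mul_apply, LinearMap.sub_apply] at h2 h3
    rw [h2, h3]; abel
  rcases eq_or_lt_of_le (show k + 1 ≤ a from ha) with rfl | ha
  · rw [TT_eq1, TT_eq1, dg_apply, dg_apply, map_add]
    have h2 := LinearMap.congr_fun h4 (w k)
    have h3 := LinearMap.congr_fun h5 (w (k+1))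
    simp only [Module.End.mul_apply, LinearMap.add_apply] at h2 h3
    rw [h2, h3]; abel
  · rw [TT_gt _ _ _ _ _ _ _ ha, TT_gt _ _ _ _ _ _ _ ha]
    exact LinearMap.congr_fun (h6 a ha) (w a)

include H X in
theorem cU_x (k l) : Commute (UU p x e t Z i k) (x l) :=
  (cq_x H X i k l).sub_left ((cgx H X i k l).pow_left 2)
include H X in
theorem cU_e (k l j) : Commute (UU p x e t Z i k) (e l j) :=
  (cq_e H X i k l j).sub_left ((cge H X i k l j).pow_left 2)
include H X in
theorem cU_g (k l) : Commute (UU p x e t Z i k) (gg e Z i l) :=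
  (cq_g H X i k l).sub_left ((cgg H X i k l).pow_left 2)
include H X in
theorem cU_U (k l) : Commute (UU p x e t Z i k) (UU p x e t Z i l) :=
  ((cq_q H X i k l).sub_right ((cq_g H X i k l).pow_right 2)).sub_left
    (((cq_g H X i l k).symm.sub_right ((cgg H X i k l).pow_right 2)).pow_left 2)
include H X in
theorem cU_t (k l) (h : k ≠ l) (h' : k ≠ l + 1) : Commute (τ l) (UU p x e t Z i k) :=
  (cq_t H X i k l h h').sub_right ((cgt H X i k l h h').pow_right 2)
include H X in
theorem ep_U (k) : ep e k * UU p x e t Z i k = UU p x e t Z i k := by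
  rw [UU, mul_sub, ep_q H X, pow_two, ← mul_assoc, ep_g H X]
include H X in
theorem U_ep (k) : UU p x e t Z i k * ep e k = UU p x e t Z i k := by
  have h : Commute (ep e k) (UU p x e t Z i k) :=
    Commute.sum_left _ _ _ fun j _ => (cU_e i H X k k j).symm
  rw [← h.eq, ep_U i H X]

include H X in
theorem TT_tx (k l) (h : l ≠ k) (h' : l ≠ k + 1) :
    TT p x e τ t Z i k * dg (xf x t l) = dg (xf x t l) * TT p x e τ t Z i k := by
  have := TT_dg (p := p) (x := x) (e := e) (τ := τ) (t := t) (Z := Z) i (k := k)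
    (f := xf x t l) (f' := xf x t l) (h := 0) ?_ ?_ ?_ ?_ ?_ ?_
  · simpa using this
  · intro a ha
    simp only [Pi.zero_apply, add_zero]
    rcases lt_trichotomy l a with hl | hl | hl
    · rw [xf_gt _ _ hl, H.tx]; omega; omega
    · subst hl; rw [xf_eq, (X.ct _).eq]
    · rw [xf_lt _ _ hl, H.tx]; omega; omega
  all_goals try simp only [Pi.zero_apply, add_zero, sub_zero]
  · rcases lt_or_gt_of_ne h with hl | hl
    · rw [xf_gt x t (show l < k + 1 by omega), xf_gt x t (show l < k by omega)]
      exact cep_x H X _ _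
    · rw [xf_lt x t (show l > k + 1 by omega), xf_lt x t (show l > k by omega)]
      exact cep_x H X _ _
  · rcases lt_or_gt_of_ne h with hl | hl
    · rw [xf_gt x t (show l < k by omega)]
      exact cgx H X _ _ _
    · rw [xf_lt x t (show l > k by omega)]
      exact cgx H X _ _ _
  · rcases lt_or_gt_of_ne h with hl | hl
    · rw [xf_gt x t (show l < k + 1 by omega), xf_gt x t (show l < k by omega)]
      exact cU_x i H X _ _
    · rw [xf_lt x t (show l > k + 1 by omega), xf_lt x t (show l > k by omega)]
      exact cU_x i H X _ _
  · rcases lt_or_gt_of_ne h with hl | hl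
    · rw [xf_gt x t (show l < k + 1 by omega)]
      exact cgx H X _ _ _
    · rw [xf_lt x t (show l > k + 1 by omega)]
      exact cgx H X _ _ _
  · intro a ha
    rcases lt_trichotomy l a with hl | hl | hl
    · rw [xf_gt _ _ hl, H.tx]; omega; omega
    · subst hl; rw [xf_eq, (X.ct _).eq]
    · rw [xf_lt _ _ hl, H.tx]; omega; omega

include H X in
theorem TT_te (k l j) (h : l ≠ k) (h' : l ≠ k + 1) :
    TT p x e τ t Z i k * dg (ef e i l j) = dg (ef e i l j) * TT p x e τ t Z i k := by
  have := TT_dg (p := p) (x := x) (e := e) (τ := τ) (t := t) (Z := Z) i (k := k)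
    (f := ef e i l j) (f' := ef e i l j) (h := 0) ?_ ?_ ?_ ?_ ?_ ?_
  · simpa using this
  · intro a ha
    simp only [Pi.zero_apply, add_zero]
    rcases lt_trichotomy l a with hl | hl | hl
    · rw [ef_gt _ _ hl, H.te]; omega; omega
    · subst hl; rw [ef_eq]; split_ifs <;> simp
    · rw [ef_lt _ _ hl, H.te]; omega; omega
  all_goals try simp only [Pi.zero_apply, add_zero, sub_zero]
  · rcases lt_or_gt_of_ne h with hl | hl
    · rw [ef_gt e i (show l < k + 1 by omega), ef_gt e i (show l < k by omega)]
      exact cep_e H X _ _ _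
    · rw [ef_lt e i (show l > k + 1 by omega), ef_lt e i (show l > k by omega)]
      exact cep_e H X _ _ _
  · rcases lt_or_gt_of_ne h with hl | hl
    · rw [ef_gt e i (show l < k by omega)]
      exact cge H X _ _ _ _
    · rw [ef_lt e i (show l > k by omega)]
      exact cge H X _ _ _ _
  · rcases lt_or_gt_of_ne h with hl | hl
    · rw [ef_gt e i (show l < k + 1 by omega), ef_gt e i (show l < k by omega)]
      exact cU_e i H X _ _ _
    · rw [ef_lt e i (show l > k + 1 by omega), ef_lt e i (show l > k by omega)]
      exact cU_e i H X _ _ _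
  · rcases lt_or_gt_of_ne h with hl | hl
    · rw [ef_gt e i (show l < k + 1 by omega)]
      exact cge H X _ _ _ _
    · rw [ef_lt e i (show l > k + 1 by omega)]
      exact cge H X _ _ _ _
  · intro a ha
    rcases lt_trichotomy l a with hl | hl | hl
    · rw [ef_gt _ _ hl, H.te]; omega; omega
    · subst hl; rw [ef_eq]; split_ifs <;> simp
    · rw [ef_lt _ _ hl, H.te]; omega; omega

include H X in
theorem TT_te1 (k j) :
    TT p x e τ t Z i k * dg (ef e i (k + 1) j) = dg (ef e i k j) * TT p x e τ t Z i k := by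
  have := TT_dg (p := p) (x := x) (e := e) (τ := τ) (t := t) (Z := Z) i (k := k)
    (f := ef e i (k + 1) j) (f' := ef e i k j) (h := 0) ?_ ?_ ?_ ?_ ?_ ?_
  · simpa using this
  · intro a ha
    obtain ⟨m, rfl⟩ : ∃ m, k = m + 1 := ⟨k - 1, by omega⟩
    rw [ef_lt' e i (by omega), ef_lt' e i (by omega)]
    simp [H.te1]
  all_goals try simp only [Pi.zero_apply, add_zero, sub_zero]
  · rw [ef_eq, ef_eq]; split_ifs <;> simp
  · rw [ef_eq, ef_lt' e i (by omega)]
    split_ifs with h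
    · subst h; rw [one_mul, (cge H X _ _ _ _).eq, e_g H X]
    · rw [zero_mul, (cge H X _ _ _ _).eq, e_g_ne H X _ _ _ h]
  · rw [ef_lt' e i (by omega), ef_gt e i (by omega)]
    exact cU_e i H X _ _ _
  · rw [ef_eq, ef_gt e i (by omega)]
    split_ifs with h
    · subst h; rw [mul_one, e_g H X]
    · rw [mul_zero, e_g_ne H X _ _ _ h]
  · intro a ha
    rw [ef_gt e i (by omega), ef_gt e i (by omega)]
    simp [H.te1]

include H X in
theorem TT_te0 (k j) :
    TT p x e τ t Z i k * dg (ef e i k j) = dg (ef e i (k + 1) j) * TT p x e τ t Z i k := by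
  have := TT_dg (p := p) (x := x) (e := e) (τ := τ) (t := t) (Z := Z) i (k := k)
    (f := ef e i k j) (f' := ef e i (k + 1) j) (h := 0) ?_ ?_ ?_ ?_ ?_ ?_
  · simpa using this
  · intro a ha
    obtain ⟨m, rfl⟩ : ∃ m, k = m + 1 := ⟨k - 1, by omega⟩
    rw [ef_lt' e i (by omega), ef_lt' e i (by omega)]
    simp [H.te0]
  all_goals try simp only [Pi.zero_apply, add_zero, sub_zero]
  · rw [ef_gt e i (by omega), ef_lt' e i (by omega)]; exact cep_e H X _ _ _
  · rw [ef_eq, ef_lt' e i (by omega)]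
    split_ifs with h
    · subst h; rw [mul_one, e_g H X]
    · rw [mul_zero, e_g_ne H X _ _ _ h]
  · rw [ef_eq, ef_eq]; split_ifs <;> simp
  · rw [ef_eq, ef_gt e i (by omega)]
    split_ifs with h
    · subst h; rw [one_mul, (cge H X _ _ _ _).eq, e_g H X]
    · rw [zero_mul, (cge H X _ _ _ _).eq, e_g_ne H X _ _ _ h]
  · intro a ha
    rw [ef_gt e i (by omega), ef_gt e i (by omega)]
    simp [H.te0]

theorem sum_dirac (c : I → Module.End F P) : (∑ j, (if j = i then (1 : Module.End F P) else 0) * c j) = c i := by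
  simp
theorem sum_dirac' (c : I → Module.End F P) : (∑ j, c j * (if j = i then (1 : Module.End F P) else 0)) = c i := by
  simp

include H X in
theorem TT_tx1 (k) :
    TT p x e τ t Z i k * dg (xf x t (k + 1)) = dg (xf x t k) * TT p x e τ t Z i k +
      ∑ j, dg (ef e i k j) * dg (ef e i (k + 1) j) := by
  have := TT_dg (p := p) (x := x) (e := e) (τ := τ) (t := t) (Z := Z) i (k := k)
    (f := xf x t (k + 1)) (f' := xf x t k) (h := ∑ j, ef e i k j * ef e i (k + 1) j) ?_ ?_ ?_ ?_ ?_ ?_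
  · rw [this]; simp only [map_sum, map_mul]
  · intro a ha
    obtain ⟨m, rfl⟩ : ∃ m, k = m + 1 := ⟨k - 1, by omega⟩
    rw [xf_lt' x t (by omega), xf_lt' x t (by omega), Finset.sum_apply]
    simp only [Pi.mul_apply, ef_lt' e i (show a ≤ m by omega), ef_lt' e i (show a ≤ m + 1 by omega)]
    exact H.tx1 m
  · rw [xf_eq, xf_eq, (X.ct _).eq]
  · rw [xf_eq, xf_lt' x t (by omega), Finset.sum_apply]
    simp only [Pi.mul_apply, ef_eq, ef_lt' e i (show k ≤ k by omega), sum_dirac]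
    rw [← g_x H X, sub_mul, (cgx H X i k k).eq]; abel
  · rw [xf_lt' x t (by omega), xf_gt x t (by omega)]
    exact cU_x i H X _ _
  · rw [xf_eq, xf_gt x t (by omega), Finset.sum_apply]
    simp only [Pi.mul_apply, ef_eq, ef_gt e i (show k < k + 1 by omega), sum_dirac']
    rw [← g_x H X, sub_mul, (X.ct _).eq]; abel
  · intro a ha
    rw [xf_gt x t (by omega), xf_gt x t (by omega), Finset.sum_apply]
    simp only [Pi.mul_apply, ef_gt e i (show k < a by omega), ef_gt e i (show k + 1 < a by omega)]
    exact H.tx1 k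

include H X in
theorem TT_tx0 (k) :
    dg (xf x t (k + 1)) * TT p x e τ t Z i k = TT p x e τ t Z i k * dg (xf x t k) +
      ∑ j, dg (ef e i k j) * dg (ef e i (k + 1) j) := by
  have := TT_dg (p := p) (x := x) (e := e) (τ := τ) (t := t) (Z := Z) i (k := k)
    (f := xf x t k) (f' := xf x t (k + 1)) (h := - ∑ j, ef e i k j * ef e i (k + 1) j) ?_ ?_ ?_ ?_ ?_ ?_
  · rw [this]; simp only [map_sum, map_mul, map_neg]; abel
  · intro a ha
    obtain ⟨m, rfl⟩ : ∃ m, k = m + 1 := ⟨k - 1, by omega⟩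
    rw [xf_lt' x t (by omega), xf_lt' x t (by omega), Pi.neg_apply, Finset.sum_apply]
    simp only [Pi.mul_apply, ef_lt' e i (show a ≤ m by omega), ef_lt' e i (show a ≤ m + 1 by omega)]
    simp only [Nat.add_sub_cancel]
    rw [H.tx0 m]; abel
  · rw [xf_gt x t (by omega), xf_lt' x t (by omega)]
    exact cep_x H X _ _
  · rw [xf_eq, xf_lt' x t (by omega), Pi.neg_apply, Finset.sum_apply]
    simp only [Pi.mul_apply, ef_eq, ef_lt' e i (show k ≤ k by omega), sum_dirac]
    rw [← g_x H X, sub_mul, (X.ct _).eq]; abel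
  · rw [xf_eq, xf_eq, (X.ct _).eq]
  · rw [xf_eq, xf_gt x t (by omega), Pi.neg_apply, Finset.sum_apply]
    simp only [Pi.mul_apply, ef_eq, ef_gt e i (show k < k + 1 by omega), sum_dirac']
    rw [← g_x H X, sub_mul, (cgx H X i k k).eq]; abel
  · intro a ha
    rw [xf_gt x t (by omega), xf_gt x t (by omega), Pi.neg_apply, Finset.sum_apply]
    simp only [Pi.mul_apply, ef_gt e i (show k < a by omega), ef_gt e i (show k + 1 < a by omega)]
    rw [H.tx0 k]; abel

end Wlevel
end

section
open Polynomial Module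
set_option linter.unusedSectionVars false
set_option linter.unusedSimpArgs false
set_option linter.unusedVariables false

section Wlevel2
variable {F P : Type*} [CommRing F] [AddCommGroup P] [Module F P]
variable {I : Type*} [Fintype I] [DecidableEq I] {p : I → I → ℕ}
    {x : ℕ → Module.End F P} {e : ℕ → I → Module.End F P} {τ : ℕ → Module.End F P}
    {t : Module.End F P} {Z : ℕ → Module.End F P} (i : I)
variable (H : KRel p x e τ) (X : KExt x t Z)

theorem sum_dirac1 : (∑ j, (if j = i then (1 : Module.End F P) else 0)) = 1 := by
  simp

include H X in
theorem TT_teps0 (k) : (∑ j, dg (ef e i k j)) * TT p x e τ t Z i k = TT p x e τ t Z i k := by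
  rw [← map_sum]
  apply LinearMap.ext; intro w; funext a
  rw [Module.End.mul_apply, dg_apply, Finset.sum_apply]
  rcases lt_or_ge a k with ha | ha
  · rw [TT_lt _ _ _ _ _ _ _ ha]
    simp only [ef_lt e i ha]
    exact LinearMap.congr_fun (H.teps0 (k-1)) (w a)
  rcases eq_or_lt_of_le ha with rfl | ha
  · simp only [ef_eq, sum_dirac1]; rfl
  rcases eq_or_lt_of_le (show k + 1 ≤ a from ha) with rfl | ha
  · simp only [ef_gt e i (show k < k + 1 by omega)]
    rw [TT_eq1, map_add]
    exact congrArg₂ _ (LinearMap.congr_fun (ep_U i H X k) (w k))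
      (LinearMap.congr_fun (ep_g H X i k) (w (k + 1)))
  · simp only [ef_gt e i (show k < a by omega)]
    rw [TT_gt _ _ _ _ _ _ _ ha]
    exact LinearMap.congr_fun (H.teps0 k) (w a)

include H X in
theorem TT_teps1 (k) : (∑ j, dg (ef e i (k + 1) j)) * TT p x e τ t Z i k = TT p x e τ t Z i k := by
  rw [← map_sum]
  apply LinearMap.ext; intro w; funext a
  rw [Module.End.mul_apply, dg_apply, Finset.sum_apply]
  rcases lt_or_ge a k with ha | ha
  · obtain ⟨m, rfl⟩ : ∃ m, k = m + 1 := ⟨k - 1, by omega⟩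
    rw [TT_lt _ _ _ _ _ _ _ ha]
    simp only [ef_lt' e i (show a ≤ m + 1 by omega)]
    exact LinearMap.congr_fun (H.teps1 m) (w a)
  rcases eq_or_lt_of_le ha with rfl | ha
  · simp only [ef_lt' e i (show k ≤ k by omega)]
    rw [TT_eq, map_sub]
    refine congrArg₂ _ (LinearMap.congr_fun (?_ : ep e k * ep e k = ep e k) (w (k+1)))
      (LinearMap.congr_fun (ep_g H X i k) (w k))
    conv_lhs => rhs; rw [ep]
    rw [Finset.mul_sum]; simp only [ep_e H X]; rfl
  rcases eq_or_lt_of_le (show k + 1 ≤ a from ha) with rfl | ha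
  · simp only [ef_eq, sum_dirac1]; rfl
  · simp only [ef_gt e i (show k + 1 < a by omega)]
    rw [TT_gt _ _ _ _ _ _ _ ha]
    exact LinearMap.congr_fun (H.teps1 k) (w a)

include H X in
theorem U_g2 (k) : UU p x e t Z i k + gg e Z i k * gg e Z i k = qt p x e t i k := by
  rw [UU, pow_two]; abel

include H X in
theorem TT_tt (k) : TT p x e τ t Z i k * TT p x e τ t Z i k = ∑ j, ∑ l, if j = l then 0 else
    dg (ef e i k j) * dg (ef e i (k + 1) l) *
      (dg (xf x t k) ^ p j l + dg (xf x t (k + 1)) ^ p l j) := by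
  have : (∑ j, ∑ l, if j = l then 0 else
    dg (ef e i k j) * dg (ef e i (k + 1) l) *
      (dg (xf x t k) ^ p j l + dg (xf x t (k + 1)) ^ p l j)) =
      dg (∑ j, ∑ l, if j = l then 0 else
    (ef e i k j) * (ef e i (k + 1) l) *
      ((xf x t k) ^ p j l + (xf x t (k + 1)) ^ p l j)) := by
    simp only [map_sum]
    refine Finset.sum_congr rfl fun j _ => Finset.sum_congr rfl fun l _ => ?_
    split_ifs <;> simp
  rw [this]
  apply LinearMap.ext; intro w; funext a
  rw [Module.End.mul_apply, dg_apply]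
  simp only [Finset.sum_apply, ite_apply, Pi.zero_apply, Pi.mul_apply, Pi.add_apply, Pi.pow_apply]
  rcases lt_or_ge a k with ha | ha
  · obtain ⟨m, rfl⟩ : ∃ m, k = m + 1 := ⟨k - 1, by omega⟩
    rw [TT_lt _ _ _ _ _ _ _ ha, TT_lt _ _ _ _ _ _ _ ha]
    simp only [ef_lt' e i (show a ≤ m + 1 by omega), ef_lt' e i (show a ≤ m by omega),
      xf_lt' x t (show a ≤ m + 1 by omega), xf_lt' x t (show a ≤ m by omega)]
    exact LinearMap.congr_fun (H.tt m) (w a)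
  rcases eq_or_lt_of_le ha with rfl | ha
  · simp only [ef_lt' e i (show k ≤ k by omega), ef_eq, xf_lt' x t (show k ≤ k by omega), xf_eq]
    rw [Finset.sum_eq_single i]
    · have : (∑ l, if i = l then 0 else (if i = i then 1 else 0) * e k l * (t ^ p i l + x k ^ p l i)) =
          qt p x e t i k := by
        rw [qt]
        refine Finset.sum_congr rfl fun l _ => ?_
        simp [eq_comm]
      rw [this, ← U_g2 i H X, TT_eq, TT_eq, TT_eq1]
      have h1 := LinearMap.congr_fun (ep_U i H X k) (w k)
      have h2 := LinearMap.congr_fun (ep_g H X i k) (w (k+1))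
      have h3 := LinearMap.congr_fun (cep_g H X i k k).eq (w (k+1))
      simp only [Module.End.mul_apply, map_add, map_sub, LinearMap.add_apply] at h1 h2 h3 ⊢
      rw [h1, h3]; abel
    · intro j _ hj
      simp [hj]
    · simp
  rcases eq_or_lt_of_le (show k + 1 ≤ a from ha) with rfl | ha
  · simp only [ef_gt e i (show k < k + 1 by omega), ef_eq, xf_gt x t (show k < k + 1 by omega), xf_eq]
    rw [Finset.sum_comm, Finset.sum_eq_single i]
    · have : (∑ l, if l = i then 0 else e k l * (if i = i then 1 else 0) * (x k ^ p l i + t ^ p i l)) =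
          qt p x e t i k := by
        rw [qt]
        refine Finset.sum_congr rfl fun l _ => ?_
        simp [add_comm]
      rw [this, ← U_g2 i H X, TT_eq1, TT_eq, TT_eq1]
      have h1 := LinearMap.congr_fun (U_ep i H X k) (w (k+1))
      have h3 := LinearMap.congr_fun (cU_g i H X k k).eq (w k)
      simp only [Module.End.mul_apply, map_add, map_sub, LinearMap.add_apply] at h1 h3 ⊢
      rw [h1, h3]; abel
    · intro j _ hj
      simp [hj]
    · simp
  · rw [TT_gt _ _ _ _ _ _ _ ha, TT_gt _ _ _ _ _ _ _ ha]
    simp only [ef_gt e i (show k + 1 < a by omega), ef_gt e i (show k < a by omega),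
      xf_gt x t (show k + 1 < a by omega), xf_gt x t (show k < a by omega)]
    exact LinearMap.congr_fun (H.tt k) (w a)

include H X in
theorem TT_far (k l) (hkl : k + 1 < l) :
    TT p x e τ t Z i k * TT p x e τ t Z i l = TT p x e τ t Z i l * TT p x e τ t Z i k := by
  apply LinearMap.ext; intro w; funext a
  rw [Module.End.mul_apply, Module.End.mul_apply]
  obtain ⟨l, rfl⟩ : ∃ m, l = m + 1 := ⟨l - 1, by omega⟩
  rcases lt_or_ge a k with ha | ha
  · obtain ⟨m, rfl⟩ : ∃ m, k = m + 1 := ⟨k - 1, by omega⟩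
    simp only [TT_lt' _ _ _ _ _ _ _ (show a ≤ m by omega), TT_lt' _ _ _ _ _ _ _ (show a ≤ l by omega)]
    exact LinearMap.congr_fun (H.far m l (by omega)) (w a)
  rcases eq_or_lt_of_le ha with rfl | ha
  · simp only [TT_eq, TT_lt' _ _ _ _ _ _ _ (show k ≤ l by omega), TT_lt' _ _ _ _ _ _ _ (show k + 1 ≤ l by omega)]
    rw [map_sub]
    exact congrArg₂ _ (LinearMap.congr_fun (cep_t H X k l (by omega) (by omega)).symm.eq _)
      (LinearMap.congr_fun (cgt H X i k l (by omega) (by omega)).symm.eq _)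
  rcases eq_or_lt_of_le (show k + 1 ≤ a from ha) with rfl | ha
  · simp only [TT_eq1, TT_lt' _ _ _ _ _ _ _ (show k ≤ l by omega), TT_lt' _ _ _ _ _ _ _ (show k + 1 ≤ l by omega)]
    rw [map_add]
    exact congrArg₂ _ (LinearMap.congr_fun (cU_t i H X k l (by omega) (by omega)).symm.eq _)
      (LinearMap.congr_fun (cgt H X i k l (by omega) (by omega)).symm.eq _)
  rcases lt_or_ge a (l + 1) with hb | hb
  · simp only [TT_gt _ _ _ _ _ _ _ ha, TT_lt' _ _ _ _ _ _ _ (show a ≤ l by omega)]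
    exact LinearMap.congr_fun (H.far k l (by omega)) (w a)
  rcases eq_or_lt_of_le hb with rfl | hb
  · simp only [TT_gt _ _ _ _ _ _ _ ha, TT_eq, TT_gt _ _ _ _ _ _ _ (show k + 1 < l + 1 + 1 by omega)]
    rw [map_sub]
    exact congrArg₂ _ (LinearMap.congr_fun (cep_t H X (l+1) k (by omega) (by omega)).eq _)
      (LinearMap.congr_fun (cgt H X i (l+1) k (by omega) (by omega)).eq _)
  rcases eq_or_lt_of_le (show l + 1 + 1 ≤ a from hb) with rfl | hb
  · simp only [TT_gt _ _ _ _ _ _ _ ha, TT_eq1, TT_gt _ _ _ _ _ _ _ (show k + 1 < l + 1 by omega)]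
    rw [map_add]
    exact congrArg₂ _ (LinearMap.congr_fun (cU_t i H X (l+1) k (by omega) (by omega)).eq _)
      (LinearMap.congr_fun (cgt H X i (l+1) k (by omega) (by omega)).eq _)
  · simp only [TT_gt _ _ _ _ _ _ _ ha, TT_gt _ _ _ _ _ _ _ hb]
    exact LinearMap.congr_fun (H.far k (l+1) (by omega)) (w a)

theorem hh_pi {A : Type*} [Ring A] (m : ℕ) (u v : ℕ → A) (a : ℕ) : hh m u v a = hh m (u a) (v a) := by
  simp [hh, Finset.sum_apply]

include H X in
theorem TT_br (k) : TT p x e τ t Z i k * TT p x e τ t Z i (k + 1) * TT p x e τ t Z i k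
    + (∑ j, ∑ l, if j = l then 0 else
    dg (ef e i k j) * dg (ef e i (k + 1) l) * dg (ef e i (k + 2) j) *
      hh (p j l) (dg (xf x t k)) (dg (xf x t (k + 2)))) =
    TT p x e τ t Z i (k + 1) * TT p x e τ t Z i k * TT p x e τ t Z i (k + 1) := by
  have : (∑ j, ∑ l, if j = l then 0 else
    dg (ef e i k j) * dg (ef e i (k + 1) l) * dg (ef e i (k + 2) j) *
      hh (p j l) (dg (xf x t k)) (dg (xf x t (k + 2)))) =
      dg (∑ j, ∑ l, if j = l then 0 else
    (ef e i k j) * (ef e i (k + 1) l) * ef e i (k + 2) j *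
      hh (p j l) (xf x t k) (xf x t (k + 2))) := by
    simp only [map_sum]
    refine Finset.sum_congr rfl fun j _ => Finset.sum_congr rfl fun l _ => ?_
    split_ifs <;> simp [map_hh]
  rw [this]
  apply LinearMap.ext; intro w; funext a
  rw [LinearMap.add_apply, Pi.add_apply, dg_apply]
  simp only [Module.End.mul_apply]
  simp only [Finset.sum_apply, ite_apply, Pi.zero_apply, Pi.mul_apply, Pi.add_apply, Pi.pow_apply, hh_pi]
  rcases lt_or_ge a k with ha | ha
  · obtain ⟨m, rfl⟩ : ∃ m, k = m + 1 := ⟨k - 1, by omega⟩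
    simp only [TT_lt' _ _ _ _ _ _ _ (show a ≤ m by omega), TT_lt' _ _ _ _ _ _ _ (show a ≤ m + 1 by omega)]
    simp only [ef_lt' e i (show a ≤ m + 2 by omega), ef_lt' e i (show a ≤ m + 1 by omega), ef_lt' e i (show a ≤ m by omega),
      xf_lt' x t (show a ≤ m + 2 by omega), xf_lt' x t (show a ≤ m by omega)]
    exact LinearMap.congr_fun (H.br m) (w a)
  have r1' := r1 H X i k
  have r2' := r2 H X i k
  have r4' := r4 H X i k
  have r5' := r5 H X i k
  have cg := (cgg H X i k (k+1)).eq
  have te0 := t_ep0 H X k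
  have te1 := t_ep1 H X k
  have et0 := ep_t0 H X k
  have et1 := ep_t1 H X k
  have hU := ab_U r1' cg r4'
  have hU' := ab_U' r2' cg r5'
  rcases eq_or_lt_of_le ha with rfl | ha
  · simp only [ef_lt' e i (show k ≤ k + 1 by omega), ef_lt' e i (show k ≤ k by omega), ef_eq, xf_lt' x t (show k ≤ k + 1 by omega), xf_eq]
    simp only [TT_eq, TT_eq1, TT_lt' _ _ _ _ _ _ _ (show k ≤ k by omega),
      TT_gt _ _ _ _ _ _ _ (show k + 1 < k + 1 + 1 by omega)]
    rw [Finset.sum_eq_single i]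
    · have hS : (∑ l, if i = l then 0 else (if i = i then 1 else 0) * e k l * e (k + 1) i * hh (p i l) t (x (k+1))) =
          gg e Z i (k + 1) * (qt p x e t i k - τ k * τ k) := by
        rw [gq_tt H X]
        refine Finset.sum_congr rfl fun l _ => ?_
        simp
      rw [hS, ← ab_k r2' cg]
      have h1 : ep e k * (ep e (k + 1) * τ k) = τ k * (ep e k * ep e (k + 1)) := by
        rw [et1, et0, ← mul_assoc, te0, te1]
      have h2 : ep e k * (gg e Z i (k + 1) * gg e Z i k) + gg e Z i k * (τ k * ep e k) =
          τ k * (ep e k * gg e Z i (k+1)) := by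
        rw [te0, ← mul_assoc (τ k), te0, r1', ← cg, ← mul_assoc, ep_g H X]; abel
      have h3 : ep e k * (gg e Z i (k + 1) * UU p x e t Z i k) = gg e Z i (k+1) * UU p x e t Z i k := by
        rw [← (cU_g i H X k (k+1)).eq, ← mul_assoc, ep_U i H X]
      have h1 := LinearMap.congr_fun h1 (w (k + 1 + 1))
      have h2 := LinearMap.congr_fun h2 (w (k + 1))
      have h3 := LinearMap.congr_fun h3 (w k)
      rw [← UU]
      simp only [Module.End.mul_apply, map_add, map_sub, LinearMap.add_apply, LinearMap.sub_apply] at h1 h2 h3 ⊢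
      rw [h1, ← h2, h3]; abel
    · intro j _ hj
      simp [hj]
    · simp
  rcases eq_or_lt_of_le (show k + 1 ≤ a from ha) with rfl | ha
  · simp only [ef_lt' e i (show k + 1 ≤ k + 1 by omega), ef_gt e i (show k < k + 1 by omega), ef_eq, xf_lt' x t (show k + 1 ≤ k + 1 by omega),  xf_gt x t (show k < k + 1 by omega)]
    simp only [TT_eq, TT_eq1, TT_lt' _ _ _ _ _ _ _ (show k ≤ k by omega),
      TT_gt _ _ _ _ _ _ _ (show k + 1 < k + 1 + 1 by omega)]
    rw [Finset.sum_comm, Finset.sum_eq_single i]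
    · have hS : (∑ l, if l = i then 0 else e k l * (if i = i then 1 else 0) * e (k + 1) l * hh (p l i) (x k) (x (k+1))) =
          DD p x e i k := by
        rw [DD]
        refine Finset.sum_congr rfl fun l _ => ?_
        simp
      rw [hS]
      have h1 : gg e Z i k * (ep e (k + 1) * τ k) = ep e (k + 1) * (τ k * gg e Z i (k + 1)) -
         gg e Z i (k+1) * (gg e Z i k * ep e (k+1)) := by
        have h0 : gg e Z i (k+1) * (gg e Z i k * ep e (k+1)) = gg e Z i k * gg e Z i (k+1) := by
          rw [← mul_assoc, ← cg, mul_assoc, ← (cep_g H X i (k+1) (k+1)).eq, ep_g H X]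
        rw [h0, et1, ← mul_assoc, et1, r1']; abel
      have h2 : UU p x e t Z i k * (τ k * ep e k) - gg e Z i k * (gg e Z i (k + 1) * gg e Z i k) + DD p x e i k =
          ep e (k + 1) * (τ k * UU p x e t Z i (k+1)) + gg e Z i (k+1) * (gg e Z i k * gg e Z i (k+1)) := by
        rw [te0, ← mul_assoc (ep e (k+1)), et1, UU, UU, hU, ← cg, ← mul_assoc, ← mul_assoc, ← cg]; abel
      have h3 : UU p x e t Z i k * (τ k * gg e Z i k) + gg e Z i k * (gg e Z i (k+1) * UU p x e t Z i k) = gg e Z i (k+1) * (UU p x e t Z i k * τ k) := by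
        rw [← mul_assoc (gg e Z i k) (gg e Z i (k+1)), ← ((cU_g i H X k k).mul_right (cU_g i H X k (k+1))).eq,
          ← mul_assoc (gg e Z i (k+1)), ← (cU_g i H X k (k+1)).eq, mul_assoc (UU p x e t Z i k), r2', mul_add]
      have h1 := LinearMap.congr_fun h1 (w (k + 1 + 1))
      have h2 := LinearMap.congr_fun h2 (w (k + 1))
      have h3 := LinearMap.congr_fun h3 (w k)
      simp only [Module.End.mul_apply, map_add, map_sub, LinearMap.add_apply, LinearMap.sub_apply] at h1 h2 h3 ⊢
      have h2 := eq_sub_of_add_eq' h2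
      rw [h1, ← h3, h2]; abel
    · intro j _ hj
      simp [hj]
    · simp
  rcases eq_or_lt_of_le (show k + 1 + 1 ≤ a from ha) with rfl | ha
  · simp only [ef_gt e i (show k < k + 1 + 1 by omega), ef_gt e i (show k + 1 < k + 1 + 1 by omega), ef_eq,
      xf_gt x t (show k < k + 1 + 1 by omega), xf_eq]
    simp only [TT_eq, TT_eq1, TT_lt' _ _ _ _ _ _ _ (show k ≤ k by omega),
      TT_gt _ _ _ _ _ _ _ (show k + 1 < k + 1 + 1 by omega)]
    rw [Finset.sum_eq_single i]
    · have hS : (∑ l, if i = l then 0 else e k i * e (k + 1) l * (if i = i then 1 else 0) * hh (p i l) (x k) t) =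
          gg e Z i k * (qt p x e t i (k+1) - τ k * τ k) := by
        rw [gq_tt2 H X]
        refine Finset.sum_congr rfl fun l _ => ?_
        simp
      rw [hS, ← ab_k2 r1' cg (cq_g H X i (k+1) k).eq]
      have h1 : UU p x e t Z i (k+1) * (gg e Z i k * ep e (k+1)) = UU p x e t Z i (k+1) * gg e Z i k := by
        rw [← (cep_g H X i (k+1) k).eq, ← mul_assoc, U_ep i H X]
      have h2 : τ k * UU p x e t Z i (k+1) * gg e Z i k =
          UU p x e t Z i (k+1) * -(gg e Z i k * gg e Z i (k+1)) + gg e Z i (k+1) * τ k * UU p x e t Z i (k+1) :=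
        ab_q2 (q1 := qt p x e t i k) (q2 := qt p x e t i (k+1)) r2' cg hU rfl rfl (q_g H X i _) (q_g H X i _) (cq_g H X i _ _).eq (D_g H X i _)
          ((cD_g H X i _ _).eq.symm.trans (D_g1 H X i _))
      have h3 : τ k * UU p x e t Z i (k+1) * UU p x e t Z i k = UU p x e t Z i (k+1) * UU p x e t Z i k * τ k :=
        ab_p2 hU hU' (by
          have hD : Commute (DD p x e i k) (UU p x e t Z i k) := (cD_q H X i k k).sub_right ((cD_g H X i k k).pow_right 2)
          have g1 := (cU_g i H X k k).symm
          have g2 := (cU_g i H X k (k+1)).symm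
          exact ((hD.sub_left ((g1.mul_left g1).mul_left g2)).sub_left ((g1.mul_left g2).mul_left g2)).eq) (cU_U i H X _ _).eq
      have h1 := LinearMap.congr_fun h1 (w (k + 1 + 1))
      have h2 := LinearMap.congr_fun h2 (w (k + 1))
      have h3 := LinearMap.congr_fun h3 (w k)
      rw [← UU]
      simp only [Module.End.mul_apply, map_add, map_sub, map_neg, LinearMap.add_apply, LinearMap.sub_apply, LinearMap.neg_apply] at h1 h2 h3 ⊢
      rw [h1, h2, h3]; abel
    · intro j _ hj
      simp [hj]
    · simp
  · simp only [TT_gt _ _ _ _ _ _ _ (show k + 1 < a by omega), TT_gt _ _ _ _ _ _ _ ha]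
    simp only [ef_gt e i (show k + 2 < a by omega), ef_gt e i (show k + 1 < a by omega), ef_gt e i (show k < a by omega),
      xf_gt x t (show k + 2 < a by omega), xf_gt x t (show k < a by omega)]
    exact LinearMap.congr_fun (H.br k) (w a)

include H X in
theorem W_rel : KRel p (fun k => dg (xf x t k)) (fun k j => dg (ef e i k j)) (TT p x e τ t Z i) where
  xx k l := by
    rw [← map_mul, ← map_mul]; congr 1; funext a
    simp only [Pi.mul_apply, xf]
    split_ifs <;> first | exact H.xx _ _ | exact (X.ct _).eq | exact (X.ct _).eq.symm
  xe k l j := by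
    rw [← map_mul, ← map_mul]; congr 1; funext a
    simp only [Pi.mul_apply, xf, ef]
    split_ifs <;> first | exact H.xe _ _ _ | exact (X.ct _).eq | simp
  ee k l j j' := by
    rw [← map_mul, ← map_mul]; congr 1; funext a
    simp only [Pi.mul_apply, ef]
    split_ifs <;> first | exact H.ee _ _ _ _ | simp
  eid k j := by
    rw [← map_mul]; congr 1; funext a
    simp only [Pi.mul_apply, ef]
    split_ifs <;> first | exact H.eid _ _ | simp
  eorth k j j' h := by
    rw [← map_mul, ← map_zero dg]; congr 1; funext a
    simp only [Pi.mul_apply, ef, Pi.zero_apply]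
    split_ifs with h1 h2 h3 h4 <;> first | exact H.eorth _ _ _ h | (exfalso; exact h (h3.trans h4.symm)) | simp
  tx k l h h' := TT_tx i H X k l h h'
  te k l j h h' := TT_te i H X k l j h h'
  te1 k j := TT_te1 i H X k j
  te0 k j := TT_te0 i H X k j
  tx1 k := TT_tx1 i H X k
  tx0 k := TT_tx0 i H X k
  teps0 k := TT_teps0 i H X k
  teps1 k := TT_teps1 i H X k
  tt k := TT_tt i H X k
  far k l h := TT_far i H X k l h
  br k := TT_br i H X k
end Wlevel2
end

section
open Polynomial Module
set_option linter.unusedSectionVars false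
set_option linter.unusedSimpArgs false
set_option linter.unusedVariables false

section Stab
variable {F W : Type*} [CommRing F] [AddCommGroup W] [Module F W]

def cc (σ : ℕ → Module.End F W) : ℕ → Module.End F W
  | 0 => 1
  | r + 1 => σ r * cc σ r

def YY (σ : ℕ → Module.End F W) (Y0 : AddSubgroup W) : ℕ → AddSubgroup W
  | 0 => Y0
  | m + 1 => YY σ Y0 m ⊔ Y0.map (cc σ (m + 1)).toAddMonoidHom

variable {σ : ℕ → Module.End F W} {Y0 : AddSubgroup W}

theorem YY_mono {m m' : ℕ} (h : m ≤ m') : YY σ Y0 m ≤ YY σ Y0 m' := by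
  induction h with
  | refl => exact le_refl _
  | step _ ih => exact ih.trans le_sup_left

theorem cc_mem {r m : ℕ} (h : r ≤ m) {y : W} (hy : y ∈ Y0) : cc σ r y ∈ YY σ Y0 m := by
  refine YY_mono h ?_
  cases r with
  | zero => exact hy
  | succ r => exact (le_sup_right : _ ≤ YY σ Y0 (r+1)) ⟨y, hy, rfl⟩

theorem YY_induction {m : ℕ} {C : AddSubgroup W} (h : ∀ r ≤ m, ∀ y ∈ Y0, cc σ r y ∈ C) : YY σ Y0 m ≤ C := by
  induction m with
  | zero => intro y hy; exact h 0 le_rfl y hy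
  | succ m ih =>
    refine sup_le (ih fun r hr => h r (by omega)) ?_
    rintro _ ⟨y, hy, rfl⟩
    exact h (m+1) le_rfl y hy

variable (hfar : ∀ m l, m + 1 < l → σ m * σ l = σ l * σ m)
  (hs0 : ∀ m, 1 ≤ m → ∀ y ∈ Y0, σ m y ∈ Y0)
include hfar

theorem cc_far (r l) (h : r < l) : σ l * cc σ r = cc σ r * σ l := by
  induction r with
  | zero => simp [cc]
  | succ r ih => rw [cc, ← mul_assoc, ← hfar _ _ h, mul_assoc, ih (by omega), mul_assoc]

include hs0
theorem sig_succ (m) {y : W} (hy : y ∈ YY σ Y0 m) : σ m y ∈ YY σ Y0 (m + 1) := by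
  refine (YY_induction (C := (YY σ Y0 (m+1)).comap (σ m).toAddMonoidHom) ?_) hy
  clear hy
  intro r hr y hy
  show σ m (cc σ r y) ∈ YY σ Y0 (m+1)
  rcases eq_or_lt_of_le hr with rfl | hr
  · exact cc_mem (r := r + 1) le_rfl hy
  · have := LinearMap.congr_fun (cc_far hfar r m hr) y
    simp only [Module.End.mul_apply] at this
    rw [this]
    exact cc_mem (by omega) (hs0 m (by omega) y hy)

variable (S : Subring (Module.End F W))
  (h1 : ∀ m, ∀ f ∈ S, ∃ f' ∈ S, ∃ f'' ∈ S, f * σ m = σ m * f' + f'')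
  (h2 : ∀ m, σ m * σ m ∈ S)
  (h4 : ∀ m, ∃ h ∈ S, σ m * σ (m + 1) * σ m = σ (m + 1) * σ m * σ (m + 1) + h)
  (hS0 : ∀ f ∈ S, ∀ y ∈ Y0, f y ∈ Y0)
include h1 h2 h4 hS0

theorem stab_aux (m) : (∀ f ∈ S, ∀ y ∈ YY σ Y0 m, f y ∈ YY σ Y0 m) ∧
    (∀ l, l ≠ m → ∀ y ∈ YY σ Y0 m, σ l y ∈ YY σ Y0 m) := by
  induction m with
  | zero => exact ⟨hS0, fun l hl => hs0 l (by omega)⟩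
  | succ m ih =>
    obtain ⟨ihS, ihσ⟩ := ih
    have hle : YY σ Y0 m ≤ YY σ Y0 (m + 1) := YY_mono (by omega)
    have hss := fun y hy => sig_succ hfar hs0 m (y := y) hy
    have hS : ∀ f ∈ S, ∀ y ∈ YY σ Y0 (m+1), f y ∈ YY σ Y0 (m+1) := by
      intro f hf y hy
      refine (sup_le ?_ ?_ : YY σ Y0 (m+1) ≤ (YY σ Y0 (m+1)).comap f.toAddMonoidHom) hy
      · intro y hy; exact hle (ihS f hf y hy)
      · rintro _ ⟨y, hy, rfl⟩
        show f (σ m (cc σ m y)) ∈ YY σ Y0 (m+1)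
        obtain ⟨f', hf', f'', hf'', h⟩ := h1 m f hf
        have h := LinearMap.congr_fun h (cc σ m y)
        simp only [Module.End.mul_apply, LinearMap.add_apply] at h
        rw [h]
        exact add_mem (hss _ (ihS _ hf' _ (cc_mem le_rfl hy))) (hle (ihS _ hf'' _ (cc_mem le_rfl hy)))
    refine ⟨hS, ?_⟩
    intro l hl y hy
    refine (sup_le ?_ ?_ : YY σ Y0 (m+1) ≤ (YY σ Y0 (m+1)).comap (σ l).toAddMonoidHom) hy
    · intro y hy
      show σ l y ∈ YY σ Y0 (m+1)
      rcases eq_or_ne l m with rfl | h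
      · exact hss y hy
      · exact hle (ihσ l h y hy)
    · clear hy
      rintro _ ⟨y, hy, rfl⟩
      show σ l (σ m (cc σ m y)) ∈ YY σ Y0 (m+1)
      have hcm : cc σ m y ∈ YY σ Y0 m := cc_mem le_rfl hy
      rcases lt_trichotomy l m with h | h | h
      · rcases eq_or_ne m (l + 1) with rfl | h'
        · show σ l (σ (l+1) (σ l (cc σ l y))) ∈ YY σ Y0 (l+1+1)
          obtain ⟨f, hf, h⟩ := h4 l
          have h := LinearMap.congr_fun h (cc σ l y)
          simp only [Module.End.mul_apply, LinearMap.add_apply] at h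
          rw [h]
          have hcl : cc σ l y ∈ YY σ Y0 l := cc_mem le_rfl hy
          refine add_mem ?_ (hS f hf _ (YY_mono (by omega) hcl))
          have h3 : σ (l + 1) (cc σ l y) ∈ YY σ Y0 l := by
            have := LinearMap.congr_fun (cc_far hfar l (l+1) (by omega)) y
            simp only [Module.End.mul_apply] at this
            rw [this]
            exact cc_mem le_rfl (hs0 _ (by omega) _ hy)
          exact hss _ (sig_succ hfar hs0 l h3)
        · have := LinearMap.congr_fun (hfar l m (by omega)) (cc σ m y)
          simp only [Module.End.mul_apply] at this
          rw [this]
          exact hss _ (ihσ l (by omega) _ hcm)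
      · subst h
        exact hS _ (h2 l) _ (hle hcm)
      · have := LinearMap.congr_fun (hfar m l (by omega)) (cc σ m y)
        simp only [Module.End.mul_apply] at this
        rw [← this]
        exact hss _ (ihσ l (by omega) _ hcm)
end Stab

section KS
variable {I : Type*} [Fintype I] [DecidableEq I] {p : I → I → ℕ} {A : Type*} [Ring A]
    {x : ℕ → A} {e : ℕ → I → A} {τ : ℕ → A}

def polyS (x : ℕ → A) (e : ℕ → I → A) : Subring A :=
  Subring.closure (Set.range x ∪ Set.range fun q : ℕ × I => e q.1 q.2)

theorem x_mem_polyS (k) : x k ∈ polyS x e := Subring.subset_closure (Or.inl ⟨k, rfl⟩)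
theorem e_mem_polyS (k j) : e k j ∈ polyS x e := Subring.subset_closure (Or.inr ⟨(k, j), rfl⟩)

variable (H : KRel p x e τ)
include H

theorem K_h1 (k) : ∀ f ∈ polyS x e, ∃ f' ∈ polyS x e, ∃ f'' ∈ polyS x e, f * τ k = τ k * f' + f'' := by
  intro f hf
  have hSm : (∑ j, e k j * e (k + 1) j) ∈ polyS x e :=
    Subring.sum_mem _ fun j _ => Subring.mul_mem _ (e_mem_polyS _ _) (e_mem_polyS _ _)
  refine Subring.closure_induction ?_ ?_ ?_ ?_ ?_ ?_ hf
  · rintro _ (⟨l, rfl⟩ | ⟨⟨l, j⟩, rfl⟩)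
    · by_cases h : l = k
      · subst h
        refine ⟨x (l+1), x_mem_polyS _, -∑ j, e l j * e (l + 1) j, neg_mem hSm, ?_⟩
        rw [H.tx1]; abel
      by_cases h' : l = k + 1
      · subst h'
        exact ⟨x k, x_mem_polyS _, _, hSm, H.tx0 k⟩
      · exact ⟨x l, x_mem_polyS _, 0, zero_mem _, by rw [H.tx k l h h', add_zero]⟩
    · by_cases h : l = k
      · subst h
        exact ⟨e (l+1) j, e_mem_polyS _ _, 0, zero_mem _, by rw [H.te1, add_zero]⟩
      by_cases h' : l = k + 1
      · subst h'
        exact ⟨e k j, e_mem_polyS _ _, 0, zero_mem _, by rw [H.te0, add_zero]⟩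
      · exact ⟨e l j, e_mem_polyS _ _, 0, zero_mem _, by rw [H.te k l j h h', add_zero]⟩
  · exact ⟨0, zero_mem _, 0, zero_mem _, by simp⟩
  · exact ⟨1, one_mem _, 0, zero_mem _, by simp⟩
  · rintro f g _ _ ⟨f1, h1, f2, h2, h3⟩ ⟨g1, k1, g2, k2, k3⟩
    exact ⟨f1 + g1, add_mem h1 k1, f2 + g2, add_mem h2 k2, by rw [add_mul, h3, k3]; noncomm_ring⟩
  · rintro f _ ⟨f1, h1, f2, h2, h3⟩
    exact ⟨-f1, neg_mem h1, -f2, neg_mem h2, by rw [neg_mul, h3]; noncomm_ring⟩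
  · rintro f g hf hg ⟨f1, h1, f2, h2, h3⟩ ⟨g1, k1, g2, k2, k3⟩
    refine ⟨f1 * g1, mul_mem h1 k1, f2 * g1 + f * g2, add_mem (mul_mem h2 k1) (mul_mem hf k2), ?_⟩
    rw [mul_assoc, k3, mul_add, ← mul_assoc, h3]; noncomm_ring

theorem K_h2 (k) : τ k * τ k ∈ polyS x e := by
  rw [H.tt]
  refine Subring.sum_mem _ fun j _ => Subring.sum_mem _ fun l _ => ?_
  split_ifs
  · exact zero_mem _
  · exact mul_mem (mul_mem (e_mem_polyS _ _) (e_mem_polyS _ _))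
      (add_mem (pow_mem (x_mem_polyS _) _) (pow_mem (x_mem_polyS _) _))

theorem K_h4 (k) : ∃ h ∈ polyS x e, τ k * τ (k + 1) * τ k + h = τ (k + 1) * τ k * τ (k + 1) := by
  refine ⟨_, ?_, H.br k⟩
  refine Subring.sum_mem _ fun j _ => Subring.sum_mem _ fun l _ => ?_
  split_ifs
  · exact zero_mem _
  · exact mul_mem (mul_mem (mul_mem (e_mem_polyS _ _) (e_mem_polyS _ _)) (e_mem_polyS _ _))
      (Subring.sum_mem _ fun r _ => mul_mem (pow_mem (x_mem_polyS _) _) (pow_mem (x_mem_polyS _) _))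

theorem KRel.comap {A' : Type*} [Ring A'] (f : A' →+* A) (hf : Function.Injective f)
    {x' : ℕ → A'} {e' : ℕ → I → A'} {τ' : ℕ → A'} (hx : ∀ k, f (x' k) = x k)
    (he : ∀ k j, f (e' k j) = e k j) (hτ : ∀ k, f (τ' k) = τ k) : KRel p x' e' τ' where
  xx k l := hf (by simp only [map_mul, hx, H.xx k l])
  xe k l j := hf (by simp only [map_mul, hx, he, H.xe k l])
  ee k l j j' := hf (by simp only [map_mul, he, H.ee k l j j'])
  eid k j := hf (by simp only [map_mul, he, H.eid])
  eorth k j j' h := hf (by simp only [map_mul, he, H.eorth k j j' h, map_zero])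
  tx k l h h' := hf (by simp only [map_mul, hx, hτ, H.tx k l h h'])
  te k l j h h' := hf (by simp only [map_mul, he, hτ, H.te k l j h h'])
  te1 k j := hf (by simp only [map_mul, he, hτ, H.te1])
  te0 k j := hf (by simp only [map_mul, he, hτ, H.te0])
  tx1 k := hf (by simp only [map_mul, hx, he, hτ, H.tx1, map_add, map_sum])
  tx0 k := hf (by simp only [map_mul, hx, he, hτ, H.tx0, map_add, map_sum])
  teps0 k := hf (by simp only [map_mul, he, hτ, H.teps0, map_sum])
  teps1 k := hf (by simp only [map_mul, he, hτ, H.teps1, map_sum])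
  tt k := hf (by
    rw [map_mul, hτ, H.tt, map_sum]
    refine Finset.sum_congr rfl fun j _ => ?_
    rw [map_sum]
    refine Finset.sum_congr rfl fun l _ => ?_
    split_ifs <;> simp [hx, he])
  far k l h := hf (by simp only [map_mul, hτ, H.far k l h])
  br k := hf (by
    simp only [map_mul, map_add, hτ]
    rw [← H.br, map_sum]
    congr 1
    refine Finset.sum_congr rfl fun j _ => ?_
    rw [map_sum]
    refine Finset.sum_congr rfl fun l _ => ?_
    split_ifs <;> simp [map_hh, hx, he])
end KS
end

section
open Polynomial Module
set_option linter.unusedSectionVars false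
set_option linter.unusedSimpArgs false
set_option linter.unusedVariables false

/-- weight idempotents -/
def EN {I A : Type*} [Ring A] (e : ℕ → I → A) : ℕ → (ℕ → I) → A
  | 0, _ => 1
  | N + 1, μ => EN e N μ * e N (μ N)

/-- remove the letter at position `a` -/
def rem {I : Type*} (μ : ℕ → I) (a : ℕ) : ℕ → I := fun k => if k < a then μ k else μ (k + 1)

theorem EN_congr {I A : Type*} [Ring A] {e : ℕ → I → A} {N : ℕ} {μ μ' : ℕ → I}
    (h : ∀ k < N, μ k = μ' k) : EN e N μ = EN e N μ' := by
  induction N with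
  | zero => rfl
  | succ N ih => rw [EN, EN, ih fun k hk => h k (by omega), h N (by omega)]

theorem map_EN {I A A' : Type*} [Ring A] [Ring A'] (f : A →+* A') (e : ℕ → I → A) (N : ℕ) (μ : ℕ → I) :
    f (EN e N μ) = EN (fun k j => f (e k j)) N μ := by
  induction N with
  | zero => simp [EN]
  | succ N ih => simp [EN, ih]

section EN
variable {I : Type*} [Fintype I] [DecidableEq I] {p : I → I → ℕ} {A : Type*} [Ring A]
    {x : ℕ → A} {e : ℕ → I → A} {τ : ℕ → A}
variable (H : KRel p x e τ)
include H

theorem EN_e (N μ l j) : EN e N μ * e l j = e l j * EN e N μ := by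
  induction N with
  | zero => simp [EN]
  | succ N ih => rw [EN, mul_assoc, H.ee, ← mul_assoc, ih, mul_assoc]

theorem EN_x (N μ l) : EN e N μ * x l = x l * EN e N μ := by
  induction N with
  | zero => simp [EN]
  | succ N ih => rw [EN, mul_assoc, ← H.xe, ← mul_assoc, ih, mul_assoc]

theorem EN_idem (N μ) : EN e N μ * EN e N μ = EN e N μ := by
  induction N with
  | zero => simp [EN]
  | succ N ih =>
    rw [EN, mul_assoc, ← mul_assoc (e N _), ← EN_e H N μ N, ← mul_assoc, ← mul_assoc, ih,
      mul_assoc, H.eid]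

theorem EN_absorb (N μ k j) (hk : k < N) : EN e N μ * e k j = if j = μ k then EN e N μ else 0 := by
  induction N with
  | zero => omega
  | succ N ih =>
    rw [EN]
    rcases eq_or_ne k N with rfl | h
    · rw [mul_assoc]
      split_ifs with h
      · rw [h, H.eid]
      · rw [H.eorth _ _ _ (Ne.symm h), mul_zero]
    · rw [mul_assoc, H.ee, ← mul_assoc, ih (by omega)]
      split_ifs <;> simp

theorem EN_tau_lt (N μ a) (h : N ≤ a) : EN e N μ * τ a = τ a * EN e N μ := by
  induction N with
  | zero => simp [EN]
  | succ N ih => rw [EN, mul_assoc, ← H.te a N _ (by omega) (by omega), ← mul_assoc, ih (by omega), mul_assoc]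

theorem EN_tau (N μ a) (h : a + 2 ≤ N) : EN e N μ * τ a = τ a * EN e N (μ ∘ Equiv.swap a (a + 1)) := by
  induction N, h using Nat.le_induction with
  | base =>
    rw [EN, EN, mul_assoc, mul_assoc, ← H.te0, ← mul_assoc (e a _), ← H.te1, EN, EN, ← mul_assoc, ← mul_assoc,
      EN_tau_lt H a μ a le_rfl]
    have : EN e a (μ ∘ Equiv.swap a (a+1)) = EN e a μ := EN_congr fun k hk => by
      simp only [Function.comp]; rw [Equiv.swap_apply_of_ne_of_ne (by omega) (by omega)]
    rw [this]
    simp only [Function.comp, Equiv.swap_apply_left, Equiv.swap_apply_right]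
    rw [mul_assoc, mul_assoc, H.ee]; noncomm_ring
  | succ N hN ih =>
    rw [EN, mul_assoc, ← H.te a N _ (by omega) (by omega), ← mul_assoc, ih, EN, mul_assoc]
    simp only [Function.comp]; rw [Equiv.swap_apply_of_ne_of_ne (by omega) (by omega)]
end EN

section Lat
variable {F P : Type*} [CommRing F] [AddCommGroup P] [Module F P]
variable {I : Type*} [Fintype I] [DecidableEq I] {p : I → I → ℕ}
    {x : ℕ → Module.End F P} {e : ℕ → I → Module.End F P} {τ : ℕ → Module.End F P}
    {t : Module.End F P} {Z : ℕ → Module.End F P} (i : I)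

theorem EN_ef_le (N a : ℕ) (μ : ℕ → I) (h : N ≤ a) : EN (ef e i) N μ a = EN e N μ := by
  induction N with
  | zero => simp [EN]
  | succ N ih => rw [EN, Pi.mul_apply, ih (by omega), ef_gt e i (by omega), EN]

theorem EN_ef (m a : ℕ) (μ : ℕ → I) (h : a ≤ m) :
    EN (ef e i) (m + 1) μ a = if μ a = i then EN e m (rem μ a) else 0 := by
  induction m, h using Nat.le_induction with
  | base =>
    rw [EN, Pi.mul_apply, EN_ef_le i a a μ le_rfl, ef_eq, EN_congr (μ := rem μ a) (μ' := μ)]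
    · split_ifs <;> simp
    · intro k hk; simp [rem, hk]
  | succ m hm ih =>
    rw [EN, Pi.mul_apply, ih, ef_lt' e i (by omega), EN]
    have : rem μ a m = μ (m + 1) := by simp [rem, not_lt.2 hm]
    rw [this]
    split_ifs <;> simp

/-- the reversed family -/
def sI (T : ℕ → Module.End F (ℕ → P)) (n : ℕ) (m : ℕ) : Module.End F (ℕ → P) := if m < n then T (n - 1 - m) else 0

def sg (a : ℕ) : P →ₗ[F] (ℕ → P) := LinearMap.single F (fun _ : ℕ => P) a

theorem sg_same (a : ℕ) (v : P) : sg (F := F) a v a = v := by simp [sg]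
theorem sg_ne {a b : ℕ} (h : b ≠ a) (v : P) : sg (F := F) a v b = 0 := by simp [sg, h]

theorem dg_sg (f : ℕ → Module.End F P) (a : ℕ) (v : P) : dg f (sg (F := F) a v) = sg (F := F) a (f a v) := by
  funext b
  rw [dg_apply]
  by_cases h : b = a
  · subst h; rw [sg_same, sg_same]
  · rw [sg_ne h, sg_ne h, map_zero]

variable (p x e τ t Z) in
def bI (n r : ℕ) : P →ₗ[F] (ℕ → P) := cc (sI (TT p x e τ t Z i) n) r ∘ₗ sg n
variable (p x e τ t Z) in
def bN (ℓ r : ℕ) : P →ₗ[F] (ℕ → P) := cc (TT p x e τ t Z i) r ∘ₗ sg 0 ∘ₗ (t ^ ℓ)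
variable (p x e t Z) in
def DN (ℓ : ℕ) : ℕ → Module.End F P
  | 0 => t ^ ℓ
  | r + 1 => UU p x e t Z i r * DN ℓ r

variable (H : KRel p x e τ) (X : KExt x t Z) {n : ℕ}

theorem bI_succ {r : ℕ} (h : r < n) (v : P) :
    bI p x e τ t Z i n (r + 1) v = TT p x e τ t Z i (n - 1 - r) (bI p x e τ t Z i n r v) := by
  simp [bI, cc, sI, h]
theorem bN_succ {ℓ r : ℕ} (v : P) :
    bN p x e τ t Z i ℓ (r + 1) v = TT p x e τ t Z i r (bN p x e τ t Z i ℓ r v) := by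
  simp [bN, cc]

variable (hone : ∀ k < n, ∑ j, e k j = 1)
include hone in
theorem bI_comp (r : ℕ) (hr : r ≤ n) (v : P) : bI p x e τ t Z i n r v (n - r) = v ∧
    (∀ a < n - r, bI p x e τ t Z i n r v a = 0) ∧ (∀ a > n, bI p x e τ t Z i n r v a = 0) := by
  induction r with
  | zero =>
    simp only [bI, cc, Nat.sub_zero]
    refine ⟨sg_same _ _, fun a ha => sg_ne (by omega) v, fun a ha => sg_ne (by omega) v⟩
  | succ r ih =>
    obtain ⟨i1, i2, i3⟩ := ih (by omega)
    rw [bI_succ i (by omega)]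
    have e1 : n - (r + 1) = n - 1 - r := by omega
    have e2 : n - 1 - r + 1 = n - r := by omega
    rw [e1]
    refine ⟨?_, ?_, ?_⟩
    · rw [TT_eq, e2, i1, i2 _ (by omega), map_zero, sub_zero, ep, hone _ (by omega)]; rfl
    · intro a ha; rw [TT_lt _ _ _ _ _ _ _ ha, i2 a (by omega), map_zero]
    · intro a ha; rw [TT_gt _ _ _ _ _ _ _ (by omega), i3 a ha, map_zero]

theorem bN_comp (ℓ r : ℕ) (v : P) : bN p x e τ t Z i ℓ r v r = DN p x e t Z i ℓ r v ∧
    (∀ a > r, bN p x e τ t Z i ℓ r v a = 0) := by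
  induction r with
  | zero =>
    exact ⟨sg_same (F := F) 0 ((t ^ ℓ) v), fun a ha => sg_ne (F := F) (by omega) ((t ^ ℓ) v)⟩
  | succ r ih =>
    obtain ⟨i1, i2⟩ := ih
    rw [bN_succ]
    refine ⟨?_, ?_⟩
    · rw [TT_eq1, i1, i2 _ (by omega), map_zero, add_zero]; rfl
    · intro a ha; rw [TT_gt _ _ _ _ _ _ _ (by omega), i2 a (by omega), map_zero]

theorem rem_swap (μ : ℕ → I) (a : ℕ) : rem (μ ∘ Equiv.swap a (a + 1)) (a + 1) = rem μ a := by
  funext k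
  simp only [rem, Function.comp]
  rcases lt_trichotomy k a with h | h | h
  · rw [if_pos (by omega), if_pos h, Equiv.swap_apply_of_ne_of_ne (by omega) (by omega)]
  · subst h; rw [if_pos (by omega), if_neg (by omega), Equiv.swap_apply_left]
  · rw [if_neg (by omega), if_neg (by omega), Equiv.swap_apply_of_ne_of_ne (by omega) (by omega)]
theorem rem_swap' (μ : ℕ → I) (a : ℕ) : rem (μ ∘ Equiv.swap a (a + 1)) a = rem μ (a + 1) := by
  rw [← rem_swap]
  congr 1
  funext k; simp

variable (e n) in
def Ea (μ : ℕ → I) (a : ℕ) : Module.End F P := if μ a = i then EN e n (rem μ a) else 0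

theorem Ea_swap (μ : ℕ → I) (a : ℕ) : Ea e i n (μ ∘ Equiv.swap a (a + 1)) (a + 1) = Ea e i n μ a := by
  rw [Ea, Ea, rem_swap]; simp
theorem Ea_swap' (μ : ℕ → I) (a : ℕ) : Ea e i n (μ ∘ Equiv.swap a (a + 1)) a = Ea e i n μ (a + 1) := by
  rw [Ea, Ea, rem_swap']; simp

theorem dg_EN_sg (μ : ℕ → I) {a : ℕ} (ha : a ≤ n) (v : P) :
    EN (fun k j => dg (ef e i k j)) (n + 1) μ (sg (F := F) a v) = sg (F := F) a (Ea e i n μ a v) := by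
  rw [← map_EN, dg_sg, EN_ef i n a μ ha]; rfl

include H X in
theorem EN_bI (r : ℕ) (hr : r ≤ n) (μ : ℕ → I) (v : P) :
    EN (fun k j => dg (ef e i k j)) (n + 1) μ (bI p x e τ t Z i n r v) =
      bI p x e τ t Z i n r (Ea e i n μ (n - r) v) := by
  induction r generalizing μ with
  | zero => exact dg_EN_sg i μ le_rfl v
  | succ r ih =>
    rw [bI_succ i (by omega), bI_succ i (by omega)]
    have := LinearMap.congr_fun (EN_tau (W_rel i H X) (n + 1) μ (n - 1 - r) (by omega))
      (bI p x e τ t Z i n r v)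
    simp only [Module.End.mul_apply] at this
    rw [this, ih (by omega)]
    have e1 : n - (r + 1) = n - 1 - r := by omega
    have e2 : n - r = n - 1 - r + 1 := by omega
    rw [e1, e2, Ea_swap]

include H X in
theorem EN_bN (ℓ r : ℕ) (hr : r ≤ n) (μ : ℕ → I) (v : P) :
    EN (fun k j => dg (ef e i k j)) (n + 1) μ (bN p x e τ t Z i ℓ r v) =
      bN p x e τ t Z i ℓ r (Ea e i n μ r v) := by
  induction r generalizing μ with
  | zero =>
    refine (dg_EN_sg i μ (by omega) ((t ^ ℓ) v)).trans ?_
    have : Commute (Ea e i n μ 0) (t ^ ℓ) := ((X.ct _).pow_left _).symm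
    have := LinearMap.congr_fun this.eq v
    simp only [Module.End.mul_apply] at this
    rw [this]; rfl
  | succ r ih =>
    rw [bN_succ, bN_succ]
    have := LinearMap.congr_fun (EN_tau (W_rel i H X) (n + 1) μ r (by omega))
      (bN p x e τ t Z i ℓ r v)
    simp only [Module.End.mul_apply] at this
    rw [this, ih (by omega), Ea_swap']

variable (hv : ∀ k, n ≤ k → ∀ j, e k j = 0)
include H hv in
theorem tau_zero (k) (hk : n ≤ k + 1) : τ k = 0 := by
  rw [← H.teps1 k]; simp [hv (k+1) hk]
include H hv in
theorem TT_zero (k) (hk : n ≤ k) : TT p x e τ t Z i k = 0 := by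
  apply LinearMap.ext; intro w; funext a
  have hτ := tau_zero H hv
  rcases lt_or_ge a k with ha | ha
  · rw [TT_lt _ _ _ _ _ _ _ ha, hτ _ (by omega)]; rfl
  rcases eq_or_lt_of_le ha with rfl | ha
  · rw [TT_eq]; simp [ep, gg, hv _ hk]
  rcases eq_or_lt_of_le (show k + 1 ≤ a from ha) with rfl | ha
  · rw [TT_eq1]; simp [UU, qt, gg, hv _ hk]
  · rw [TT_gt _ _ _ _ _ _ _ ha, hτ _ (by omega)]; rfl

variable (P0 : AddSubgroup P)
variable (p x e τ t Z n) in
def LI : AddSubgroup (ℕ → P) := YY (sI (TT p x e τ t Z i) n) (P0.map (sg (F := F) n).toAddMonoidHom) n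
variable (p x e τ t Z n) in
def LN (ℓ : ℕ) : AddSubgroup (ℕ → P) := YY (TT p x e τ t Z i) (P0.map (sg (F := F) 0 ∘ₗ (t ^ ℓ)).toAddMonoidHom) n

variable (hx0 : ∀ k, ∀ v ∈ P0, x k v ∈ P0) (he0 : ∀ k j, ∀ v ∈ P0, e k j v ∈ P0)
  (hτ0 : ∀ k, ∀ v ∈ P0, τ k v ∈ P0) (ht0 : ∀ v ∈ P0, t v ∈ P0)

abbrev SW (x : ℕ → Module.End F P) (e : ℕ → I → Module.End F P) (t : Module.End F P) (i : I) : Subring (Module.End F (ℕ → P)) :=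
  polyS (fun k => dg (xf x t k)) (fun k j => dg (ef e i k j))

include hx0 he0 ht0 in
theorem SW_diag {f : Module.End F (ℕ → P)} (hf : f ∈ SW x e t i) :
    ∃ g : ℕ → Module.End F P, f = dg g ∧ ∀ a, ∀ v ∈ P0, g a v ∈ P0 := by
  refine Subring.closure_induction ?_ ?_ ?_ ?_ ?_ ?_ hf
  · rintro _ (⟨l, rfl⟩ | ⟨⟨l, j⟩, rfl⟩)
    · refine ⟨_, rfl, fun a v hv => ?_⟩
      simp only [xf]; split_ifs
      · exact hx0 _ v hv
      · exact ht0 v hv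
      · exact hx0 _ v hv
    · refine ⟨_, rfl, fun a v hv => ?_⟩
      simp only [ef]; split_ifs
      · exact he0 _ _ v hv
      · exact hv
      · exact zero_mem _
      · exact he0 _ _ v hv
  · exact ⟨0, by simp, fun a v hv => zero_mem _⟩
  · exact ⟨1, by simp, fun a v hv => hv⟩
  · rintro f g _ _ ⟨f', rfl, h1⟩ ⟨g', rfl, h2⟩
    exact ⟨f' + g', by simp, fun a v hv => add_mem (h1 a v hv) (h2 a v hv)⟩
  · rintro f _ ⟨f', rfl, h1⟩
    exact ⟨-f', by simp, fun a v hv => neg_mem (h1 a v hv)⟩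
  · rintro f g _ _ ⟨f', rfl, h1⟩ ⟨g', rfl, h2⟩
    exact ⟨f' * g', by simp, fun a v hv => h1 a _ (h2 a v hv)⟩

include H X hx0 he0 ht0 hτ0 in
theorem LI_stab0 : (∀ f ∈ SW x e t i, ∀ y ∈ LI p x e τ t Z i n P0, f y ∈ LI p x e τ t Z i n P0) ∧
    (∀ l, l ≠ n → ∀ y ∈ LI p x e τ t Z i n P0, sI (TT p x e τ t Z i) n l y ∈ LI p x e τ t Z i n P0) := by
  have HW := W_rel i H X
  refine stab_aux ?_ ?_ _ ?_ ?_ ?_ ?_ n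
  · intro m l h
    simp only [sI]; split_ifs with h1 h2
    · exact (HW.far _ _ (by omega)).symm
    all_goals simp
  · rintro m hm _ ⟨v, hv, rfl⟩
    simp only [sI]; split_ifs with h1
    · refine ⟨τ (n - 1 - m) v, hτ0 _ v hv, ?_⟩
      funext a
      show sg (F := F) n (τ (n-1-m) v) a = TT p x e τ t Z i (n - 1 - m) (sg (F := F) n v) a
      rcases lt_or_ge a (n-1-m) with ha | ha
      · rw [TT_lt _ _ _ _ _ _ _ ha, sg_ne (by omega), sg_ne (by omega), map_zero]
      rcases eq_or_lt_of_le ha with rfl | ha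
      · rw [TT_eq, sg_ne (by omega), sg_ne (by omega), sg_ne (by omega), map_zero, map_zero, sub_zero]
      rcases eq_or_lt_of_le (show n-1-m + 1 ≤ a from ha) with rfl | ha
      · rw [TT_eq1, sg_ne (by omega), sg_ne (by omega), sg_ne (by omega), map_zero, map_zero, add_zero]
      rw [TT_gt _ _ _ _ _ _ _ ha]
      by_cases h : a = n
      · subst h; rw [sg_same, sg_same]
      · rw [sg_ne h, sg_ne h, map_zero]
    · exact zero_mem _
  · intro m f hf
    simp only [sI]; split_ifs with h1
    · exact K_h1 HW _ f hf
    · exact ⟨0, zero_mem _, 0, zero_mem _, by simp⟩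
  · intro m
    simp only [sI]; split_ifs with h1
    · exact K_h2 HW _
    · simp
  · intro m
    simp only [sI]; split_ifs with h1 h2
    · obtain ⟨h, hh, hq⟩ := K_h4 HW (n - 1 - (m + 1))
      have : n - 1 - (m+1) + 1 = n - 1 - m := by omega
      rw [this] at hq
      exact ⟨h, hh, hq.symm⟩
    · exact ⟨0, zero_mem _, by simp⟩
    · exact ⟨0, zero_mem _, by simp⟩
    · exact ⟨0, zero_mem _, by simp⟩
  · rintro f hf _ ⟨v, hv, rfl⟩
    obtain ⟨g, rfl, hg⟩ := SW_diag i P0 hx0 he0 ht0 hf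
    exact ⟨g n v, hg n v hv, (dg_sg g n v).symm⟩

include H X hx0 he0 ht0 hτ0 hv in
theorem LI_T (k) : ∀ y ∈ LI p x e τ t Z i n P0, TT p x e τ t Z i k y ∈ LI p x e τ t Z i n P0 := by
  intro y hy
  rcases lt_or_ge k n with h | h
  · have := (LI_stab0 i H X P0 hx0 he0 hτ0 ht0).2 (n - 1 - k) (by omega) y hy
    rw [sI, if_pos (by omega)] at this
    have e1 : n - 1 - (n - 1 - k) = k := by omega
    rwa [e1] at this
  · rw [TT_zero i H hv k h]; exact zero_mem _

include H X hx0 he0 ht0 hτ0 in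
theorem LN_stab0 (ℓ : ℕ) : (∀ f ∈ SW x e t i, ∀ y ∈ LN p x e τ t Z i n P0 ℓ, f y ∈ LN p x e τ t Z i n P0 ℓ) ∧
    (∀ l, l ≠ n → ∀ y ∈ LN p x e τ t Z i n P0 ℓ, TT p x e τ t Z i l y ∈ LN p x e τ t Z i n P0 ℓ) := by
  have HW := W_rel i H X
  have comm : ∀ (g : Module.End F P) v, g ((t ^ ℓ) v) = (t ^ ℓ) (g v) := fun g v =>
    LinearMap.congr_fun ((X.ct g).pow_left ℓ).eq.symm v
  refine stab_aux HW.far ?_ _ (fun m => K_h1 HW m) (K_h2 HW) ?_ ?_ n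
  · rintro m hm _ ⟨v, hv, rfl⟩
    refine ⟨τ (m - 1) v, hτ0 _ v hv, ?_⟩
    funext a
    show sg (F := F) 0 ((t ^ ℓ) (τ (m-1) v)) a = TT p x e τ t Z i m (sg (F := F) 0 ((t ^ ℓ) v)) a
    rw [← comm]
    rcases lt_or_ge a m with ha | ha
    · rw [TT_lt _ _ _ _ _ _ _ ha]
      by_cases h : a = 0
      · subst h; rw [sg_same, sg_same]
      · rw [sg_ne h, sg_ne h, map_zero]
    rcases eq_or_lt_of_le ha with rfl | ha
    · rw [TT_eq, sg_ne (by omega), sg_ne (by omega), sg_ne (by omega), map_zero, map_zero, sub_zero]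
    rcases eq_or_lt_of_le (show m + 1 ≤ a from ha) with rfl | ha
    · rw [TT_eq1, sg_ne (by omega), sg_ne (by omega), sg_ne (by omega), map_zero, map_zero, add_zero]
    rw [TT_gt _ _ _ _ _ _ _ ha, sg_ne (by omega), sg_ne (by omega), map_zero]
  · intro m
    obtain ⟨h, hh, hq⟩ := K_h4 HW m
    exact ⟨-h, neg_mem hh, by rw [← hq]; abel⟩
  · rintro f hf _ ⟨v, hv, rfl⟩
    obtain ⟨g, rfl, hg⟩ := SW_diag i P0 hx0 he0 ht0 hf
    refine ⟨g 0 v, hg 0 v hv, ?_⟩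
    show sg (F := F) 0 ((t ^ ℓ) (g 0 v)) = dg g (sg (F := F) 0 ((t ^ ℓ) v))
    rw [dg_sg, comm]

include H X hx0 he0 ht0 hτ0 hv in
theorem LN_T (ℓ k) : ∀ y ∈ LN p x e τ t Z i n P0 ℓ, TT p x e τ t Z i k y ∈ LN p x e τ t Z i n P0 ℓ := by
  intro y hy
  rcases lt_or_ge k n with h | h
  · exact (LN_stab0 i H X P0 hx0 he0 hτ0 ht0 ℓ).2 k (by omega) y hy
  · rw [TT_zero i H hv k h]; exact zero_mem _

theorem bI_mem {r : ℕ} (hr : r ≤ n) {v : P} (hv : v ∈ P0) : bI p x e τ t Z i n r v ∈ LI p x e τ t Z i n P0 :=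
  cc_mem hr (⟨v, hv, rfl⟩ : sg (F := F) n v ∈ P0.map (sg (F := F) n).toAddMonoidHom)
theorem bN_mem {ℓ r : ℕ} (hr : r ≤ n) {v : P} (hv : v ∈ P0) : bN p x e τ t Z i ℓ r v ∈ LN p x e τ t Z i n P0 ℓ :=
  cc_mem hr (⟨v, hv, rfl⟩ : (sg (F := F) 0 ∘ₗ (t ^ ℓ)) v ∈ P0.map (sg (F := F) 0 ∘ₗ (t ^ ℓ)).toAddMonoidHom)
theorem LI_ind {C : AddSubgroup (ℕ → P)} (h : ∀ r ≤ n, ∀ v ∈ P0, bI p x e τ t Z i n r v ∈ C) :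
    LI p x e τ t Z i n P0 ≤ C :=
  YY_induction (by rintro r hr _ ⟨v, hv, rfl⟩; exact h r hr v hv)
theorem LN_ind {ℓ : ℕ} {C : AddSubgroup (ℕ → P)} (h : ∀ r ≤ n, ∀ v ∈ P0, bN p x e τ t Z i ℓ r v ∈ C) :
    LN p x e τ t Z i n P0 ℓ ≤ C :=
  YY_induction (by rintro r hr _ ⟨v, hv, rfl⟩; exact h r hr v hv)

/-- the cyclotomic element -/
def cyc {A : Type*} [Ring A] (x : ℕ → A) (e : ℕ → I → A) (ℓ : I → ℕ) : A := ∑ j, e 0 j * x 0 ^ ℓ j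

variable (ℓ : I → ℕ) (hc : cyc x e ℓ = 0)
include hc in
theorem cyc_W (w : ℕ → P) : cyc (fun k => dg (xf x t k)) (fun k j => dg (ef e i k j)) ℓ w =
    sg (F := F) 0 ((t ^ ℓ i) (w 0)) := by
  have : cyc (fun k => dg (xf x t k)) (fun k j => dg (ef e i k j)) ℓ =
      dg (cyc (xf x t) (ef e i) ℓ) := by simp [cyc]
  rw [this]
  funext a
  rw [dg_apply, cyc, Finset.sum_apply]
  simp only [Pi.mul_apply, Pi.pow_apply]
  by_cases h : a = 0
  · subst h
    simp only [ef_eq, xf_eq, sum_dirac]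
    rw [sg_same]
  · simp only [ef_gt e i (Nat.pos_of_ne_zero h), xf_gt x t (Nat.pos_of_ne_zero h)]
    rw [sg_ne h]
    exact LinearMap.congr_fun hc (w a)

include hone in
theorem LI_zero : ∀ w ∈ LI p x e τ t Z i n P0, w 0 ∈ P0 := by
  refine LI_ind (C := P0.comap (LinearMap.proj (R := F) (φ := fun _ : ℕ => P) 0).toAddMonoidHom) i P0 ?_
  intro r hr v hv
  show bI p x e τ t Z i n r v 0 ∈ P0
  obtain ⟨h1, h2, _⟩ := bI_comp (p := p) (x := x) (τ := τ) (t := t) (Z := Z) i hone r hr v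
  rcases eq_or_lt_of_le hr with rfl | hr
  · rw [Nat.sub_self] at h1; rwa [h1]
  · rw [h2 0 (by omega)]; exact zero_mem _

include hone hc in
theorem cyc_LI : ∀ w ∈ LI p x e τ t Z i n P0,
    cyc (fun k => dg (xf x t k)) (fun k j => dg (ef e i k j)) ℓ w ∈ LN p x e τ t Z i n P0 (ℓ i) := by
  intro w hw
  rw [cyc_W i ℓ hc]
  exact bN_mem i P0 (r := 0) (Nat.zero_le _) (LI_zero i hone P0 w hw)

include H X hx0 he0 ht0 hτ0 hv hone hc in
theorem LN_le_LI : LN p x e τ t Z i n P0 (ℓ i) ≤ LI p x e τ t Z i n P0 := by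
  refine LN_ind i P0 ?_
  intro r hr v hv'
  induction r with
  | zero =>
    have h1 := (bI_comp (p := p) (x := x) (τ := τ) (t := t) (Z := Z) i hone n le_rfl v).1
    have h2 := cyc_W (t := t) i ℓ hc (bI p x e τ t Z i n n v)
    rw [Nat.sub_self] at h1
    rw [h1] at h2
    show sg (F := F) 0 ((t ^ ℓ i) v) ∈ _
    rw [← h2]
    refine (LI_stab0 i H X P0 hx0 he0 hτ0 ht0).1 _ ?_ _ (bI_mem i P0 le_rfl hv')
    exact Subring.sum_mem _ fun j _ => mul_mem (e_mem_polyS _ _) (pow_mem (x_mem_polyS _) _)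
  | succ r ih =>
    rw [bN_succ]
    exact LI_T i H X hv P0 hx0 he0 hτ0 ht0 _ _ (ih (by omega))
end Lat
end

section
open Polynomial Module
set_option linter.unusedSectionVars false
set_option linter.unusedSimpArgs false
set_option linter.unusedVariables false

section D1
variable {k : Type} [Field k] {F W : Type} [Field F] [Algebra k[X] F] [AddCommGroup W] [Module F W]
  [Module k[X] W] [IsScalarTower k[X] F W] [Module k W] [IsScalarTower k k[X] W]
variable {J : Type} [Fintype J] [DecidableEq J]

/-- endomorphisms preserving two lattices -/
noncomputable def presS (M N : Submodule k[X] W) : Subring (Module.End F W) where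
  carrier := {f | (∀ y ∈ M, f y ∈ M) ∧ (∀ y ∈ N, f y ∈ N)}
  mul_mem' := fun {f g} hf hg => ⟨fun y hy => hf.1 _ (hg.1 y hy), fun y hy => hf.2 _ (hg.2 y hy)⟩
  one_mem' := ⟨fun y hy => hy, fun y hy => hy⟩
  add_mem' := fun {f g} hf hg => ⟨fun y hy => add_mem (hf.1 y hy) (hg.1 y hy), fun y hy => add_mem (hf.2 y hy) (hg.2 y hy)⟩
  zero_mem' := ⟨fun y hy => zero_mem _, fun y hy => zero_mem _⟩
  neg_mem' := fun {f} hf => ⟨fun y hy => neg_mem (hf.1 y hy), fun y hy => neg_mem (hf.2 y hy)⟩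

noncomputable def resM {M N : Submodule k[X] W} (s : presS (F := F) M N) : M →ₗ[k[X]] M :=
  ((s : Module.End F W).restrictScalars k[X]).restrict s.2.1

noncomputable def rhoR (M N : Submodule k[X] W) : presS (F := F) M N →+* Module.End k[X] (M ⧸ N.comap M.subtype) where
  toFun s := Submodule.mapQ _ _ (resM s) (fun y hy => s.2.2 _ hy)
  map_one' := by
    apply LinearMap.ext; intro q; obtain ⟨m, rfl⟩ := Submodule.Quotient.mk_surjective _ q; rfl
  map_zero' := by
    apply LinearMap.ext; intro q; obtain ⟨m, rfl⟩ := Submodule.Quotient.mk_surjective _ q; rfl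
  map_mul' f g := by
    apply LinearMap.ext; intro q; obtain ⟨m, rfl⟩ := Submodule.Quotient.mk_surjective _ q; rfl
  map_add' f g := by
    apply LinearMap.ext; intro q; obtain ⟨m, rfl⟩ := Submodule.Quotient.mk_surjective _ q; rfl

noncomputable def resk (Q : Type) [AddCommGroup Q] [Module k[X] Q] [Module k Q] [IsScalarTower k k[X] Q] :
    Module.End k[X] Q →+* Module.End k Q where
  toFun f := f.restrictScalars k
  map_one' := rfl
  map_zero' := rfl
  map_mul' f g := rfl
  map_add' f g := rfl

theorem exists_factor (φ ψ : (J → k[X]) →ₗ[k[X]] W) (h : LinearMap.range ψ ≤ LinearMap.range φ) :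
    ∃ A : Matrix J J k[X], ∀ c, φ (A.mulVec c) = ψ c := by
  have : ∀ j, ∃ c, φ c = ψ (Pi.single j 1) := fun j => h ⟨_, rfl⟩
  choose c hc using this
  refine ⟨Matrix.of fun i j => c j i, fun v => ?_⟩
  have : (Matrix.of fun i j => c j i).mulVec v = ∑ j, v j • c j := by
    funext i; simp [Matrix.mulVec, dotProduct, mul_comm]
  rw [this, map_sum]
  conv_rhs => rw [pi_eq_sum_univ v, map_sum]
  refine Finset.sum_congr rfl fun j _ => ?_
  rw [map_smul, map_smul, hc]
  congr 2
  funext i; simp [Pi.single_apply, eq_comm]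

theorem lattice_quot (φ ψ : (J → k[X]) →ₗ[k[X]] W) (A : Matrix J J k[X]) (hA : ∀ c, φ (A.mulVec c) = ψ c)
    (hφ : Function.Injective φ) (hdet : A.det ≠ 0) :
    ∃ (d : ℕ) (ρ : presS (F := F) (LinearMap.range φ) (LinearMap.range ψ) →+* Matrix (Fin d) (Fin d) k),
      (∀ s, (∀ c, s.1 (φ c) ∈ LinearMap.range ψ) → ρ s = 0) ∧
      (∀ s, ∀ E' : Matrix J J k[X], E' * E' = E' → (∀ c, s.1 (φ c) = φ (E'.mulVec c)) →
        (∀ c, s.1 (ψ c) = ψ (E'.mulVec c)) → (E' * A + (1 - E')).det ≠ 0 →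
          (ρ s).rank = (E' * A + (1 - E')).det.natDegree) := by
  classical
  set M := LinearMap.range φ
  set N := LinearMap.range ψ
  set Q := M ⧸ N.comap M.subtype
  have hrangeψ : ∀ c, φ c ∈ N ↔ c ∈ LinearMap.range A.mulVecLin := by
    intro c
    constructor
    · rintro ⟨c', hc'⟩
      exact ⟨c', hφ (by rw [Matrix.mulVecLin_apply, hA, hc'])⟩
    · rintro ⟨c', rfl⟩
      exact ⟨c', (hA c').symm⟩
  let π : (J → k[X]) →ₗ[k[X]] Q := (Submodule.mkQ _) ∘ₗ φ.rangeRestrict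
  have hπ : Function.Surjective π := (Submodule.mkQ_surjective _).comp φ.surjective_rangeRestrict
  have key : ∀ (f : Q →ₗ[k[X]] Q) (E' : Matrix J J k[X]), E' * E' = E' → E' * A = A * E' →
      (∀ c, f (π c) = π (E'.mulVec c)) → (E' * A + (1 - E')).det ≠ 0 →
      Module.Finite k (LinearMap.range f) ∧
        finrank k (LinearMap.range f) = (E' * A + (1 - E')).det.natDegree := by
    intro f E' hE hEA hf hd
    have hker : LinearMap.ker (f ∘ₗ π) = LinearMap.range (E' * A + (1 - E')).mulVecLin := by
      ext c
      rw [LinearMap.mem_ker, LinearMap.comp_apply, hf]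
      have : π (E'.mulVec c) = 0 ↔ φ (E'.mulVec c) ∈ N := by
        show Submodule.Quotient.mk _ = (0 : Q) ↔ _
        rw [Submodule.Quotient.mk_eq_zero]; rfl
      rw [this, hrangeψ]
      constructor
      · rintro ⟨c', hc'⟩
        rw [Matrix.mulVecLin_apply] at hc'
        refine ⟨E'.mulVec c' + (1 - E').mulVec c, ?_⟩
        rw [Matrix.mulVecLin_apply, Matrix.mulVec_add, Matrix.mulVec_mulVec, Matrix.mulVec_mulVec]
        have h1 : (E' * A + (1 - E')) * E' = E' * A := by
          rw [add_mul, sub_mul, one_mul, hE, sub_self, add_zero, mul_assoc, ← hEA, ← mul_assoc, hE]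
        have h2 : (E' * A + (1 - E')) * (1 - E') = 1 - E' := by
          rw [mul_sub, h1, mul_one]; abel
        rw [h1, h2, ← Matrix.mulVec_mulVec, hc', Matrix.mulVec_mulVec, hE, ← Matrix.add_mulVec]
        simp
      · rintro ⟨c', rfl⟩
        refine ⟨E'.mulVec c', ?_⟩
        rw [Matrix.mulVecLin_apply, Matrix.mulVecLin_apply, Matrix.mulVec_mulVec, Matrix.mulVec_mulVec]
        congr 1
        rw [mul_add, mul_sub, hE, mul_one, sub_self, add_zero, ← mul_assoc, hE, hEA]
    have hr : LinearMap.range (f ∘ₗ π) = LinearMap.range f :=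
      LinearMap.range_comp_of_range_eq_top _ (LinearMap.range_eq_top.2 hπ)
    obtain ⟨c1, c2⟩ := coker_aux (E' * A + (1 - E')) hd
    have eqv := ((Submodule.quotEquivOfEq _ _ hker.symm).trans
      ((f ∘ₗ π).quotKerEquivRange.trans (LinearEquiv.ofEq _ _ hr))).restrictScalars k
    exact ⟨Module.Finite.equiv eqv, eqv.finrank_eq.symm.trans c2⟩
  have hQ := (key LinearMap.id 1 (by simp) (by simp) (by simp) (by simpa using hdet)).1
  have hQ : Module.Finite k Q := by
    rw [LinearMap.range_id] at hQ
    exact Module.Finite.equiv ((Submodule.topEquiv (R := k[X]) (M := Q)).restrictScalars k)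
  let b := Module.finBasis k Q
  let ρ : presS (F := F) M N →+* Matrix (Fin (finrank k Q)) (Fin (finrank k Q)) k :=
    (LinearMap.toMatrixAlgEquiv b).toAlgHom.toRingHom.comp ((resk Q).comp (rhoR M N))
  refine ⟨finrank k Q, ρ, ?_, ?_⟩
  · intro s hs
    have : rhoR M N s = 0 := by
      apply LinearMap.ext; intro q
      obtain ⟨c, rfl⟩ := hπ q
      show Submodule.Quotient.mk _ = (0 : Q)
      rw [Submodule.Quotient.mk_eq_zero]
      exact hs c
    show LinearMap.toMatrixAlgEquiv b (resk Q (rhoR M N s)) = 0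
    rw [this, map_zero, map_zero]
  · intro s E' hE h1 h2 hd
    have hEA : E' * A = A * E' := by
      apply Matrix.toLin'.injective
      apply LinearMap.ext; intro c
      rw [Matrix.toLin'_apply, Matrix.toLin'_apply]
      apply hφ
      rw [← Matrix.mulVec_mulVec, ← Matrix.mulVec_mulVec, ← h1, hA, hA, h2]
    have h3 := (key (rhoR M N s) E' hE hEA ?_ hd).2
    · rw [← h3]
      show (LinearMap.toMatrixAlgEquiv b (resk Q (rhoR M N s))).rank = _
      rw [Matrix.rank_eq_finrank_range_toLin _ b b]
      have : Matrix.toLin b b (LinearMap.toMatrixAlgEquiv b (resk Q (rhoR M N s))) = resk Q (rhoR M N s) :=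
        Matrix.toLin_toMatrix b b _
      rw [this]; rfl
    · intro c
      show Submodule.Quotient.mk _ = Submodule.Quotient.mk _
      congr 1
      exact Subtype.ext (h1 c)
end D1
end

section
open Polynomial Module
set_option linter.unusedSectionVars false
set_option linter.unusedSimpArgs false
set_option linter.unusedVariables false

theorem rneg1 {A : Type*} [Ring A] (a b : A) : 0 - a * b = a * -b := by simp
theorem rneg2 {A : Type*} [Ring A] (b : A) : -b = -1 * b := by simp

section D2
variable {k : Type} [Field k] [CharZero k] {d : ℕ}

def HD (g : RatFunc k) (m : ℤ) : Prop := g ≠ 0 ∧ g.intDegree = m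

theorem HD.mul {g h : RatFunc k} {m l : ℤ} (hg : HD g m) (hh : HD h l) : HD (g * h) (m + l) :=
  ⟨mul_ne_zero hg.1 hh.1, by rw [RatFunc.intDegree_mul hg.1 hh.1, hg.2, hh.2]⟩
theorem HD.one : HD (1 : RatFunc k) 0 := ⟨one_ne_zero, by simp⟩
theorem HD.prod {ι : Type*} (s : Finset ι) (g : ι → RatFunc k) (m : ι → ℤ) (h : ∀ a ∈ s, HD (g a) (m a)) :
    HD (∏ a ∈ s, g a) (∑ a ∈ s, m a) := by
  classical
  induction s using Finset.induction_on with
  | empty => simpa using HD.one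
  | insert a s ha ih =>
    rw [Finset.prod_insert ha, Finset.sum_insert ha]
    exact (h a (by simp)).mul (ih fun b hb => h b (by simp [hb]))
theorem HD.of_mul {g h : RatFunc k} {m : ℤ} (hg : HD g m) (hh : h * g = 1) : HD h (-m) := by
  have h0 : h ≠ 0 := left_ne_zero_of_mul_eq_one hh
  refine ⟨h0, ?_⟩
  have := RatFunc.intDegree_mul h0 hg.1
  rw [hh, RatFunc.intDegree_one, hg.2] at this
  omega

noncomputable def io (k : Type) [Field k] (d : ℕ) : Matrix (Fin d) (Fin d) k →+* Module.End (RatFunc k) (Fin d → RatFunc k) :=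
  (Matrix.toLinAlgEquiv' (R := RatFunc k) (n := Fin d)).toAlgHom.toRingHom.comp (algebraMap k (RatFunc k)).mapMatrix

noncomputable def tX (k : Type) [Field k] (d : ℕ) : Module.End (RatFunc k) (Fin d → RatFunc k) :=
  algebraMap (RatFunc k) _ (RatFunc.X : RatFunc k)

noncomputable def dE (E g : Module.End (RatFunc k) (Fin d → RatFunc k)) : RatFunc k :=
  LinearMap.det (E * g + (1 - E))

theorem dE_mul (E g h : Module.End (RatFunc k) (Fin d → RatFunc k)) (hE : E * E = E) (hg : Commute E g) :
    dE E (g * h) = dE E g * dE E h := by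
  rw [dE, dE, dE, ← map_mul]
  congr 1
  have h0 := hg.eq
  have h1 : E * g * (1 - E) = 0 := by rw [h0, mul_assoc, mul_sub, hE, mul_one, sub_self, mul_zero]
  have h2 : (1 - E) * (E * h) = 0 := by rw [← mul_assoc, sub_mul, hE, one_mul, sub_self, zero_mul]
  have h3 : (1 - E) * (1 - E) = 1 - E := by rw [mul_sub, mul_one, sub_mul, hE]; simp
  have h4 : E * g * (E * h) = E * (g * h) := by
    rw [h0, mul_assoc, ← mul_assoc E E, hE, ← mul_assoc, ← h0, mul_assoc]
  rw [add_mul, mul_add, mul_add, h1, h2, h3, h4]; simp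

theorem dE_one (E : Module.End (RatFunc k) (Fin d → RatFunc k)) : dE E 1 = 1 := by
  rw [dE, mul_one, add_sub_cancel, map_one]

theorem dE_congr {E g h : Module.End (RatFunc k) (Fin d → RatFunc k)} (H : E * g = E * h) : dE E g = dE E h := by
  rw [dE, dE, H]

theorem dE_pow (E g : Module.End (RatFunc k) (Fin d → RatFunc k)) (hE : E * E = E) (hg : Commute E g) (m : ℕ) :
    dE E (g ^ m) = dE E g ^ m := by
  induction m with
  | zero => simp [dE_one]
  | succ m ih => rw [pow_succ, dE_mul _ _ _ hE (hg.pow_right m), ih, pow_succ]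

/-- polynomial matrices to endomorphisms -/
noncomputable def ioX (k : Type) [Field k] (d : ℕ) : Matrix (Fin d) (Fin d) k[X] →+* Module.End (RatFunc k) (Fin d → RatFunc k) :=
  (Matrix.toLinAlgEquiv' (R := RatFunc k) (n := Fin d)).toAlgHom.toRingHom.comp (algebraMap k[X] (RatFunc k)).mapMatrix

theorem ioX_C (M : Matrix (Fin d) (Fin d) k) : ioX k d (M.map C) = io k d M := by
  have : (algebraMap k[X] (RatFunc k)).mapMatrix (M.map C) = (algebraMap k (RatFunc k)).mapMatrix M := by
    ext a b; simp [RatFunc.algebraMap_eq_C]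
  show Matrix.toLinAlgEquiv' ((algebraMap k[X] (RatFunc k)).mapMatrix (M.map C)) = _
  rw [this]; rfl

theorem ioX_X : ioX k d ((X : k[X]) • (1 : Matrix (Fin d) (Fin d) k[X])) = tX k d := by
  apply LinearMap.ext; intro v
  show Matrix.toLin' ((algebraMap k[X] (RatFunc k)).mapMatrix ((X : k[X]) • (1 : Matrix (Fin d) (Fin d) k[X]))) v = _
  have : (algebraMap k[X] (RatFunc k)).mapMatrix ((X : k[X]) • (1 : Matrix (Fin d) (Fin d) k[X])) = (RatFunc.X : RatFunc k) • (1 : Matrix (Fin d) (Fin d) (RatFunc k)) := by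
    ext a b
    by_cases h : a = b
    · subst h; simp
    · simp [h]
  rw [this]
  simp [tX, Matrix.toLin'_apply, Matrix.smul_mulVec]

theorem ioX_det (M : Matrix (Fin d) (Fin d) k[X]) : LinearMap.det (ioX k d M) = algebraMap k[X] (RatFunc k) M.det := by
  show LinearMap.det (Matrix.toLin' ((algebraMap k[X] (RatFunc k)).mapMatrix M)) = _
  rw [LinearMap.det_toLin', RingHom.map_det]

theorem HD_poly {q : k[X]} (h : q.Monic) : HD (algebraMap k[X] (RatFunc k) q) q.natDegree :=
  ⟨by simpa using h.ne_zero, by simp⟩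

theorem tX_comm (g : Module.End (RatFunc k) (Fin d → RatFunc k)) : Commute (tX k d) g := Algebra.commutes _ _

theorem HD_pow_add (E y : Matrix (Fin d) (Fin d) k) (hE : E * E = E) (hy : E * y = y * E) {p : ℕ} (hp : 0 < p) :
    HD (dE (io k d E) (tX k d ^ p + io k d y)) (p * E.rank) := by
  obtain ⟨q, q1, q2, q3⟩ := deg_aux E y hE hy
  have hdet : (E.map C * (((X : k[X]) ^ p) • (1 : Matrix (Fin d) (Fin d) k[X]) + y.map C) + (1 - E.map C)).det =
      expand k p q := by
    rw [← q3, AlgHom.map_det]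
    congr 1
    have hC : ∀ M : Matrix (Fin d) (Fin d) k, (expand k p).mapMatrix (M.map C) = M.map C := by
      intro M; ext a b : 2; simp
    rw [map_add, map_mul, map_add, map_sub, map_one, hC, hC]
    congr 3
    ext a b : 2
    by_cases h : a = b
    · subst h; simp
    · simp [h]
  have h1 := ioX_det (E.map C * (((X : k[X]) ^ p) • (1 : Matrix (Fin d) (Fin d) k[X]) + y.map C) + (1 - E.map C))
  rw [hdet] at h1
  have h2 := HD_poly (q1.expand hp)
  rw [← h1] at h2
  have h3 : ((X : k[X]) ^ p) • (1 : Matrix (Fin d) (Fin d) k[X]) = ((X : k[X]) • (1 : Matrix (Fin d) (Fin d) k[X])) ^ p := by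
    rw [_root_.smul_pow, one_pow]
  rw [h3, map_add (ioX k d), map_mul (ioX k d), map_add (ioX k d), map_sub (ioX k d), map_one (ioX k d), ioX_C, ioX_C, map_pow, ioX_X, natDegree_expand, q2] at h2
  rw [dE]
  convert h2 using 1
  push_cast; ring

theorem HD_t (E : Matrix (Fin d) (Fin d) k) (hE : E * E = E) (p : ℕ) :
    HD (dE (io k d E) (tX k d ^ p)) (p * E.rank) := by
  rcases Nat.eq_zero_or_pos p with rfl | hp
  · simpa [dE_one] using HD.one
  · simpa using HD_pow_add E 0 hE (by simp) hp

theorem ioE (E : Matrix (Fin d) (Fin d) k) (hE : E * E = E) : io k d E * io k d E = io k d E := by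
  rw [← map_mul, hE]

theorem dE_k (E g : Matrix (Fin d) (Fin d) k) : dE (io k d E) (io k d g) = algebraMap k (RatFunc k) (E * g + (1 - E)).det := by
  rw [dE, ← map_mul, ← map_one (io k d), ← map_sub, ← map_add]
  show LinearMap.det (Matrix.toLin' ((algebraMap k (RatFunc k)).mapMatrix _)) = _
  rw [LinearMap.det_toLin', RingHom.map_det]

theorem HD_const (E : Matrix (Fin d) (Fin d) k) (hE : E * E = E) (c : k) (hc : c ≠ 0) :
    HD (dE (io k d E) (io k d (c • 1))) 0 := by
  have h : dE (io k d E) (io k d (c • 1)) * dE (io k d E) (io k d (c⁻¹ • 1)) = 1 := by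
    rw [← dE_mul _ _ _ (ioE E hE), ← map_mul]
    · simp [hc, dE_one]
    · show _ * _ = _ * _
      rw [← map_mul, ← map_mul]; simp
  refine ⟨left_ne_zero_of_mul_eq_one h, ?_⟩
  rw [dE_k, RatFunc.algebraMap_eq_C, RatFunc.intDegree_C]

variable {I : Type*} [Fintype I] [DecidableEq I] {p : I → I → ℕ}
    {x : ℕ → Matrix (Fin d) (Fin d) k} {e : ℕ → I → Matrix (Fin d) (Fin d) k}
    {Z : ℕ → Module.End (RatFunc k) (Fin d → RatFunc k)}

theorem HD_U (hp : ∀ i j, p i j = 0 ↔ p j i = 0) (X : KExt (fun b => io k d (x b)) (tX k d) Z) (E : Matrix (Fin d) (Fin d) k)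
    (hE : E * E = E) (b : ℕ) (hx : E * x b = x b * E) (i j : I) (hEe : ∀ j', E * e b j' = if j' = j then E else 0)
    (he : ∀ j', Commute (e b j') (x b)) :
    HD (dE (io k d E) (UU p (fun b => io k d (x b)) (fun b j => io k d (e b j)) (tX k d) Z i b))
      ((if j = i then -2 else (p i j : ℤ)) * E.rank) ∧
     io k d E * UU p (fun b => io k d (x b)) (fun b j => io k d (e b j)) (tX k d) Z i b =
      io k d E * (if j = i then - (Z b * Z b) else (tX k d ^ p i j + io k d (x b) ^ p j i)) := by
  have hq : io k d E * qt p (fun b => io k d (x b)) (fun b j => io k d (e b j)) (tX k d) i b =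
      if j = i then 0 else io k d E * (tX k d ^ p i j + io k d (x b) ^ p j i) := by
    rw [qt, Finset.mul_sum]
    rw [Finset.sum_eq_single j]
    · split_ifs with h
      · simp
      · rw [← mul_assoc, ← map_mul, hEe, if_pos rfl]
    · intro j' _ h
      split_ifs
      · simp
      · rw [← mul_assoc, ← map_mul, hEe, if_neg h, map_zero, zero_mul]
    · simp
  have hZe : Commute (Z b) (io k d (e b i)) := X.zc (by
    show _ * _ = _ * _
    rw [← map_mul, ← map_mul, (he i).eq])
  have hZE : Commute (Z b) (io k d E) := X.zc (by
    show _ * _ = _ * _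
    rw [← map_mul, ← map_mul, hx])
  have hg : io k d E * gg (fun b j => io k d (e b j)) Z i b ^ 2 = if j = i then io k d E * (Z b * Z b) else 0 := by
    rw [gg, sq, ← mul_assoc, ← mul_assoc, ← mul_assoc, ← map_mul, hEe]
    split_ifs with h h' h'
    · rw [← hZE.eq, mul_assoc (Z b), ← map_mul, hEe, if_pos h, hZE.eq, mul_assoc]
    · exact absurd h.symm h'
    · exact absurd h'.symm h
    · simp
  have hU : io k d E * UU p (fun b => io k d (x b)) (fun b j => io k d (e b j)) (tX k d) Z i b =
      io k d E * (if j = i then - (Z b * Z b) else (tX k d ^ p i j + io k d (x b) ^ p j i)) := by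
    rw [UU, mul_sub, hq, hg]
    split_ifs
    · exact rneg1 (A := Module.End (RatFunc k) (Fin d → RatFunc k)) _ _
    · rw [sub_zero]
  refine ⟨?_, hU⟩
  rw [dE_congr hU]
  split_ifs with h
  · have hm1 : io k d ((-1 : k) • 1) = -1 := by rw [neg_one_smul, map_neg, map_one]
    have e1 : -(Z b * Z b) = io k d ((-1 : k) • 1) * (Z b * Z b) := by rw [hm1]; exact rneg2 (A := Module.End (RatFunc k) (Fin d → RatFunc k)) _
    rw [e1, dE_mul _ _ _ (ioE E hE) (by rw [hm1]; exact Commute.neg_right (R := Module.End (RatFunc k) (Fin d → RatFunc k)) (Commute.one_right _)), dE_mul _ _ _ (ioE E hE) hZE.symm]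
    have h1 := HD_const E hE (-1) (by simp)
    have h2 : HD (dE (io k d E) (Z b)) (-E.rank) := by
      have h3 := HD_pow_add E (- x b) hE (by simp [hx]) (p := 1) one_pos
      refine HD.of_mul (by simpa using h3) ?_
      rw [← dE_mul _ _ _ (ioE E hE) hZE.symm, ← sub_eq_add_neg, X.z2, dE_one]
    convert h1.mul (h2.mul h2) using 1
    ring
  · rcases Nat.eq_zero_or_pos (p i j) with h0 | h0
    · rw [h0, (hp i j).1 h0, pow_zero, pow_zero]
      have h1 := HD_const E hE 2 (by simp)
      have : io k d ((2 : k) • 1) = 1 + 1 := by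
        rw [← map_one (io k d), ← map_add]; congr 1; rw [two_smul]
      rw [this] at h1
      simpa using h1
    · rw [← map_pow]
      exact HD_pow_add E _ hE (by rw [(show Commute E (x b) from hx).pow_right]) h0
end D2
end

section
open Polynomial Module
set_option linter.unusedSectionVars false
set_option linter.unusedSimpArgs false
set_option linter.unusedVariables false

section D3
variable {k : Type} [Field k] [CharZero k] {d : ℕ}
variable {I : Type*} [Fintype I] [DecidableEq I] {p : I → I → ℕ}
    {x : ℕ → Matrix (Fin d) (Fin d) k} {e : ℕ → I → Matrix (Fin d) (Fin d) k} {τ : ℕ → Matrix (Fin d) (Fin d) k}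
    {Z : ℕ → Module.End (RatFunc k) (Fin d → RatFunc k)}

theorem unit_of_det {g : Module.End (RatFunc k) (Fin d → RatFunc k)} (h : LinearMap.det g ≠ 0) : IsUnit g :=
  LinearMap.isUnit_iff_isUnit_det g |>.2 (isUnit_iff_ne_zero.2 h)

theorem dE_id (g : Module.End (RatFunc k) (Fin d → RatFunc k)) : dE (io k d 1) g = LinearMap.det g := by
  rw [dE, map_one, one_mul, sub_self, add_zero]

theorem exists_Z (x : ℕ → Matrix (Fin d) (Fin d) k) : ∃ Z, KExt (fun b => io k d (x b)) (tX k d) Z := by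
  have : ∀ b, IsUnit (tX k d - io k d (x b)) := by
    intro b
    apply unit_of_det
    have h := (HD_pow_add (1 : Matrix (Fin d) (Fin d) k) (-x b) (by simp) (by simp) one_pos).1
    rwa [dE_id, pow_one, map_neg, ← sub_eq_add_neg] at h
  choose Z hZ using this
  refine ⟨fun b => ((Z b)⁻¹ : (Module.End (RatFunc k) (Fin d → RatFunc k))ˣ), tX_comm, ?_, ?_⟩
  · intro b; rw [← hZ]; exact (Z b).mul_inv
  · intro b; rw [← hZ]; exact (Z b).inv_mul

theorem comm_U (X : KExt (fun b => io k d (x b)) (tX k d) Z) (E : Matrix (Fin d) (Fin d) k)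
    (hx : ∀ b, E * x b = x b * E) (he : ∀ b j, E * e b j = e b j * E) (i : I) (b : ℕ) :
    Commute (io k d E) (UU p (fun b => io k d (x b)) (fun b j => io k d (e b j)) (tX k d) Z i b) := by
  have hx' : ∀ b, Commute (io k d E) (io k d (x b)) := fun b => by
    show _ * _ = _ * _
    rw [← map_mul, ← map_mul, hx]
  have he' : ∀ b j, Commute (io k d E) (io k d (e b j)) := fun b j => by
    show _ * _ = _ * _
    rw [← map_mul, ← map_mul, he]
  have hZ : Commute (io k d E) (Z b) := (X.zc (hx' b).symm).symm
  have ht : Commute (io k d E) (tX k d) := (tX_comm _).symm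
  rw [UU]
  refine Commute.sub_right ?_ ?_
  · rw [qt]
    refine Commute.sum_right _ _ _ fun j _ => ?_
    split_ifs
    · exact Commute.zero_right _
    · exact (he' b j).mul_right ((ht.pow_right _).add_right ((hx' b).pow_right _))
  · rw [gg]
    exact ((he' b i).mul_right hZ).pow_right _

theorem HD_DN (hp : ∀ i j, p i j = 0 ↔ p j i = 0) (H : KRel p x e τ) (X : KExt (fun b => io k d (x b)) (tX k d) Z)
    (E : Matrix (Fin d) (Fin d) k) (hE : E * E = E)
    (hx : ∀ b, E * x b = x b * E) (he : ∀ b j, E * e b j = e b j * E) (i : I) (w : ℕ → I) (ℓ a : ℕ)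
    (hEe : ∀ b < a, ∀ j', E * e b j' = if j' = w b then E else 0) :
    HD (dE (io k d E) (DN p (fun b => io k d (x b)) (fun b j => io k d (e b j)) (tX k d) Z i ℓ a))
      ((ℓ + ∑ b ∈ Finset.range a, (if w b = i then -2 else (p i (w b) : ℤ))) * E.rank) := by
  induction a with
  | zero => simpa [DN] using HD_t E hE ℓ
  | succ a ih =>
    rw [DN, dE_mul _ _ _ (ioE E hE) (comm_U X E hx he i a)]
    have h1 := (HD_U hp X E hE a (hx a) i (w a) (hEe a (by omega)) (fun j' => (H.xe a a j').symm)).1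
    convert h1.mul (ih fun b hb => hEe b (by omega)) using 1
    rw [Finset.sum_range_succ]; ring

variable {n : ℕ}
theorem det_U (hp : ∀ i j, p i j = 0 ↔ p j i = 0) (H : KRel p x e τ) (X : KExt (fun b => io k d (x b)) (tX k d) Z)
    (i : I) (b : ℕ) (hone : ∑ j, e b j = 1) :
    LinearMap.det (UU p (fun b => io k d (x b)) (fun b j => io k d (e b j)) (tX k d) Z i b) ≠ 0 := by
  set U := UU p (fun b => io k d (x b)) (fun b j => io k d (e b j)) (tX k d) Z i b with hU
  have hinj : Function.Injective U := by
    rw [injective_iff_map_eq_zero]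
    intro v hv
    have hv' : v = ∑ j, io k d (e b j) v := by
      have := congrArg (fun M => io k d M v) hone
      simp only [map_sum, map_one] at this
      rw [LinearMap.sum_apply] at this
      exact this.symm
    rw [hv']
    refine Finset.sum_eq_zero fun j _ => ?_
    have h1 := (HD_U hp X (e b j) (H.eid b j) b (H.xe b b j).symm i j (fun j' => by
      split_ifs with h
      · rw [h, H.eid]
      · exact H.eorth _ _ _ (Ne.symm h)) (fun j' => (H.xe b b j').symm)).1.1
    have hc := comm_U X (e b j) (fun b' => (H.xe b' b j).symm) (fun b' j' => H.ee _ _ _ _) (e := e) (p := p) i b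
    rw [dE] at h1
    have hu := unit_of_det h1
    have hker := ((LinearMap.isUnit_iff_ker_eq_bot _).1 hu)
    have : io k d (e b j) v ∈ LinearMap.ker (io k d (e b j) * U + (1 - io k d (e b j))) := by
      rw [LinearMap.mem_ker, LinearMap.add_apply, Module.End.mul_apply, ← Module.End.mul_apply U, ← hc.eq,
        Module.End.mul_apply, hv, map_zero, map_zero, zero_add, ← Module.End.mul_apply, sub_mul, one_mul,
        ioE _ (H.eid b j), sub_self]; rfl
    rw [hker] at this
    exact this
  have : IsUnit U := (LinearMap.isUnit_iff_ker_eq_bot U).2 (LinearMap.ker_eq_bot.2 hinj)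
  exact ((LinearMap.isUnit_iff_isUnit_det U).1 this).ne_zero

theorem det_DN (hp : ∀ i j, p i j = 0 ↔ p j i = 0) (H : KRel p x e τ) (X : KExt (fun b => io k d (x b)) (tX k d) Z)
    (i : I) (hone : ∀ b < n, ∑ j, e b j = 1) (ℓ a : ℕ) (ha : a ≤ n) :
    LinearMap.det (DN p (fun b => io k d (x b)) (fun b j => io k d (e b j)) (tX k d) Z i ℓ a) ≠ 0 := by
  induction a with
  | zero =>
    have h := (HD_t (1 : Matrix (Fin d) (Fin d) k) (by simp) ℓ).1
    rwa [dE_id] at h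
  | succ a ih =>
    rw [DN, map_mul]
    exact mul_ne_zero (det_U hp H X i a (hone a (by omega))) (ih (by omega))

variable (e n) in
def EaM (i : I) (μ : ℕ → I) (a : ℕ) : Matrix (Fin d) (Fin d) k := if μ a = i then EN e n (rem μ a) else 0

theorem EaM_io (i : I) (μ : ℕ → I) (a : ℕ) : Ea (fun b j => io k d (e b j)) i n μ a = io k d (EaM e n i μ a) := by
  rw [Ea, EaM]
  split_ifs
  · rw [map_EN]
  · rw [map_zero]

theorem EaM_idem (H : KRel p x e τ) (i : I) (μ : ℕ → I) (a : ℕ) : EaM e n i μ a * EaM e n i μ a = EaM e n i μ a := by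
  rw [EaM]; split_ifs
  · exact EN_idem H _ _
  · simp

theorem HD_Ea (hp : ∀ i j, p i j = 0 ↔ p j i = 0) (H : KRel p x e τ) (X : KExt (fun b => io k d (x b)) (tX k d) Z)
    (i : I) (ℓ : ℕ) (μ : ℕ → I) (a : ℕ) (ha : a ≤ n) :
    HD (dE (io k d (EaM e n i μ a)) (DN p (fun b => io k d (x b)) (fun b j => io k d (e b j)) (tX k d) Z i ℓ a))
      (if μ a = i then (ℓ + ∑ b ∈ Finset.range a, (if μ b = i then -2 else (p i (μ b) : ℤ))) * (EN e n (rem μ a)).rank else 0) := by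
  rw [EaM]
  split_ifs with h
  · have := HD_DN hp H X (EN e n (rem μ a)) (EN_idem H _ _) (EN_x H _ _) (EN_e H _ _) i (rem μ a) ℓ a
      (fun b hb j' => EN_absorb H n _ b j' (by omega))
    have h2 : ∑ b ∈ Finset.range a, (if μ b = i then -2 else (p i (μ b) : ℤ)) =
        ∑ b ∈ Finset.range a, (if rem μ a b = i then -2 else (p i (rem μ a b) : ℤ)) :=
      Finset.sum_congr rfl fun b hb => by simp [rem, Finset.mem_range.1 hb]
    rw [h2]; exact this
  · rw [dE, map_zero, zero_mul, sub_zero, zero_add, map_one]; exact HD.one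
end D3
end

section
open Polynomial Module
set_option linter.unusedSectionVars false
set_option linter.unusedSimpArgs false
set_option linter.unusedVariables false

section Mat
variable {F : Type} [Field F] {d : ℕ} (n : ℕ)

def matb (b : ℕ → ((Fin d → F) →ₗ[F] (ℕ → Fin d → F))) : Matrix (Fin (n + 1) × Fin d) (Fin (n + 1) × Fin d) F :=
  Matrix.of fun q r => b r.1 (Pi.single r.2 1) q.1 q.2

variable {n}
theorem vec_sum (v : Fin d → F) : v = ∑ s, v s • (Pi.single s (1 : F) : Fin d → F) := by
  rw [← Finset.univ_sum_single v]
  simp [← Pi.single_smul']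

theorem matb_mulVec (b : ℕ → ((Fin d → F) →ₗ[F] (ℕ → Fin d → F))) (c : Fin (n + 1) × Fin d → F)
    (q : Fin (n + 1) × Fin d) :
    (matb n b).mulVec c q = ∑ r : Fin (n + 1), b r (fun s => c (r, s)) q.1 q.2 := by
  simp only [Matrix.mulVec, dotProduct, Fintype.sum_prod_type, matb, Matrix.of_apply]
  refine Finset.sum_congr rfl fun r _ => ?_
  conv_rhs => rw [vec_sum (fun s => c (r, s))]
  simp [map_sum, Finset.sum_apply, mul_comm]

theorem matb_add (b b' : ℕ → ((Fin d → F) →ₗ[F] (ℕ → Fin d → F))) : matb n b + matb n b' = matb n (fun r => b r + b' r) := rfl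
theorem matb_sub (b b' : ℕ → ((Fin d → F) →ₗ[F] (ℕ → Fin d → F))) : matb n b - matb n b' = matb n (fun r => b r - b' r) := rfl

def blk (n : ℕ) (g : ℕ → Module.End F (Fin d → F)) : Matrix (Fin (n + 1) × Fin d) (Fin (n + 1) × Fin d) F :=
  matb n (fun r => sg r ∘ₗ g r)

theorem sg_apply (a b : ℕ) (v : Fin d → F) : sg (F := F) a v b = if b = a then v else 0 := by
  split_ifs with h
  · subst h; exact sg_same _ _
  · exact sg_ne h v

theorem blk_one : blk (d := d) (F := F) n 1 = 1 := by
  ext ⟨a, s⟩ ⟨b, s'⟩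
  simp only [blk, matb, Matrix.of_apply, LinearMap.comp_apply, sg_apply, Pi.one_apply, Module.End.one_apply]
  rw [Matrix.one_apply]
  by_cases h : a = b
  · subst h; simp [Pi.single_apply]
  · have : (a : ℕ) ≠ b := fun h' => h (Fin.ext h')
    simp [this, h]

theorem mat_ext {M N : Matrix (Fin (n + 1) × Fin d) (Fin (n + 1) × Fin d) F} (h : ∀ c, M.mulVec c = N.mulVec c) : M = N := by
  apply Matrix.toLin'.injective
  apply LinearMap.ext; intro c
  rw [Matrix.toLin'_apply, Matrix.toLin'_apply, h]

theorem blk_mulVec (g : ℕ → Module.End F (Fin d → F)) (c : Fin (n + 1) × Fin d → F)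
    (q : Fin (n + 1) × Fin d) : (blk n g).mulVec c q = g q.1 (fun s => c (q.1, s)) q.2 := by
  rw [blk, matb_mulVec, Finset.sum_eq_single q.1]
  · rw [LinearMap.comp_apply, sg_same]
  · intro r _ hr
    rw [LinearMap.comp_apply, sg_ne (fun h => hr (Fin.ext h.symm))]; rfl
  · simp

theorem matb_mul_blk (b : ℕ → ((Fin d → F) →ₗ[F] (ℕ → Fin d → F))) (g : ℕ → Module.End F (Fin d → F)) :
    matb n b * blk n g = matb n (fun r => b r ∘ₗ g r) := by
  apply mat_ext; intro c; funext q
  rw [← Matrix.mulVec_mulVec, matb_mulVec, matb_mulVec]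
  refine Finset.sum_congr rfl fun r _ => ?_
  simp only [blk_mulVec]; rfl

theorem blk_mul_matb (b : ℕ → ((Fin d → F) →ₗ[F] (ℕ → Fin d → F))) (g : ℕ → Module.End F (Fin d → F)) :
    blk n g * matb n b = matb n (fun r => dg g ∘ₗ b r) := by
  apply mat_ext; intro c; funext q
  rw [← Matrix.mulVec_mulVec, blk_mulVec, matb_mulVec]
  simp only [matb_mulVec]
  have : (fun s => ∑ r : Fin (n + 1), b r (fun s => c (r, s)) q.1 s) = ∑ r : Fin (n + 1), b r (fun s => c (r, s)) q.1 := by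
    funext s; simp
  rw [this, map_sum, Finset.sum_apply]
  refine Finset.sum_congr rfl fun r _ => ?_
  rw [LinearMap.comp_apply, dg_apply]

theorem det_matb (b : ℕ → ((Fin d → F) →ₗ[F] (ℕ → Fin d → F))) (D : ℕ → Module.End F (Fin d → F))
    (hD : ∀ a ≤ n, ∀ v, b a v a = D a v)
    (h : (∀ r ≤ n, ∀ v, ∀ a < r, b r v a = 0) ∨ (∀ r ≤ n, ∀ v, ∀ a > r, b r v a = 0)) :
    (matb n b).det = ∏ a ∈ Finset.range (n + 1), LinearMap.det (D a) := by
  have main : ∀ {α : Type} [Fintype α] [LinearOrder α] (f : Fin (n + 1) ≃ α),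
      (matb n b).BlockTriangular (fun q => f q.1) → (matb n b).det = ∏ a : Fin (n + 1), LinearMap.det (D a) := by
    intro α _ _ f hf
    rw [hf.det_fintype, ← f.prod_comp]
    refine Finset.prod_congr rfl fun a _ => ?_
    rw [← LinearMap.det_toMatrix']
    let g : {q : Fin (n + 1) × Fin d // f q.1 = f a} ≃ Fin d :=
      { toFun := fun q => q.1.2
        invFun := fun s => ⟨(a, s), rfl⟩
        left_inv := by
          rintro ⟨⟨a', s⟩, hq⟩
          have : a' = a := f.injective hq
          subst this; rfl
        right_inv := fun s => rfl }
    rw [← Matrix.det_reindex_self g]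
    congr 1
    ext s s'
    rw [LinearMap.toMatrix'_apply]
    show b a (Pi.single s' 1) a s = _
    rw [hD a (by omega)]
  rw [Finset.prod_range]
  rcases h with h | h
  · refine main (OrderDual.toDual) ?_
    intro q r hqr
    have : q.1 < r.1 := hqr
    show b r.1 _ q.1 q.2 = 0
    rw [h r.1 (by omega) _ _ this]; rfl
  · refine main (Equiv.refl _) ?_
    intro q r hqr
    have : r.1 < q.1 := hqr
    show b r.1 _ q.1 q.2 = 0
    rw [h r.1 (by omega) _ _ this]; rfl
end Mat

section Lat2
variable {k : Type} [Field k] {d : ℕ} (n : ℕ)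

noncomputable def toF (k : Type) [Field k] (d : ℕ) : (Fin d → k[X]) →ₗ[k[X]] (Fin d → RatFunc k) where
  toFun c s := algebraMap k[X] (RatFunc k) (c s)
  map_add' c c' := by funext s; simp
  map_smul' r c := by funext s; simp [Algebra.smul_def]

noncomputable def lat (b : ℕ → ((Fin d → RatFunc k) →ₗ[RatFunc k] (ℕ → Fin d → RatFunc k))) :
    (Fin (n + 1) × Fin d → k[X]) →ₗ[k[X]] (ℕ → Fin d → RatFunc k) where
  toFun c := ∑ r : Fin (n + 1), b r (toF k d (fun s => c (r, s)))
  map_add' c c' := by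
    rw [← Finset.sum_add_distrib]
    refine Finset.sum_congr rfl fun r _ => ?_
    rw [← map_add, ← map_add]; rfl
  map_smul' t c := by
    rw [RingHom.id_apply, Finset.smul_sum]
    refine Finset.sum_congr rfl fun r _ => ?_
    rw [← LinearMap.map_smul_of_tower, ← map_smul]; rfl

variable {n}
theorem lat_apply (b : ℕ → ((Fin d → RatFunc k) →ₗ[RatFunc k] (ℕ → Fin d → RatFunc k))) (c : Fin (n + 1) × Fin d → k[X])
    (q : Fin (n + 1) × Fin d) : lat n b c q.1 q.2 = (matb n b).mulVec (fun r => algebraMap k[X] (RatFunc k) (c r)) q := by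
  rw [matb_mulVec]
  show (∑ r : Fin (n + 1), b r (toF k d (fun s => c (r, s)))) q.1 q.2 = _
  rw [Finset.sum_apply, Finset.sum_apply]; rfl

theorem lat_inj (b : ℕ → ((Fin d → RatFunc k) →ₗ[RatFunc k] (ℕ → Fin d → RatFunc k))) (h : (matb n b).det ≠ 0) :
    Function.Injective (lat n b) := by
  rw [injective_iff_map_eq_zero]
  intro c hc
  have : (matb n b).mulVec (fun r => algebraMap k[X] (RatFunc k) (c r)) = 0 := by
    funext q; rw [← lat_apply, hc]; rfl
  have := Matrix.eq_zero_of_mulVec_eq_zero h this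
  funext q
  simpa using congrFun this q

theorem lat_mat (b b' : ℕ → ((Fin d → RatFunc k) →ₗ[RatFunc k] (ℕ → Fin d → RatFunc k)))
    (A : Matrix (Fin (n + 1) × Fin d) (Fin (n + 1) × Fin d) k[X]) (hA : ∀ c, lat n b (A.mulVec c) = lat n b' c) :
    matb n b * A.map (algebraMap k[X] (RatFunc k)) = matb n b' := by
  have h1 : ∀ c, (fun r => algebraMap k[X] (RatFunc k) (A.mulVec c r)) =
      (A.map (algebraMap k[X] (RatFunc k))).mulVec (fun r => algebraMap k[X] (RatFunc k) (c r)) := by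
    intro c; funext r; exact RingHom.map_mulVec _ _ _ _
  ext q r
  have h2 := lat_apply b (A.mulVec (Pi.single r 1)) q
  rw [h1, hA, lat_apply, Matrix.mulVec_mulVec] at h2
  have h3 : (fun s => algebraMap k[X] (RatFunc k) ((Pi.single r 1 : Fin (n + 1) × Fin d → k[X]) s)) = Pi.single r 1 := by
    funext s; by_cases h : s = r
    · subst h; simp
    · simp [h]
  rw [h3, Matrix.mulVec_single_one, Matrix.mulVec_single_one] at h2
  exact h2.symm

noncomputable def blkX (n : ℕ) (M : ℕ → Matrix (Fin d) (Fin d) k) : Matrix (Fin (n + 1) × Fin d) (Fin (n + 1) × Fin d) k[X] :=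
  Matrix.of fun q r => if q.1 = r.1 then C (M q.1 q.2 r.2) else 0

theorem io_apply (M : Matrix (Fin d) (Fin d) k) (v : Fin d → RatFunc k) (s : Fin d) :
    io k d M v s = ∑ s', algebraMap k (RatFunc k) (M s s') * v s' := rfl

theorem blkX_mulVec (M : ℕ → Matrix (Fin d) (Fin d) k) (c : Fin (n + 1) × Fin d → k[X]) (a : Fin (n + 1)) :
    toF k d (fun s => (blkX n M).mulVec c (a, s)) = io k d (M a) (toF k d (fun s => c (a, s))) := by
  funext s
  rw [io_apply]
  show algebraMap k[X] (RatFunc k) _ = _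
  simp only [Matrix.mulVec, dotProduct, Fintype.sum_prod_type, blkX, Matrix.of_apply]
  rw [Finset.sum_eq_single a]
  · rw [map_sum]
    refine Finset.sum_congr rfl fun s' _ => ?_
    rw [if_pos rfl, map_mul]
    simp [RatFunc.algebraMap_eq_C, toF]
  · intro b _ hb
    refine Finset.sum_eq_zero fun s' _ => ?_
    rw [if_neg (Ne.symm hb), zero_mul]
  · simp

theorem blkX_map (M : ℕ → Matrix (Fin d) (Fin d) k) :
    (blkX n M).map (algebraMap k[X] (RatFunc k)) = blk n (fun a => io k d (M a)) := by
  ext ⟨a, s⟩ ⟨b, s'⟩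
  simp only [blk, matb, Matrix.of_apply, LinearMap.comp_apply, sg_apply, Matrix.map_apply, blkX]
  by_cases h : a = b
  · subst h
    simp [io_apply, Pi.single_apply, RatFunc.algebraMap_eq_C]
  · have : (a : ℕ) ≠ b := fun h' => h (Fin.ext h')
    simp [this, h]

theorem blkX_idem (M : ℕ → Matrix (Fin d) (Fin d) k) (h : ∀ a, M a * M a = M a) : blkX n M * blkX n M = blkX n M := by
  ext ⟨a, s⟩ ⟨b, s'⟩ : 2
  simp only [Matrix.mul_apply, Fintype.sum_prod_type, blkX, Matrix.of_apply]
  rw [Finset.sum_eq_single a]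
  · simp only [if_true]
    by_cases hab : a = b
    · subst hab
      simp only [if_true, ← C_mul, ← map_sum]
      rw [← Matrix.mul_apply, h]
    · simp [hab]
  · intro b _ hb
    refine Finset.sum_eq_zero fun s' _ => ?_
    rw [if_neg (Ne.symm hb), zero_mul]
  · simp
end Lat2
end

section
open Polynomial Module
set_option linter.unusedSectionVars false
set_option linter.unusedSimpArgs false
set_option linter.unusedVariables false

theorem ring_AE {A : Type*} [Ring A] (E f a g : A) (h1 : f * a = g) (h2 : E * f = f * E) (h3 : E * E = E) :
    (E * f + (1 - E)) * (E * a + (1 - E)) = E * g + (1 - E) := by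
  have e1 : E * f * (1 - E) = 0 := by rw [h2, mul_assoc, mul_sub, h3, mul_one, sub_self, mul_zero]
  have e2 : (1 - E) * (E * a) = 0 := by rw [← mul_assoc, sub_mul, h3, one_mul, sub_self, zero_mul]
  have e3 : (1 - E) * (1 - E) = 1 - E := by rw [mul_sub, mul_one, sub_mul, h3]; simp
  have e4 : E * f * (E * a) = E * g := by
    rw [h2, mul_assoc, ← mul_assoc E E, h3, ← mul_assoc, ← h2, mul_assoc, h1]
  rw [add_mul, mul_add, mul_add, e1, e2, e3, e4]; simp

theorem step {k : Type} [Field k] [CharZero k] {d n : ℕ} {I : Type*} [Fintype I] [DecidableEq I] {p : I → I → ℕ}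
    (hp : ∀ i j, p i j = 0 ↔ p j i = 0)
    {xm : ℕ → Matrix (Fin d) (Fin d) k} {em : ℕ → I → Matrix (Fin d) (Fin d) k} {τm : ℕ → Matrix (Fin d) (Fin d) k}
    (Hm : KRel p xm em τm) (honem : ∀ b < n, ∑ j, em b j = 1) (hvm : ∀ b, n ≤ b → ∀ j, em b j = 0)
    (ℓ : I → ℕ) (hcm : cyc xm em ℓ = 0) (i : I) :
    ∃ (d' : ℕ) (x' : ℕ → Matrix (Fin d') (Fin d') k) (e' : ℕ → I → Matrix (Fin d') (Fin d') k)
      (τ' : ℕ → Matrix (Fin d') (Fin d') k), KRel p x' e' τ' ∧ (∀ b < n + 1, ∑ j, e' b j = 1) ∧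
        (∀ b, n + 1 ≤ b → ∀ j, e' b j = 0) ∧ cyc x' e' ℓ = 0 ∧
        ∀ μ : ℕ → I, ((EN e' (n + 1) μ).rank : ℤ) = ∑ a ∈ Finset.range (n + 1), if μ a = i then
          (ℓ i + ∑ b ∈ Finset.range a, (if μ b = i then -2 else (p i (μ b) : ℤ))) * ((EN em n (rem μ a)).rank : ℤ) else 0 := by
  classical
  obtain ⟨Z, X⟩ := exists_Z xm
  set x : ℕ → Module.End (RatFunc k) (Fin d → RatFunc k) := fun b => io k d (xm b) with hx
  set e : ℕ → I → Module.End (RatFunc k) (Fin d → RatFunc k) := fun b j => io k d (em b j) with he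
  set τ : ℕ → Module.End (RatFunc k) (Fin d → RatFunc k) := fun b => io k d (τm b) with hτ
  set t := tX k d with ht
  have H : KRel p x e τ := Hm.map (io k d)
  have hone : ∀ b < n, ∑ j, e b j = 1 := fun b hb => by
    rw [← map_one (io k d), ← honem b hb, map_sum]
  have hv : ∀ b, n ≤ b → ∀ j, e b j = 0 := fun b hb j => by
    rw [he]; show io k d (em b j) = 0; rw [hvm b hb j, map_zero]
  have hc : cyc x e ℓ = 0 := by
    have := congrArg (io k d) hcm
    simpa [cyc] using this
  let P0 : AddSubgroup (Fin d → RatFunc k) := (toF k d).toAddMonoidHom.range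
  have hio : ∀ M : Matrix (Fin d) (Fin d) k, ∀ v ∈ P0, io k d M v ∈ P0 := by
    rintro M _ ⟨c, rfl⟩
    refine ⟨fun s => ∑ s', C (M s s') * c s', ?_⟩
    funext s
    rw [io_apply]
    show algebraMap k[X] (RatFunc k) (∑ s', C (M s s') * c s') = _
    rw [map_sum]
    refine Finset.sum_congr rfl fun s' _ => ?_
    rw [map_mul]
    simp [RatFunc.algebraMap_eq_C, toF]
  have hx0 : ∀ b, ∀ v ∈ P0, x b v ∈ P0 := fun b => hio _
  have he0 : ∀ b j, ∀ v ∈ P0, e b j v ∈ P0 := fun b j => hio _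
  have hτ0 : ∀ b, ∀ v ∈ P0, τ b v ∈ P0 := fun b => hio _
  have ht0 : ∀ v ∈ P0, t v ∈ P0 := by
    rintro _ ⟨c, rfl⟩
    refine ⟨fun s => Polynomial.X * c s, ?_⟩
    funext s
    simp [toF, ht, tX]
  set bi : ℕ → ((Fin d → RatFunc k) →ₗ[RatFunc k] (ℕ → Fin d → RatFunc k)) := fun a => bI p x e τ t Z i n (n - a) with hbi
  set bn : ℕ → ((Fin d → RatFunc k) →ₗ[RatFunc k] (ℕ → Fin d → RatFunc k)) := fun a => bN p x e τ t Z i (ℓ i) a with hbn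
  have hmem : ∀ (b : ℕ → ((Fin d → RatFunc k) →ₗ[RatFunc k] (ℕ → Fin d → RatFunc k))) (r : ℕ) (hr : r ≤ n),
      ∀ v ∈ P0, b r v ∈ LinearMap.range (lat n b) := by
    rintro b r hr _ ⟨c, rfl⟩
    refine ⟨fun q => if q.1 = (⟨r, by omega⟩ : Fin (n + 1)) then c q.2 else 0, ?_⟩
    show ∑ r' : Fin (n + 1), b r' (toF k d _) = _
    rw [Finset.sum_eq_single (⟨r, by omega⟩ : Fin (n + 1))]
    · simp
    · intro r' _ hr'
      simp only [if_neg hr']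
      have : toF k d (fun _ => 0) = 0 := map_zero (toF k d)
      rw [this, map_zero]
    · simp
  have hLI : ∀ y, y ∈ LinearMap.range (lat n bi) ↔ y ∈ LI p x e τ t Z i n P0 := by
    intro y
    constructor
    · rintro ⟨c, rfl⟩
      show ∑ r' : Fin (n + 1), bi r' (toF k d (fun s => c (r', s))) ∈ LI p x e τ t Z i n P0
      refine AddSubgroup.sum_mem _ (fun r _ => ?_)
      exact bI_mem (r := n - (r : ℕ)) i P0 (Nat.sub_le _ _) ⟨_, rfl⟩
    · intro hy
      refine LI_ind (C := (LinearMap.range (lat n bi)).toAddSubgroup) i P0 ?_ hy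
      intro r hr v hv
      have := hmem bi (n - r) (by omega) v hv
      simp only [hbi] at this
      rw [show n - (n - r) = r by omega] at this
      exact this
  have hLN : ∀ y, y ∈ LinearMap.range (lat n bn) ↔ y ∈ LN p x e τ t Z i n P0 (ℓ i) := by
    intro y
    constructor
    · rintro ⟨c, rfl⟩
      show ∑ r' : Fin (n + 1), bn r' (toF k d (fun s => c (r', s))) ∈ LN p x e τ t Z i n P0 (ℓ i)
      refine AddSubgroup.sum_mem _ (fun r _ => ?_)
      exact bN_mem (r := (r : ℕ)) i P0 (Nat.lt_succ_iff.1 r.2) ⟨_, rfl⟩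
    · intro hy
      exact LN_ind (C := (LinearMap.range (lat n bn)).toAddSubgroup) i P0 (fun r hr v hv => hmem bn r hr v hv) hy
  have hle : LinearMap.range (lat n bn) ≤ LinearMap.range (lat n bi) := fun y hy =>
    (hLI y).2 (LN_le_LI i H X hone hv P0 hx0 he0 hτ0 ht0 ℓ hc ((hLN y).1 hy))
  obtain ⟨A, hA⟩ := exists_factor _ _ hle
  have hΦA := lat_mat bi bn A hA
  have hbi1 : ∀ a ≤ n, ∀ v, bi a v a = v := fun a ha v => by
    have := (bI_comp (p := p) (x := x) (τ := τ) (t := t) (Z := Z) i hone (n - a) (by omega) v).1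
    rwa [show n - (n - a) = a by omega] at this
  have hbi2 : ∀ r ≤ n, ∀ v, ∀ a < r, bi r v a = 0 := fun r hr v a ha => 
    (bI_comp (p := p) (x := x) (τ := τ) (t := t) (Z := Z) i hone (n - r) (by omega) v).2.1 a (by omega)
  have hbn1 : ∀ a, ∀ v, bn a v a = DN p x e t Z i (ℓ i) a v := fun a v => 
    (bN_comp (p := p) (x := x) (e := e) (τ := τ) (t := t) (Z := Z) i (ℓ i) a v).1
  have hbn2 : ∀ r, ∀ v, ∀ a > r, bn r v a = 0 := fun r v a ha => 
    (bN_comp (p := p) (x := x) (e := e) (τ := τ) (t := t) (Z := Z) i (ℓ i) r v).2 a ha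
  have hdetΦ : (matb n bi).det = 1 := by
    rw [det_matb bi 1 hbi1 (Or.inl hbi2)]; simp
  have hdetΨ : (matb n bn).det ≠ 0 := by
    rw [det_matb bn (DN p x e t Z i (ℓ i)) (fun a _ => hbn1 a) (Or.inr fun r _ => hbn2 r)]
    exact Finset.prod_ne_zero_iff.2 fun a ha => det_DN hp Hm X i honem _ a (by have := Finset.mem_range.1 ha; omega)
  have hinj : Function.Injective (lat n bi) := lat_inj bi (by rw [hdetΦ]; exact one_ne_zero)
  have hdetA : A.det ≠ 0 := by
    intro h0
    apply hdetΨ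
    rw [← hΦA, Matrix.det_mul, ← RingHom.mapMatrix_apply, ← RingHom.map_det, h0, map_zero, mul_zero]
  obtain ⟨d', ρ, hρ0, hρr⟩ := lattice_quot (F := RatFunc k) (lat n bi) (lat n bn) A hA hinj hdetA
  have hSW : ∀ f ∈ SW x e t i, f ∈ presS (F := RatFunc k) (LinearMap.range (lat n bi)) (LinearMap.range (lat n bn)) := by
    intro f hf
    exact ⟨fun y hy => (hLI _).2 ((LI_stab0 i H X P0 hx0 he0 hτ0 ht0).1 f hf y ((hLI y).1 hy)),
      fun y hy => (hLN _).2 ((LN_stab0 i H X P0 hx0 he0 hτ0 ht0 (ℓ i)).1 f hf y ((hLN y).1 hy))⟩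
  let xS : ℕ → presS (F := RatFunc k) (LinearMap.range (lat n bi)) (LinearMap.range (lat n bn)) :=
    fun b => ⟨dg (xf x t b), hSW _ (x_mem_polyS _)⟩
  let eS : ℕ → I → presS (F := RatFunc k) (LinearMap.range (lat n bi)) (LinearMap.range (lat n bn)) :=
    fun b j => ⟨dg (ef e i b j), hSW _ (e_mem_polyS _ _)⟩
  let τS : ℕ → presS (F := RatFunc k) (LinearMap.range (lat n bi)) (LinearMap.range (lat n bn)) :=
    fun b => ⟨TT p x e τ t Z i b, fun y hy => (hLI _).2 (LI_T i H X hv P0 hx0 he0 hτ0 ht0 b y ((hLI y).1 hy)),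
      fun y hy => (hLN _).2 (LN_T i H X hv P0 hx0 he0 hτ0 ht0 (ℓ i) b y ((hLN y).1 hy))⟩
  have HS : KRel p xS eS τS := (W_rel i H X).comap (Subring.subtype _) Subtype.val_injective
    (fun _ => rfl) (fun _ _ => rfl) (fun _ => rfl)
  have hbig : ∀ c, ∀ a > n, lat n bi c a = 0 := by
    intro c a ha
    show (∑ r : Fin (n + 1), bi r (toF k d (fun s => c (r, s)))) a = 0
    rw [Finset.sum_apply]
    exact Finset.sum_eq_zero fun r _ => 
      (bI_comp (p := p) (x := x) (τ := τ) (t := t) (Z := Z) i hone (n - r) (by omega) _).2.2 a ha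
  refine ⟨d', _, _, _, HS.map ρ, ?_, ?_, ?_, ?_⟩
  · intro b hb
    rw [← map_sum, ← map_one ρ, ← sub_eq_zero, ← map_sub]
    apply hρ0
    intro c
    convert Submodule.zero_mem (LinearMap.range (lat n bn))
    have h1 : ((∑ j, eS b j - 1 : presS (F := RatFunc k) (LinearMap.range (lat n bi)) (LinearMap.range (lat n bn))) : Module.End (RatFunc k) (ℕ → Fin d → RatFunc k)) = dg (∑ j, ef e i b j - 1) := by
      rw [map_sub, map_sum, map_one]
      push_cast
      rfl
    rw [h1]
    funext a
    rw [dg_apply]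
    rcases le_or_gt a n with ha | ha
    · have : (∑ j, ef e i b j - 1) a = 0 := by
        rw [Pi.sub_apply, Finset.sum_apply, Pi.one_apply]
        rcases lt_trichotomy b a with h | h | h
        · simp only [ef_gt e i h]; rw [hone b (by omega), sub_self]
        · subst h; simp only [ef_eq]; simp
        · simp only [ef_lt e i h]; rw [hone (b - 1) (by omega), sub_self]
      rw [this]; rfl
    · rw [hbig c a ha, map_zero]; rfl
  · intro b hb j
    apply hρ0
    intro c
    convert Submodule.zero_mem (LinearMap.range (lat n bn))
    funext a
    show dg (ef e i b j) (lat n bi c) a = 0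
    rw [dg_apply]
    rcases le_or_gt a n with ha | ha
    · rw [ef_lt e i (by omega), hv (b - 1) (by omega)]; rfl
    · rw [hbig c a ha, map_zero]
  · have h1 : cyc (fun b => ρ (xS b)) (fun b j => ρ (eS b j)) ℓ = ρ (cyc xS eS ℓ) := by simp [cyc]
    rw [h1]
    apply hρ0
    intro c
    rw [hLN]
    have h2 : ((cyc xS eS ℓ : presS (F := RatFunc k) (LinearMap.range (lat n bi)) (LinearMap.range (lat n bn))) : Module.End (RatFunc k) (ℕ → Fin d → RatFunc k)) =
        cyc (fun b => dg (xf x t b)) (fun b j => dg (ef e i b j)) ℓ := by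
      simp only [cyc]; push_cast; rfl
    rw [h2]
    exact cyc_LI i hone P0 ℓ hc _ ((hLI _).1 ⟨c, rfl⟩)
  · intro μ
    have h1 : EN (fun b j => ρ (eS b j)) (n + 1) μ = ρ (EN eS (n + 1) μ) := (map_EN ρ eS (n + 1) μ).symm
    have h2 : ((EN eS (n + 1) μ : presS (F := RatFunc k) (LinearMap.range (lat n bi)) (LinearMap.range (lat n bn))) : Module.End (RatFunc k) (ℕ → Fin d → RatFunc k)) =
        EN (fun b j => dg (ef e i b j)) (n + 1) μ := map_EN (Subring.subtype _) eS (n + 1) μ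
    rw [h1]
    set E' := blkX n (EaM em n i μ) with hE'
    have hE'i : E' * E' = E' := blkX_idem _ (EaM_idem Hm i μ)
    set g : ℕ → Module.End (RatFunc k) (Fin d → RatFunc k) := fun a => io k d (EaM em n i μ a) with hg
    have hgE : ∀ a, g a = Ea e i n μ a := fun a => (EaM_io i μ a).symm
    have hEmap : E'.map (algebraMap k[X] (RatFunc k)) = blk n g := blkX_map _
    have hcomp : ∀ w : ℕ → Fin d → RatFunc k, ∀ a ≤ n, EN (fun b j => dg (ef e i b j)) (n + 1) μ w a = g a (w a) := by
      intro w a ha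
      rw [← map_EN, dg_apply, EN_ef i n a μ ha, hgE]; rfl
    have hcommI : ∀ r ≤ n, ∀ v, EN (fun b j => dg (ef e i b j)) (n + 1) μ (bi r v) = bi r (g r v) := by
      intro r hr v
      have := EN_bI i H X (n - r) (by omega) μ v (n := n)
      rw [show n - (n - r) = r by omega, ← hgE] at this
      exact this
    have hcommN : ∀ r ≤ n, ∀ v, EN (fun b j => dg (ef e i b j)) (n + 1) μ (bn r v) = bn r (g r v) := by
      intro r hr v
      have := EN_bN i H X (ℓ i) r hr μ v (n := n)
      rw [← hgE] at this
      exact this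
    have hlat : ∀ (b : ℕ → ((Fin d → RatFunc k) →ₗ[RatFunc k] (ℕ → Fin d → RatFunc k))),
        (∀ r ≤ n, ∀ v, EN (fun b j => dg (ef e i b j)) (n + 1) μ (b r v) = b r (g r v)) →
        ∀ c, (EN eS (n + 1) μ).1 (lat n b c) = lat n b (E'.mulVec c) := by
      intro b hb c
      rw [h2]
      show EN (fun b j => dg (ef e i b j)) (n + 1) μ (∑ r : Fin (n + 1), b r (toF k d (fun s => c (r, s)))) = 
        ∑ r : Fin (n + 1), b r (toF k d (fun s => E'.mulVec c (r, s)))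
      rw [map_sum]
      refine Finset.sum_congr rfl fun r _ => ?_
      rw [hb r (by omega), hE', blkX_mulVec]
    have hcommM : ∀ (b : ℕ → ((Fin d → RatFunc k) →ₗ[RatFunc k] (ℕ → Fin d → RatFunc k))),
        (∀ r ≤ n, ∀ v, EN (fun b j => dg (ef e i b j)) (n + 1) μ (b r v) = b r (g r v)) →
        blk n g * matb n b = matb n b * blk n g := by
      intro b hb
      rw [blk_mul_matb, matb_mul_blk]
      ext q r
      show dg g (b r.1 _) q.1 q.2 = b r.1 (g r.1 _) q.1 q.2
      rw [dg_apply, ← hb r.1 (by omega), hcomp _ _ (by omega)]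
    have hform : ∀ b : ℕ → ((Fin d → RatFunc k) →ₗ[RatFunc k] (ℕ → Fin d → RatFunc k)),
        blk n g * matb n b + (1 - blk n g) = matb n (fun r => dg g ∘ₗ b r + (sg r ∘ₗ (1 : ℕ → Module.End (RatFunc k) (Fin d → RatFunc k)) r - sg r ∘ₗ g r)) := by
      intro b
      rw [blk_mul_matb, ← blk_one]; rfl
    have hgi : ∀ a, g a * g a = g a := fun a => ioE _ (EaM_idem Hm i μ a)
    have hblki : blk n g * blk n g = blk n g := by
      rw [← hEmap, ← Matrix.map_mul, hE'i]
    have hring := ring_AE (blk n g) (matb n bi) (A.map (algebraMap k[X] (RatFunc k))) (matb n bn) hΦA (hcommM bi hcommI) hblki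
    have hd1 : (blk n g * matb n bi + (1 - blk n g)).det = 1 := by
      rw [hform, det_matb _ 1 _ (Or.inl _)]
      · simp
      · intro a ha v
        simp only [Pi.add_apply, LinearMap.add_apply, LinearMap.sub_apply, Pi.sub_apply, LinearMap.comp_apply, dg_apply,
          sg_same, hbi1 a ha]
        simp
      · intro r hr v a ha
        simp only [Pi.add_apply, LinearMap.add_apply, LinearMap.sub_apply, Pi.sub_apply, LinearMap.comp_apply, dg_apply,
          sg_ne ha.ne, hbi2 r hr v a ha]
        simp
    have hd2 : (blk n g * matb n bn + (1 - blk n g)).det = ∏ a ∈ Finset.range (n + 1), dE (g a) (DN p x e t Z i (ℓ i) a) := by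
      rw [hform, det_matb _ (fun a => g a * DN p x e t Z i (ℓ i) a + (1 - g a)) _ (Or.inr _)]
      · rfl
      · intro a ha v
        simp only [Pi.add_apply, LinearMap.add_apply, LinearMap.sub_apply, Pi.sub_apply, LinearMap.comp_apply, dg_apply,
          sg_same, hbn1 a]
        rfl
      · intro r hr v a ha
        simp only [Pi.add_apply, LinearMap.add_apply, LinearMap.sub_apply, Pi.sub_apply, LinearMap.comp_apply, dg_apply,
          sg_ne ha.ne', hbn2 r v a ha]
        simp
    have hdAE : algebraMap k[X] (RatFunc k) (E' * A + (1 - E')).det = ∏ a ∈ Finset.range (n + 1), dE (g a) (DN p x e t Z i (ℓ i) a) := by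
      rw [← hd2, ← hring, Matrix.det_mul, hd1, one_mul, ← hEmap, RingHom.map_det]
      congr 1
      rw [map_add, map_mul, map_sub, map_one]; rfl
    have hHD := HD.prod (Finset.range (n + 1)) (fun a => dE (g a) (DN p x e t Z i (ℓ i) a)) _
      (fun a ha => HD_Ea hp Hm X i (ℓ i) μ a (by have := Finset.mem_range.1 ha; omega))
    rw [← hdAE] at hHD
    obtain ⟨n1, n2⟩ := hHD
    rw [RatFunc.intDegree_polynomial] at n2
    rw [hρr _ E' hE'i (hlat bi hcommI) (hlat bn hcommN) (by intro h0; apply n1; rw [h0, map_zero]), n2]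
end

/-- insert the value `a` at the last place of a permutation -/
def insLast {n : ℕ} (q : Fin (n + 1) × Equiv.Perm (Fin n)) : Equiv.Perm (Fin (n + 1)) :=
  (finSuccEquivLast.trans q.2.optionCongr).trans (finSuccEquiv' q.1).symm

theorem insLast_last {n : ℕ} (q : Fin (n + 1) × Equiv.Perm (Fin n)) : insLast q (Fin.last n) = q.1 := by
  simp [insLast]

theorem insLast_castSucc {n : ℕ} (q : Fin (n + 1) × Equiv.Perm (Fin n)) (j : Fin n) :
    insLast q j.castSucc = q.1.succAbove (q.2 j) := by
  simp [insLast]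

theorem insLast_bij {n : ℕ} : Function.Bijective (insLast (n := n)) := by
  rw [Fintype.bijective_iff_injective_and_card]
  constructor
  · rintro ⟨a, w⟩ ⟨a', w'⟩ h
    have h1 : a = a' := by
      have := congrArg (fun f => f (Fin.last n)) h
      simpa [insLast_last] using this
    subst h1
    have h2 : w = w' := by
      ext j
      have := congrArg (fun f => f j.castSucc) h
      simp only [insLast_castSucc] at this
      rw [Fin.succAbove_right_injective this]
    rw [h2]
  · rw [Fintype.card_prod, Fintype.card_perm, Fintype.card_perm]
    simp [Nat.factorial_succ]

/-- the sum of products over the permutations carrying one word to the other -/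
def SSum {I : Type*} [DecidableEq I] (a : I → I → ℤ) (L : I → ℤ) (n : ℕ) (ν ν' : Fin n → I) : ℤ :=
  ∑ w : Equiv.Perm (Fin n), if ∀ k, ν' (w k) = ν k then ∏ t : Fin n, Nfun a L w ν t else 0

theorem Nfun_insLast_castSucc {I : Type*} (a : I → I → ℤ) (L : I → ℤ) {n : ℕ} (ν : Fin (n + 1) → I)
    (q : Fin (n + 1) × Equiv.Perm (Fin n)) (t : Fin n) :
    Nfun a L (insLast q) ν t.castSucc = Nfun a L q.2 (fun k => ν k.castSucc) t := by
  unfold Nfun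
  congr 1
  rw [Finset.sum_filter, Finset.sum_filter, Fin.sum_univ_castSucc]
  rw [if_neg (by simp [Fin.le_last]), add_zero]
  refine Finset.sum_congr rfl fun j _ => ?_
  simp only [insLast_castSucc, Fin.castSucc_lt_castSucc_iff, Fin.succAbove_lt_succAbove_iff]

theorem Nfun_insLast_last {I : Type*} (a : I → I → ℤ) (L : I → ℤ) {n : ℕ} (ν ν' : Fin (n + 1) → I)
    (q : Fin (n + 1) × Equiv.Perm (Fin n)) (h : ∀ k, ν' (insLast q k) = ν k) :
    Nfun a L (insLast q) ν (Fin.last n) =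
      L (ν (Fin.last n)) - ∑ b, if b < q.1 then a (ν (Fin.last n)) (ν' b) else 0 := by
  unfold Nfun
  congr 1
  rw [Finset.sum_filter, ← Equiv.sum_comp (insLast q) (fun b => if b < q.1 then a (ν (Fin.last n)) (ν' b) else 0)]
  refine Finset.sum_congr rfl fun j _ => ?_
  rw [insLast_last, h]
  refine if_congr ?_ rfl rfl
  refine ⟨fun h => h.2, fun h' => ⟨?_, h'⟩⟩
  refine lt_of_le_of_ne (Fin.le_last j) ?_
  rintro rfl
  rw [insLast_last] at h'
  exact lt_irrefl _ h'

theorem SSum_succ {I : Type*} [DecidableEq I] (a : I → I → ℤ) (L : I → ℤ) (n : ℕ) (ν ν' : Fin (n + 1) → I) :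
    SSum a L (n + 1) ν ν' = ∑ s : Fin (n + 1), if ν' s = ν (Fin.last n) then
      (L (ν (Fin.last n)) - ∑ b, if b < s then a (ν (Fin.last n)) (ν' b) else 0) *
        SSum a L n (fun k => ν k.castSucc) (fun k => ν' (s.succAbove k)) else 0 := by
  unfold SSum
  rw [← Function.Bijective.sum_comp insLast_bij, Fintype.sum_prod_type]
  refine Finset.sum_congr rfl fun s _ => ?_
  split_ifs with hs
  · rw [Finset.mul_sum]
    refine Finset.sum_congr rfl fun w _ => ?_
    have hiff : (∀ k, ν' (insLast (s, w) k) = ν k) ↔ ∀ k, ν' (s.succAbove (w k)) = ν k.castSucc := by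
      rw [Fin.forall_fin_succ']
      simp only [insLast_castSucc, insLast_last, hs, and_true]
    by_cases h : ∀ k, ν' (insLast (s, w) k) = ν k
    · rw [if_pos h, if_pos (hiff.1 h), Fin.prod_univ_castSucc, Nfun_insLast_last a L ν ν' _ h, mul_comm]
      congr 1
      exact Finset.prod_congr rfl fun t _ => Nfun_insLast_castSucc a L ν _ t
    · rw [if_neg h, if_neg (fun h' => h (hiff.2 h')), mul_zero]
  · refine Finset.sum_eq_zero fun w _ => ?_
    rw [if_neg]
    intro h
    have := h (Fin.last n)
    rw [insLast_last] at this
    exact hs this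

theorem SSum_rank {I : Type*} [Fintype I] [DecidableEq I] (a : I → I → ℤ) (L : I → ℤ)
    (ha2 : ∀ i, a i i = 2) (p : I → I → ℕ) (hpa : ∀ i j, i ≠ j → (p i j : ℤ) = - a i j)
    (hp : ∀ i j, p i j = 0 ↔ p j i = 0) (ℓ : I → ℕ) (hℓ : ∀ i, (ℓ i : ℤ) = L i) (n : ℕ) (ν : Fin n → I) :
    ∃ (d : ℕ) (x : ℕ → Matrix (Fin d) (Fin d) ℚ) (e : ℕ → I → Matrix (Fin d) (Fin d) ℚ)
      (τ : ℕ → Matrix (Fin d) (Fin d) ℚ), KRel p x e τ ∧ (∀ b < n, ∑ j, e b j = 1) ∧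
        (∀ b, n ≤ b → ∀ j, e b j = 0) ∧ cyc x e ℓ = 0 ∧
        ∀ μ : ℕ → I, ((EN e n μ).rank : ℤ) = SSum a L n ν (fun k => μ k) := by
  induction n with
  | zero =>
    refine ⟨1, fun _ => 0, fun _ _ => 0, fun _ => 0, ?_, ?_, ?_, ?_, ?_⟩
    · constructor <;> simp
    · simp
    · simp
    · simp [cyc]
    · intro μ
      simp [EN, SSum, Matrix.rank_one]
  | succ n ih =>
    obtain ⟨d, xm, em, τm, Hm, h1, h2, h3, h4⟩ := ih (fun k => ν k.castSucc)
    obtain ⟨d', x, e, τ, H, g1, g2, g3, g4⟩ := step hp Hm h1 h2 ℓ h3 (ν (Fin.last n))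
    refine ⟨d', x, e, τ, H, g1, g2, g3, fun μ => ?_⟩
    rw [g4, SSum_succ, Finset.sum_range]
    refine Finset.sum_congr rfl fun s _ => ?_
    refine if_congr Iff.rfl ?_ rfl
    rw [h4]
    congr 1
    · rw [hℓ, sub_eq_add_neg, ← Finset.sum_neg_distrib]
      congr 1
      have hs : (s : ℕ) ≤ n + 1 := s.2.le
      refine Eq.trans ?_ (Finset.sum_range (fun b => -(if b < (s : ℕ) then a (ν (Fin.last n)) (μ b) else 0)) (n := n + 1))
      · rw [← Finset.sum_subset (Finset.range_subset_range.2 hs)]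
        · refine Finset.sum_congr rfl fun b hb => ?_
          rw [if_pos (Finset.mem_range.1 hb)]
          split_ifs with hi
          · rw [hi, ha2]
          · exact hpa _ _ (Ne.symm hi)
        · intro b _ hb
          rw [if_neg (fun h => hb (Finset.mem_range.2 h)), neg_zero]
    · congr 1
      funext k
      simp only [rem, Fin.succAbove, Fin.lt_def, Fin.val_castSucc]
      split_ifs <;> simp

/-- Non-negativity (consequence of Corollary 3.2 of the paper): if `a` is a symmetrizable
generalized Cartan matrix (`a(i,i) = 2`, `a(i,j) ≤ 0` for `i ≠ j`, and `d_i·a(i,j) = d_j·a(j,i)`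
for positive integers `d_i`) and `L ≥ 0`, then for all `n` and all `ν, ν' ∈ I^n`,
`Σ_{w ∈ S(ν,ν')} ∏_t N(w,ν,t) ≥ 0`. -/
theorem stmt16 {I : Type*} [DecidableEq I] (a : I → I → ℤ) (L : I → ℤ)
    (ha2 : ∀ i, a i i = 2) (haneg : ∀ i j, i ≠ j → a i j ≤ 0)
    (dd : I → ℤ) (hdd : ∀ i, 0 < dd i) (hsym : ∀ i j, dd i * a i j = dd j * a j i)
    (hL : ∀ i, 0 ≤ L i)
    (n : ℕ) (ν ν' : Fin n → I) :
    0 ≤ ∑ w ∈ Finset.univ.filter (fun w : Equiv.Perm (Fin n) => ∀ k, ν (w⁻¹ k) = ν' k),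
          ∏ t : Fin n, Nfun a L w ν t := by
  have hcond : ∀ w : Equiv.Perm (Fin n), (∀ k, ν (w⁻¹ k) = ν' k) ↔ ∀ k, ν' (w k) = ν k := by
    intro w
    constructor
    · intro h k
      rw [← h (w k)]; simp
    · intro h k
      rw [← h (w⁻¹ k)]; simp
  have hz : ∀ i j, a i j = 0 → a j i = 0 := by
    intro i j h
    have := hsym i j
    rw [h, mul_zero] at this
    exact (mul_eq_zero.1 this.symm).resolve_left (hdd j).ne'
  rcases Nat.eq_zero_or_pos n with rfl | hn
  · exact Finset.sum_nonneg fun w _ => by simp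
  let S : Finset I := Finset.image ν Finset.univ ∪ Finset.image ν' Finset.univ
  let J := {i // i ∈ S}
  let m : Fin n → J := fun k => ⟨ν k, Finset.mem_union_left _ (Finset.mem_image_of_mem _ (Finset.mem_univ _))⟩
  let m' : Fin n → J := fun k => ⟨ν' k, Finset.mem_union_right _ (Finset.mem_image_of_mem _ (Finset.mem_univ _))⟩
  have hp : ∀ i j : J, (-a i j).toNat = 0 ↔ (-a j i).toNat = 0 := by
    intro i j
    by_cases hij : i = j
    · rw [hij]
    · have u1 := haneg i j (fun h => hij (Subtype.ext h))
      have u2 := haneg j i (fun h => hij (Subtype.ext h.symm))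
      have u3 := hz i j
      have u4 := hz j i
      constructor <;> intro h <;> omega
  obtain ⟨d, x, e, τ, _, _, _, _, hr⟩ := SSum_rank (I := J) (fun i j => a i j) (fun i => L i) (fun i => ha2 i)
    (fun i j => (-a i j).toNat) (fun i j hij => Int.toNat_of_nonneg (by
      have := haneg i j (fun h => hij (Subtype.ext h)); omega)) hp (fun i => (L i).toNat)
    (fun i => Int.toNat_of_nonneg (hL i)) n m
  have hr' := hr (fun k => if h : k < n then m' ⟨k, h⟩ else m' ⟨0, hn⟩)
  have key : SSum (I := J) (fun i j => a i j) (fun i => L i) n m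
      (fun k => (fun k => if h : k < n then m' ⟨k, h⟩ else m' ⟨0, hn⟩) (k : ℕ)) =
      ∑ w ∈ Finset.univ.filter (fun w : Equiv.Perm (Fin n) => ∀ k, ν (w⁻¹ k) = ν' k),
          ∏ t : Fin n, Nfun a L w ν t := by
    rw [Finset.sum_filter]
    unfold SSum
    refine Finset.sum_congr rfl fun w _ => ?_
    refine if_congr ?_ rfl rfl
    rw [hcond]
    refine forall_congr' fun k => ?_
    simp only [Fin.is_lt, dite_true]
    exact Subtype.ext_iff
  rw [← key, ← hr']
  exact Int.natCast_nonneg _
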